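/- Let 1 ≤ n < N be integers and let K : (ℝ^N)^{n+2} → [0,∞) be a function such that K^2 is a proper integrand (with exponent p = 2). If E ⊂ ℝ^N is a Borel set with M_{K^2}(E) < ∞, then E is n-rectifiable. -/

import Mathlib

open MeasureTheory Metric Set
open scoped NNReal ENNReal

noncomputable section

/-- `x 0, …, x m` span an `(m,σ)`-simplex: the distance from each vertex to the affine
span of the remaining vertices is at least `σ`. -/
def IsHSimplex (N : ℕ) {m : ℕ} (σ : ℝ) (x : Fin (m + 1) → EuclideanSpace ℝ (Fin N)) : Prop :=
  ∀ i : Fin (m + 1),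
    σ ≤ Metric.infDist (x i)
      (affineSpan ℝ (x '' ({i}ᶜ : Set (Fin (m + 1)))) : Set (EuclideanSpace ℝ (Fin N)))

/-- The integral Menger curvature `M_{K^p}(μ) = ∫⋯∫ K^p dμ ⋯ dμ`. -/
def MengerEnergy (N n : ℕ) (p : ℝ) (K : (Fin (n + 2) → EuclideanSpace ℝ (Fin N)) → ℝ)
    (μ : Measure (EuclideanSpace ℝ (Fin N))) : ℝ≥0∞ :=
  ∫⁻ z, ENNReal.ofReal (K z ^ p) ∂(Measure.pi fun _ : Fin (n + 2) => μ)

/-- `K^p` is a proper integrand. -/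
def ProperIntegrand (N n : ℕ) (p : ℝ)
    (K : (Fin (n + 2) → EuclideanSpace ℝ (Fin N)) → ℝ) : Prop :=
  (∀ z, 0 ≤ K z) ∧ Measurable K ∧
  (∃ c : ℝ, 1 ≤ c ∧ ∃ l : ℝ, 1 ≤ l ∧
    ∀ t : ℝ, 0 < t → ∀ C : ℝ, 1 ≤ C → ∀ x : EuclideanSpace ℝ (Fin N),
      ∀ y : Fin (n + 1) → EuclideanSpace ℝ (Fin N),
        IsHSimplex N (t / C) y →
        convexHull ℝ (Set.range y) ⊆ Metric.closedBall x (C * t) →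
        ∀ w ∈ Metric.closedBall x (C * t),
          (Metric.infDist w (affineSpan ℝ (Set.range y) : Set (EuclideanSpace ℝ (Fin N))) / t) ^ p
            ≤ c * C ^ l * t ^ (n * (n + 1)) * K (Fin.snoc y w) ^ p) ∧
  (∀ t : ℝ, 0 < t → ∀ z : Fin (n + 2) → EuclideanSpace ℝ (Fin N),
      t ^ (n * (n + 1)) * K (fun i => t • z i) ^ p = K z ^ p) ∧
  (∀ b : EuclideanSpace ℝ (Fin N), ∀ z : Fin (n + 2) → EuclideanSpace ℝ (Fin N),
      K (fun i => z i + b) = K z)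

/-- `E` is `n`-rectifiable: up to an `H^n`-null set it is covered by countably many
Lipschitz images of `ℝ^n`. -/
def IsNRectifiable (N n : ℕ) (E : Set (EuclideanSpace ℝ (Fin N))) : Prop :=
  ∃ f : ℕ → EuclideanSpace ℝ (Fin n) → EuclideanSpace ℝ (Fin N),
    (∀ i, ∃ L : ℝ≥0, LipschitzWith L (f i)) ∧
    μH[(n : ℝ)] (E \ ⋃ i, Set.range (f i)) = 0

/-- Quantitative affine independence: the coefficients of a combination of total weight zero are
controlled by the norm of the combination. -/
def CoeffBound {ι E : Type*} [Fintype ι] [NormedAddCommGroup E] [NormedSpace ℝ E] (C : ℝ)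
    (y : ι → E) : Prop :=
  ∀ c : ι → ℝ, ∑ i, c i = 0 → ∀ j, |c j| ≤ C * ‖∑ i, c i • y i‖

section CoeffBound

variable {ι E F : Type*} [Fintype ι] [NormedAddCommGroup E] [NormedSpace ℝ E]
  [NormedAddCommGroup F] [NormedSpace ℝ F]

theorem CoeffBound.mono {C C' : ℝ} {y : ι → E} (h : CoeffBound C y) (hC : C ≤ C') :
    CoeffBound C' y := fun c hc j =>
  (h c hc j).trans (mul_le_mul_of_nonneg_right hC (norm_nonneg _))

theorem CoeffBound.of_approx {C a τ : ℝ} {y : ι → E} {z : ι → F} (h : CoeffBound C y)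
    (hC : 0 ≤ C) (hτ : 0 ≤ τ) (hCτ : C * Fintype.card ι * τ ≤ 1 / 2)
    (hyz : ∀ c : ι → ℝ, ∑ i, c i = 0 →
      ‖∑ i, c i • y i‖ ≤ a * ‖∑ i, c i • z i‖ + τ * ∑ i, |c i|) :
    CoeffBound (2 * C * a) z := by
  intro c hc j
  obtain ⟨m, -, hm⟩ := Finset.exists_max_image Finset.univ (fun i => |c i|) ⟨j, Finset.mem_univ j⟩
  have hsum : ∑ i, |c i| ≤ Fintype.card ι * |c m| := by
    have := Finset.sum_le_card_nsmul Finset.univ (fun i => |c i|) |c m| hm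
    simpa using this
  have h1 := h c hc m
  have h2 : C * ‖∑ i, c i • y i‖ ≤ C * (a * ‖∑ i, c i • z i‖ + τ * (Fintype.card ι * |c m|)) := by
    gcongr
    exact (hyz c hc).trans (by gcongr)
  have h3 : C * Fintype.card ι * τ * |c m| ≤ 1 / 2 * |c m| := by gcongr
  have h4 := hm j (Finset.mem_univ j)
  nlinarith

theorem CoeffBound.perturb {C τ : ℝ} {y z : ι → E} (h : CoeffBound C y) (hC : 0 ≤ C)
    (hτ : 0 ≤ τ) (hCτ : C * Fintype.card ι * τ ≤ 1 / 2) (hyz : ∀ i, ‖y i - z i‖ ≤ τ) :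
    CoeffBound (2 * C) z := by
  have := h.of_approx (a := 1) (z := z) hC hτ hCτ fun c _ => by
    have : ∑ i, c i • y i = ∑ i, c i • z i + ∑ i, c i • (y i - z i) := by
      simp [smul_sub]
    rw [this, one_mul, Finset.mul_sum]
    refine (norm_add_le _ _).trans (add_le_add le_rfl ((norm_sum_le _ _).trans ?_))
    refine Finset.sum_le_sum fun i _ => ?_
    rw [norm_smul, Real.norm_eq_abs, mul_comm]
    gcongr
    exact hyz i
  simpa using this

theorem CoeffBound.of_graph {C τ : ℝ} {y : ι → E} {G : Type*} [NormedAddCommGroup G]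
    [NormedSpace ℝ G] (h : CoeffBound C y) (hC : 0 ≤ C)
    (hτ : 0 ≤ τ) (hCτ : C * Fintype.card ι * τ ≤ 1 / 2) (P : E →L[ℝ] F) (Q : E →L[ℝ] G)
    (hPQ : ∀ x, ‖x‖ ≤ ‖P x‖ + ‖Q x‖) (Λ : F →L[ℝ] G) (hΛ : ‖Λ‖ ≤ 1) (b : G)
    (hy : ∀ i, ‖Q (y i) - (b + Λ (P (y i)))‖ ≤ τ) :
    CoeffBound (4 * C) (fun i => P (y i)) := by
  have := h.of_approx (a := 2) (z := fun i => P (y i)) hC hτ hCτ fun c hc => by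
    have h1 : Q (∑ i, c i • y i) = Λ (P (∑ i, c i • y i))
        + ∑ i, c i • (Q (y i) - (b + Λ (P (y i)))) := by
      simp only [map_sum, map_smul, smul_sub, smul_add, Finset.sum_sub_distrib,
        Finset.sum_add_distrib, ← Finset.sum_smul, hc]
      simp
    have h2 : ‖∑ i, c i • (Q (y i) - (b + Λ (P (y i))))‖ ≤ τ * ∑ i, |c i| := by
      rw [Finset.mul_sum]
      refine (norm_sum_le _ _).trans (Finset.sum_le_sum fun i _ => ?_)
      rw [norm_smul, Real.norm_eq_abs, mul_comm]
      gcongr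
      exact hy i
    have h3 : ‖Λ (P (∑ i, c i • y i))‖ ≤ ‖P (∑ i, c i • y i)‖ := by
      simpa using Λ.le_of_opNorm_le hΛ (P (∑ i, c i • y i))
    have h4 : ∑ i, c i • P (y i) = P (∑ i, c i • y i) := by simp
    rw [h4]
    have h5 := hPQ (∑ i, c i • y i)
    have h6 : ‖Q (∑ i, c i • y i)‖ ≤ ‖P (∑ i, c i • y i)‖ + τ * ∑ i, |c i| := by
      rw [h1]
      exact (norm_add_le _ _).trans (add_le_add h3 h2)
    linarith
  convert this using 1
  ring

theorem exists_coeff_of_mem_affineSpan_image {y : ι → E} {s : Set ι} {q : E}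
    (hq : q ∈ affineSpan ℝ (y '' s)) :
    ∃ c : ι → ℝ, ∑ i, c i = 1 ∧ (∀ i ∉ s, c i = 0) ∧ q = ∑ i, c i • y i := by
  classical
  obtain ⟨t, w, hts, hw, rfl⟩ := eq_affineCombination_of_mem_affineSpan_image hq
  refine ⟨fun i => if i ∈ t then w i else 0, ?_, fun i hi => ?_, ?_⟩
  · simpa using hw
  · exact if_neg fun h => hi (hts h)
  · rw [Finset.affineCombination_eq_linear_combination _ _ _ hw]
    simp [ite_smul]

theorem CoeffBound.affineIndependent {C : ℝ} {y : ι → E} (h : CoeffBound C y) :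
    AffineIndependent ℝ y := by
  rw [affineIndependent_iff_of_fintype]
  intro w hw hs i
  rw [Finset.weightedVSub_eq_linear_combination _ hw] at hs
  have := h w hw i
  rw [hs, norm_zero, mul_zero] at this
  exact abs_eq_zero.1 (le_antisymm this (abs_nonneg _))

theorem CoeffBound.isHSimplex {N m : ℕ} {C : ℝ} (hm : 1 ≤ m) (hC : 0 < C)
    {y : Fin (m + 1) → EuclideanSpace ℝ (Fin N)} (h : CoeffBound C y) :
    IsHSimplex N (1 / C) y := by
  intro i
  have hne : (affineSpan ℝ (y '' ({i}ᶜ : Set (Fin (m + 1)))) :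
      Set (EuclideanSpace ℝ (Fin N))).Nonempty := by
    rw [affineSpan_nonempty]
    have : Nontrivial (Fin (m + 1)) := Fin.nontrivial_iff_two_le.2 (by omega)
    obtain ⟨j, hj⟩ := exists_ne i
    exact ⟨y j, j, hj, rfl⟩
  refine (le_infDist hne).2 fun q hq => ?_
  obtain ⟨c, hc1, hci, rfl⟩ := exists_coeff_of_mem_affineSpan_image hq
  have h1 := h (fun j => (if j = i then 1 else 0) - c j)
    (by simp [Finset.sum_sub_distrib, hc1]) i
  have h2 : ∑ j, ((if j = i then 1 else 0) - c j) • y j = y i - ∑ j, c j • y j := by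
    simp [sub_smul, Finset.sum_sub_distrib, ite_smul]
  rw [h2, hci i (by simp)] at h1
  rw [dist_eq_norm, div_le_iff₀ hC, mul_comm]
  simpa using h1

theorem CoeffBound.snoc {m : ℕ} {C σ D : ℝ} {p : Fin (m + 1) → E} {w : E} (h : CoeffBound C p)
    (hC : 0 ≤ C) (hσ : 0 < σ) (hD : ‖w - p 0‖ ≤ D)
    (hw : ∀ v ∈ Submodule.span ℝ (range fun i => p i - p 0), σ ≤ ‖w - p 0 - v‖) :
    CoeffBound (C * (1 + D / σ) + 1 / σ)
      (Fin.snoc (α := fun _ => E) p w : Fin (m + 2) → E) := by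
  intro c hc
  set u := ∑ i, c i • (Fin.snoc (α := fun _ => E) p w : Fin (m + 2) → E) i with hu
  have hD0 : 0 ≤ D := (norm_nonneg _).trans hD
  set lam := c (Fin.last (m + 1)) with hlam
  have hu' : u = ∑ i : Fin (m + 1), c i.castSucc • p i + lam • w := by
    rw [hu, Fin.sum_univ_castSucc]
    simp [hlam]
  have hc' : ∑ i : Fin (m + 1), c i.castSucc = - lam := by
    rw [Fin.sum_univ_castSucc] at hc
    linarith
  have h1 : |lam| ≤ ‖u‖ / σ := by
    rw [le_div_iff₀ hσ]
    by_cases h0 : lam = 0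
    · simp [h0]
    have hv : ∑ i : Fin (m + 1), (- c i.castSucc / lam) • (p i - p 0) ∈
        Submodule.span ℝ (range fun i => p i - p 0) :=
      Submodule.sum_mem _ fun i _ => Submodule.smul_mem _ _ (Submodule.subset_span ⟨i, rfl⟩)
    have h2 := hw _ hv
    have h3 : u = lam • (w - p 0 - ∑ i : Fin (m + 1), (- c i.castSucc / lam) • (p i - p 0)) := by
      rw [smul_sub, Finset.smul_sum, hu', smul_sub]
      have : ∀ i : Fin (m + 1), lam • (- c i.castSucc / lam) • (p i - p 0)
          = - (c i.castSucc • p i) + c i.castSucc • p 0 := by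
        intro i
        rw [smul_smul, mul_div_cancel₀ _ h0]
        simp [smul_sub]
      simp_rw [this]
      rw [Finset.sum_add_distrib, ← Finset.sum_smul, hc', Finset.sum_neg_distrib]
      simp
      abel
    rw [h3, norm_smul, Real.norm_eq_abs]
    gcongr
  have h4 : ‖∑ i : Fin (m + 1), (c i.castSucc + if i = 0 then lam else 0) • p i‖
      ≤ ‖u‖ * (1 + D / σ) := by
    have : ∑ i : Fin (m + 1), (c i.castSucc + if i = 0 then lam else 0) • p i
        = u - lam • (w - p 0) := by
      simp only [add_smul, Finset.sum_add_distrib, ite_smul, zero_smul, Finset.sum_ite_eq',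
        Finset.mem_univ, if_true]
      rw [hu', smul_sub]
      abel
    rw [this]
    refine (norm_sub_le _ _).trans ?_
    rw [norm_smul, Real.norm_eq_abs]
    have : |lam| * ‖w - p 0‖ ≤ ‖u‖ / σ * D := by gcongr
    calc _ ≤ ‖u‖ + ‖u‖ / σ * D := by gcongr
      _ = _ := by ring
  have hσ' : 0 ≤ C * (1 + D / σ) := by positivity
  intro j
  refine Fin.lastCases ?_ (fun i => ?_) j
  · refine h1.trans ?_
    rw [add_mul, div_eq_inv_mul, one_div]
    exact le_add_of_nonneg_left (by positivity)
  · have h5 := h (fun i => c i.castSucc + if i = 0 then lam else 0)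
      (by simp [Finset.sum_add_distrib, hc']) i
    have h6 : |c i.castSucc| ≤ |c i.castSucc + if i = 0 then lam else 0| + |lam| := by
      have h7 : c i.castSucc = (c i.castSucc + if i = 0 then lam else 0)
        - if i = 0 then lam else 0 := by ring
      have h8 : |if i = 0 then lam else 0| ≤ |lam| := by split_ifs <;> simp
      calc |c i.castSucc| = |(c i.castSucc + if i = 0 then lam else 0)
            - if i = 0 then lam else 0| := by rw [← h7]
        _ ≤ _ := (abs_sub _ _).trans (by gcongr)
    have h9 := mul_le_mul_of_nonneg_left h4 hC
    calc |c i.castSucc| ≤ C * (‖u‖ * (1 + D / σ)) + ‖u‖ / σ := by linarith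
      _ = _ := by ring

end CoeffBound

section Interpolation

variable {n : ℕ} {V G : Type*} [NormedAddCommGroup V] [NormedSpace ℝ V] [FiniteDimensional ℝ V]
  [NormedAddCommGroup G] [NormedSpace ℝ G]

theorem CoeffBound.exists_coeff {C : ℝ} {y : Fin (n + 1) → V} (h : CoeffBound C y)
    (hV : Module.finrank ℝ V = n) (v : V) :
    ∃ c : Fin (n + 1) → ℝ, ∑ i, c i = 0 ∧ v = ∑ i, c i • y i := by
  have htop : affineSpan ℝ (range y) = ⊤ :=
    h.affineIndependent.affineSpan_eq_top_iff_card_eq_finrank_add_one.2 (by simp [hV])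
  have hv : v + y 0 ∈ affineSpan ℝ (y '' univ) := by
    rw [image_univ, htop]
    trivial
  obtain ⟨c, hc, -, hvc⟩ := exists_coeff_of_mem_affineSpan_image hv
  refine ⟨fun i => c i - if i = 0 then 1 else 0, by simp [hc], ?_⟩
  simp [sub_smul, ite_smul, ← hvc]

theorem CoeffBound.norm_linear_le {C τ : ℝ} {y : Fin (n + 1) → V} (h : CoeffBound C y)
    (hV : Module.finrank ℝ V = n) (Λ : V →L[ℝ] G) (b : G)
    (hy : ∀ i, ‖b + Λ (y i)‖ ≤ τ) (v : V) : ‖Λ v‖ ≤ (n + 1) * C * τ * ‖v‖ := by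
  obtain ⟨c, hc, hv⟩ := h.exists_coeff hV v
  have h1 : Λ v = ∑ i, c i • (b + Λ (y i)) := by
    simp only [smul_add, Finset.sum_add_distrib, ← Finset.sum_smul, hc, hv, map_sum, map_smul]
    simp
  rw [h1]
  refine (norm_sum_le _ _).trans ?_
  have : ∀ i ∈ Finset.univ, ‖c i • (b + Λ (y i))‖ ≤ C * ‖v‖ * τ := by
    intro i _
    rw [norm_smul, Real.norm_eq_abs]
    have := h c hc i
    rw [← hv] at this
    exact mul_le_mul this (hy i) (norm_nonneg _) ((abs_nonneg _).trans this)
  refine (Finset.sum_le_card_nsmul _ _ _ this).trans (le_of_eq ?_)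
  simp
  ring

theorem CoeffBound.norm_affine_le {C τ : ℝ} {y : Fin (n + 1) → V} (h : CoeffBound C y)
    (hV : Module.finrank ℝ V = n) (Λ : V →L[ℝ] G) (b : G)
    (hy : ∀ i, ‖b + Λ (y i)‖ ≤ τ) (v : V) :
    ‖b + Λ v‖ ≤ τ * (1 + (n + 1) * C * ‖v - y 0‖) := by
  have h1 := h.norm_linear_le hV Λ b hy (v - y 0)
  have h2 : b + Λ v = (b + Λ (y 0)) + Λ (v - y 0) := by simp
  rw [h2]
  refine (norm_add_le _ _).trans ((add_le_add (hy 0) h1).trans (le_of_eq ?_))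
  ring

theorem CoeffBound.exists_interpolation {C : ℝ} {y : Fin (n + 1) → V} (h : CoeffBound C y)
    (hV : Module.finrank ℝ V = n) (q : Fin (n + 1) → G) :
    ∃ (Λ : V →L[ℝ] G) (b : G), ∀ i, b + Λ (y i) = q i := by
  have hli : LinearIndependent ℝ fun i : Fin n => y i.succ - y 0 := by
    rw [Fintype.linearIndependent_iff]
    intro g hg i
    have h1 := h (Fin.cons (-∑ i, g i) g) (by simp [Fin.sum_univ_succ]) i.succ
    have h2 : ∑ j, (Fin.cons (-∑ i, g i) g : Fin (n + 1) → ℝ) j • y j = 0 := by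
      rw [← hg]
      simp only [Fin.sum_univ_succ, Fin.cons_zero, Fin.cons_succ, smul_sub, Finset.sum_sub_distrib,
        neg_smul, Finset.sum_smul]
      abel
    rw [h2, norm_zero, mul_zero] at h1
    simpa using abs_eq_zero.1 (le_antisymm h1 (abs_nonneg _))
  let B := basisOfLinearIndependentOfCardEqFinrank' (K := ℝ) _ hli (by simp [hV])
  let Λ : V →L[ℝ] G := LinearMap.toContinuousLinearMap (B.constr ℝ fun i => q i.succ - q 0)
  have hΛ : ∀ i : Fin n, Λ (y i.succ - y 0) = q i.succ - q 0 := by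
    intro i
    have : B i = y i.succ - y 0 := by
      simp [B]
    rw [← this]
    exact B.constr_basis ℝ _ i
  refine ⟨Λ, q 0 - Λ (y 0), fun i => ?_⟩
  refine Fin.cases (by simp) (fun i => ?_) i
  have := hΛ i
  rw [map_sub] at this
  rw [sub_add_eq_add_sub, add_sub_assoc, this]
  simp

end Interpolation

section Selection

variable {N n : ℕ}

theorem measure_tube_le {μ : Measure (EuclideanSpace ℝ (Fin N))} {C₀ : ℝ} (hC₀ : 0 ≤ C₀)
    (hμ : ∀ x r, 0 < r → μ (closedBall x r) ≤ ENNReal.ofReal (C₀ * r ^ n))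
    (W : Submodule ℝ (EuclideanSpace ℝ (Fin N))) (hW : Module.finrank ℝ W < n)
    {s : ℕ} (hs : 0 < s) (x : EuclideanSpace ℝ (Fin N)) {r : ℝ} (hr : 0 < r) :
    μ {w | w ∈ closedBall x (2 * r) ∧ ∃ v ∈ W, ‖w - x - v‖ ≤ r / s} ≤
      ENNReal.ofReal (C₀ * (7 ^ n * (n + 2) ^ n) / s * r ^ n) := by
  classical
  set d := Module.finrank ℝ W with hd
  set b := stdOrthonormalBasis ℝ W with hb
  have hs' : (1 : ℝ) ≤ s := by exact_mod_cast hs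
  have hs0 : (0 : ℝ) < s := by linarith
  let cell : (Fin d → ℤ) → Set (EuclideanSpace ℝ (Fin N)) := fun g =>
    {w | ∃ v : W, ‖w - x - v‖ ≤ r / s ∧ ∀ i, ⌊b.repr v i * s / r⌋ = g i}
  let T : Finset (Fin d → ℤ) := Fintype.piFinset fun _ => Finset.Icc (-(3 * s : ℤ)) (3 * s)
  have hsub : {w | w ∈ closedBall x (2 * r) ∧ ∃ v ∈ W, ‖w - x - v‖ ≤ r / s} ⊆
      ⋃ g ∈ T, cell g := by
    rintro w ⟨hw, v, hv, hwv⟩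
    refine mem_iUnion₂.2 ⟨fun i => ⌊b.repr ⟨v, hv⟩ i * s / r⌋, ?_, ⟨v, hv⟩, hwv, fun i => rfl⟩
    refine Fintype.mem_piFinset.2 fun i => ?_
    have h1 : ‖v‖ ≤ 3 * r := by
      rw [mem_closedBall, dist_eq_norm] at hw
      have : v = (w - x) - (w - x - v) := by abel
      rw [this]
      refine (norm_sub_le _ _).trans ?_
      have : r / s ≤ r := div_le_self hr.le hs'
      linarith
    have h2 : |b.repr ⟨v, hv⟩ i| ≤ 3 * r := by
      refine le_trans ?_ h1
      have := PiLp.norm_apply_le (b.repr ⟨v, hv⟩) i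
      rwa [LinearIsometryEquiv.norm_map, Real.norm_eq_abs] at this
    have h3 : |b.repr ⟨v, hv⟩ i * s / r| ≤ 3 * s := by
      rw [abs_div, abs_mul, abs_of_pos hs0, abs_of_pos hr, div_le_iff₀ hr]
      nlinarith
    rw [abs_le] at h3
    rw [Finset.mem_Icc]
    constructor
    · rw [Int.le_floor]
      push_cast
      exact h3.1
    · have := (Int.floor_le (b.repr ⟨v, hv⟩ i * s / r)).trans h3.2
      rw [← Int.cast_le (R := ℝ)]
      push_cast
      exact this
  have hcell : ∀ g, μ (cell g) ≤ ENNReal.ofReal (C₀ * ((n + 2) * r / s) ^ n) := by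
    intro g
    rcases (cell g).eq_empty_or_nonempty with h | ⟨w, v, hwv, hg⟩
    · simp [h]
    refine (measure_mono ?_).trans (hμ w _ (by positivity))
    rintro w' ⟨v', hwv', hg'⟩
    have h1 : ‖v' - v‖ ≤ d * (r / s) := by
      rw [← b.repr.norm_map, ← b.sum_repr (v' - v), map_sum]
      refine (norm_sum_le _ _).trans ?_
      have : ∀ i ∈ Finset.univ, ‖b.repr (b.repr (v' - v) i • b i)‖ ≤ r / s := by
        intro i _
        rw [LinearIsometryEquiv.norm_map, norm_smul, b.norm_eq_one, mul_one, map_sub,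
          Real.norm_eq_abs]
        have := Int.abs_sub_lt_one_of_floor_eq_floor ((hg' i).trans (hg i).symm)
        rw [← sub_div, ← sub_mul, abs_div, abs_mul, abs_of_pos hs0, abs_of_pos hr,
          div_lt_one hr] at this
        rw [le_div_iff₀ hs0]
        exact this.le
      refine (Finset.sum_le_card_nsmul _ _ _ this).trans (le_of_eq ?_)
      simp [hd]
    rw [mem_closedBall, dist_eq_norm]
    have h2 : w' - w = (w' - x - v') - (w - x - v) + ((v' - v : W) : EuclideanSpace ℝ (Fin N)) := by
      simp
      abel
    rw [h2]
    refine (norm_add_le _ _).trans ((add_le_add (norm_sub_le _ _) le_rfl).trans ?_)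
    have h3 : ‖((v' - v : W) : EuclideanSpace ℝ (Fin N))‖ ≤ n * (r / s) := by
      refine le_trans h1 ?_
      gcongr
    calc _ ≤ r / s + r / s + n * (r / s) := by gcongr
      _ = _ := by ring
  have hcard : (T.card : ℝ) ≤ (7 * s) ^ (n - 1) := by
    have : T.card = (6 * s + 1) ^ d := by
      simp only [T, Fintype.card_piFinset, Int.card_Icc, Finset.prod_const, Finset.card_univ,
        Fintype.card_fin]
      congr 1
      omega
    rw [this]
    push_cast
    calc (6 * (s : ℝ) + 1) ^ d ≤ (7 * s) ^ d := by gcongr; linarith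
      _ ≤ (7 * s) ^ (n - 1) := pow_le_pow_right₀ (by linarith) (by omega)
  calc _ ≤ μ (⋃ g ∈ T, cell g) := measure_mono hsub
    _ ≤ ∑ g ∈ T, μ (cell g) := measure_biUnion_finset_le _ _
    _ ≤ ∑ g ∈ T, ENNReal.ofReal (C₀ * ((n + 2) * r / s) ^ n) :=
        Finset.sum_le_sum fun g _ => hcell g
    _ = ENNReal.ofReal (T.card * (C₀ * ((n + 2) * r / s) ^ n)) := by
        rw [Finset.sum_const, nsmul_eq_mul, ENNReal.ofReal_mul (Nat.cast_nonneg _),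
          ENNReal.ofReal_natCast]
    _ ≤ _ := by
        apply ENNReal.ofReal_le_ofReal
        calc (T.card : ℝ) * (C₀ * ((n + 2) * r / s) ^ n)
            ≤ (7 * s) ^ (n - 1) * (C₀ * ((n + 2) * r / s) ^ n) := by gcongr
          _ = 7 ^ (n - 1) * C₀ * (n + 2) ^ n * r ^ n * ((s : ℝ) ^ (n - 1) / s ^ n) := by
              rw [div_pow, mul_pow, mul_pow]
              ring
          _ = 7 ^ (n - 1) * (C₀ * (n + 2) ^ n * r ^ n * (1 / s)) := by
              have : (s : ℝ) ^ n = s ^ (n - 1) * s := by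
                rw [← pow_succ]
                congr 1
                omega
              rw [this]
              field_simp
          _ ≤ 7 ^ n * (C₀ * (n + 2) ^ n * r ^ n * (1 / s)) := by
              gcongr
              · norm_num
              · omega
          _ = _ := by ring

theorem exists_mem_le_measure_closedBall {τ δ : ℝ} (hτ : 0 < τ) (hδ : 0 < δ) (N n : ℕ) :
    ∃ c > 0, ∀ (μ : Measure (EuclideanSpace ℝ (Fin N))) (X : EuclideanSpace ℝ (Fin N)) (r : ℝ),
      0 < r → ∀ A ⊆ closedBall X r, ENNReal.ofReal (δ * r ^ n) ≤ μ A →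
      ∃ p ∈ A, ENNReal.ofReal (c * r ^ n) ≤ μ (closedBall p (τ * r)) := by
  obtain ⟨t, -, htf, ht⟩ := (isCompact_closedBall (0 : EuclideanSpace ℝ (Fin N)) 1).finite_cover_balls
    (half_pos hτ)
  lift t to Finset (EuclideanSpace ℝ (Fin N)) using htf
  have htne : t.Nonempty := by
    have := ht (mem_closedBall_self zero_le_one)
    obtain ⟨x, hx, -⟩ := mem_iUnion₂.1 this
    exact ⟨x, hx⟩
  have hcard : (0 : ℝ) < t.card := by exact_mod_cast htne.card_pos
  refine ⟨δ / t.card, by positivity, fun μ X r hr A hA hμA => ?_⟩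
  have hex : ∃ x ∈ t, ENNReal.ofReal (δ / t.card * r ^ n) ≤
      μ (A ∩ closedBall (X + r • x) (τ / 2 * r)) := by
    by_contra! hcon
    have hsub : A ⊆ ⋃ x ∈ t, A ∩ closedBall (X + r • x) (τ / 2 * r) := by
      intro w hw
      have h1 : r⁻¹ • (w - X) ∈ closedBall (0 : EuclideanSpace ℝ (Fin N)) 1 := by
        have := hA hw
        rw [mem_closedBall, dist_eq_norm] at this
        rw [mem_closedBall_zero_iff, norm_smul, norm_inv, Real.norm_eq_abs, abs_of_pos hr,
          inv_mul_le_iff₀ hr, mul_one]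
        exact this
      obtain ⟨x, hx, hxw⟩ := mem_iUnion₂.1 (ht h1)
      refine mem_iUnion₂.2 ⟨x, hx, hw, ?_⟩
      rw [mem_ball, dist_eq_norm] at hxw
      rw [mem_closedBall, dist_eq_norm]
      have : w - (X + r • x) = r • (r⁻¹ • (w - X) - x) := by
        rw [smul_sub, smul_smul, mul_inv_cancel₀ hr.ne', one_smul]
        abel
      rw [this, norm_smul, Real.norm_eq_abs, abs_of_pos hr, mul_comm]
      gcongr
    have h2 : μ A < ∑ x ∈ t, ENNReal.ofReal (δ / t.card * r ^ n) :=
      ((measure_mono hsub).trans (measure_biUnion_finset_le _ _)).trans_lt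
        (ENNReal.sum_lt_sum_of_nonempty htne hcon)
    rw [Finset.sum_const, nsmul_eq_mul, ← ENNReal.ofReal_natCast,
      ← ENNReal.ofReal_mul (Nat.cast_nonneg _), ← mul_assoc, mul_div_cancel₀ _ hcard.ne'] at h2
    exact absurd hμA (not_le.2 h2)
  obtain ⟨x, -, hx⟩ := hex
  have hne : (A ∩ closedBall (X + r • x) (τ / 2 * r)).Nonempty := by
    refine nonempty_of_measure_ne_zero (μ := μ) (ne_of_gt (lt_of_lt_of_le ?_ hx))
    rw [ENNReal.ofReal_pos]
    positivity
  obtain ⟨p, hpA, hp⟩ := hne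
  refine ⟨p, hpA, hx.trans (measure_mono fun w hw => ?_)⟩
  have h1 := hw.2
  rw [mem_closedBall] at h1 hp ⊢
  have := dist_triangle_right w p (X + r • x)
  linarith

theorem exists_coeffBound_selection (hn : 1 ≤ n) {C₀ δ : ℝ} (hC₀ : 0 < C₀) (hδ : 0 < δ) (N : ℕ) :
    ∃ C > (0 : ℝ), ∃ τ > (0 : ℝ), ∃ c > (0 : ℝ), τ ≤ 1 ∧ C * (n + 1) * τ ≤ 1 / 2 ∧
    ∀ μ : Measure (EuclideanSpace ℝ (Fin N)),
      (∀ x r, 0 < r → μ (closedBall x r) ≤ ENNReal.ofReal (C₀ * r ^ n)) →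
      ∀ (X : EuclideanSpace ℝ (Fin N)) (r : ℝ), 0 < r →
      ENNReal.ofReal (δ * r ^ n) ≤ μ (closedBall X r) →
      ∃ p : Fin (n + 1) → EuclideanSpace ℝ (Fin N), (∀ i, p i ∈ closedBall X r) ∧
        (∀ i, ENNReal.ofReal (c * r ^ n) ≤ μ (closedBall (p i) (τ * r))) ∧
        CoeffBound (C / r) p := by
  obtain ⟨s, hs⟩ := exists_nat_gt (2 * (C₀ * (7 ^ n * (n + 2) ^ n)) / δ)
  have hA : 0 < C₀ * (7 ^ n * (n + 2 : ℝ) ^ n) := by positivity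
  have hs0 : (0 : ℝ) < s := lt_trans (by positivity) hs
  have hspos : 0 < s := by exact_mod_cast hs0
  have hsA : C₀ * (7 ^ n * (n + 2 : ℝ) ^ n) / s ≤ δ / 2 := by
    rw [div_lt_iff₀ hδ] at hs
    rw [div_le_iff₀ hs0]
    linarith
  let Cs : ℕ → ℝ := fun j => Nat.rec 1 (fun _ C => C * (1 + 2 * s) + s) j
  have hCs : ∀ j, 0 < Cs j := by
    intro j
    induction j with
    | zero => exact one_pos
    | succ j ih =>
      change 0 < Cs j * (1 + 2 * s) + s
      positivity
  set τ := min 1 (1 / (2 * (Cs n * (n + 1)))) with hτ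
  have hτ0 : 0 < τ := lt_min one_pos (by have := hCs n; positivity)
  obtain ⟨c, hc, hball⟩ := exists_mem_le_measure_closedBall hτ0 (half_pos hδ) N n
  refine ⟨Cs n, hCs n, τ, hτ0, c, hc, min_le_left _ _, ?_, fun μ hμ X r hr hX => ?_⟩
  · have h1 : 0 < Cs n * (n + 1) := by have := hCs n; positivity
    calc Cs n * (n + 1) * τ ≤ Cs n * (n + 1) * (1 / (2 * (Cs n * (n + 1)))) := by
          gcongr
          exact min_le_right _ _
      _ = 1 / 2 := by rw [mul_one_div, mul_comm 2, div_mul_cancel_left₀ h1.ne', one_div]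
  suffices h : ∀ j ≤ n, ∃ p : Fin (j + 1) → EuclideanSpace ℝ (Fin N), (∀ i, p i ∈ closedBall X r) ∧
      (∀ i, ENNReal.ofReal (c * r ^ n) ≤ μ (closedBall (p i) (τ * r))) ∧
      CoeffBound (Cs j / r) p from h n le_rfl
  intro j
  induction j with
  | zero =>
    intro _
    obtain ⟨p, hp, hpμ⟩ := hball μ X r hr (closedBall X r) subset_rfl
      ((ENNReal.ofReal_le_ofReal (by gcongr; linarith)).trans hX)
    refine ⟨fun _ => p, fun _ => hp, fun _ => hpμ, fun a ha i => ?_⟩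
    have : a i = 0 := by
      rw [Fin.fin_one_eq_zero i]
      simpa using ha
    rw [this, abs_zero]
    have := hCs 0
    positivity
  | succ j ih =>
    intro hj
    obtain ⟨p, hpX, hpμ, hp⟩ := ih (by omega)
    set W := Submodule.span ℝ (range fun i => p i - p 0) with hWdef
    have hW : Module.finrank ℝ W < n := by
      have hle : W ≤ Submodule.span ℝ (range fun i : Fin j => p i.succ - p 0) := by
        rw [hWdef, Submodule.span_le]
        rintro _ ⟨i, rfl⟩
        refine Fin.cases ?_ (fun i => ?_) i
        · simp
        · exact Submodule.subset_span ⟨i, rfl⟩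
      have h1 := Submodule.finrank_mono hle
      have h2 := finrank_range_le_card (R := ℝ) (fun i : Fin j => p i.succ - p 0)
      rw [Set.finrank, Fintype.card_fin] at h2
      omega
    set T := {w | w ∈ closedBall (p 0) (2 * r) ∧ ∃ v ∈ W, ‖w - p 0 - v‖ ≤ r / s} with hT
    have hTμ : μ T ≤ ENNReal.ofReal (δ / 2 * r ^ n) :=
      (measure_tube_le hC₀.le hμ W hW hspos (p 0) hr).trans
        (ENNReal.ofReal_le_ofReal (by gcongr))
    have hdiff : ENNReal.ofReal (δ / 2 * r ^ n) ≤ μ (closedBall X r \ T) := by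
      have h1 : μ (closedBall X r) ≤ μ (closedBall X r \ T) + μ T :=
        (measure_mono (by rw [sdiff_union_self]; exact subset_union_left)).trans
          (measure_union_le _ _)
      have h2 : ENNReal.ofReal (δ * r ^ n) =
          ENNReal.ofReal (δ / 2 * r ^ n) + ENNReal.ofReal (δ / 2 * r ^ n) := by
        rw [← ENNReal.ofReal_add (by positivity) (by positivity)]
        congr 1
        ring
      have h3 := (hX.trans h1).trans (add_le_add le_rfl hTμ)
      rw [h2] at h3
      exact (ENNReal.add_le_add_iff_right ENNReal.ofReal_ne_top).1 h3
    obtain ⟨w, hw, hwμ⟩ := hball μ X r hr _ sdiff_subset hdiff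
    have hw0 : ‖w - p 0‖ ≤ 2 * r := by
      have h1 := hw.1
      have h2 := hpX 0
      rw [mem_closedBall] at h1 h2
      rw [← dist_eq_norm]
      have := dist_triangle_right w (p 0) X
      linarith
    have hwT : ∀ v ∈ W, r / s ≤ ‖w - p 0 - v‖ := by
      intro v hv
      by_contra! hlt
      exact hw.2 ⟨by rwa [mem_closedBall, dist_eq_norm], v, hv, hlt.le⟩
    have hsnoc := hp.snoc (by have := hCs j; positivity) (by positivity) hw0 hwT
    refine ⟨Fin.snoc (α := fun _ => EuclideanSpace ℝ (Fin N)) p w, ?_, ?_, ?_⟩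
    · refine Fin.lastCases ?_ fun i => ?_
      · simpa using hw.1
      · simpa using hpX i
    · refine Fin.lastCases ?_ fun i => ?_
      · simpa using hwμ
      · simpa using hpμ i
    · convert hsnoc using 1
      change (Cs j * (1 + 2 * s) + s) / r = _
      field_simp

end Selection

theorem exists_forall_mul_le_lintegral {α ι : Type*} [Fintype ι] [MeasurableSpace α]
    {ν : Measure α} [IsFiniteMeasure ν] (hν : ν ≠ 0) {f : ι → α → ℝ≥0∞}
    (hf : ∀ i, AEMeasurable (f i) ν) {p : α → Prop} (hp : ∀ᵐ x ∂ν, p x) :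
    ∃ x, p x ∧ ∀ i, f i x * ν univ ≤ Fintype.card ι * ∫⁻ x, f i x ∂ν := by
  have hu : ν univ ≠ 0 := by simpa using hν
  have hut : ν univ ≠ ∞ := measure_ne_top _ _
  set I : ι → ℝ≥0∞ := fun i => ∫⁻ x, f i x ∂ν with hI
  obtain ⟨x, hx, hgx⟩ := exists_notMem_null_le_laverage (f := fun x => ∑ i, f i x * (I i)⁻¹) hν
    (Finset.aemeasurable_fun_sum _ fun i _ => (hf i).mul_const _) hp
  refine ⟨x, by simpa using hx, fun i => ?_⟩
  have h1 : ⨍⁻ x, ∑ i, f i x * (I i)⁻¹ ∂ν ≤ Fintype.card ι / ν univ := by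
    rw [laverage_eq]
    gcongr
    rw [lintegral_finsetSum' _ fun i _ => (hf i).mul_const _]
    calc ∑ i, ∫⁻ x, f i x * (I i)⁻¹ ∂ν ≤ ∑ _i : ι, 1 := by
          refine Finset.sum_le_sum fun i _ => ?_
          rw [lintegral_mul_const'' _ (hf i)]
          exact ENNReal.mul_inv_le_one _
      _ = _ := by simp
  have h2 : f i x * (I i)⁻¹ ≤ Fintype.card ι / ν univ :=
    ((Finset.single_le_sum (f := fun i => f i x * (I i)⁻¹) (fun _ _ => zero_le)
      (Finset.mem_univ i)).trans hgx).trans h1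
  have hcard : (Fintype.card ι : ℝ≥0∞) ≠ 0 := by
    have : Nonempty ι := ⟨i⟩
    simp
  change f i x * ν univ ≤ Fintype.card ι * I i
  by_cases hIt : I i = ∞
  · simp [hIt, ENNReal.mul_top hcard]
  by_cases hI0 : I i = 0
  · rw [hI0, ENNReal.inv_zero] at h2
    have : f i x = 0 := by
      by_contra h0
      rw [ENNReal.mul_top h0, top_le_iff] at h2
      exact ENNReal.div_ne_top (ENNReal.natCast_ne_top _) hu h2
    simp [this]
  · rw [← div_eq_mul_inv, ENNReal.div_le_iff hI0 hIt, ← ENNReal.mul_div_right_comm,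
      ENNReal.le_div_iff_mul_le (Or.inl hu) (Or.inl hut)] at h2
    exact h2

theorem ENNReal.ofReal_mul_le_of_ofReal_mul_mul_le {a b d : ℝ} (ha : 0 < a)
    {x e : ℝ≥0∞} (h : ENNReal.ofReal (a * b) * x ≤ ENNReal.ofReal d * e) :
    ENNReal.ofReal b * x ≤ ENNReal.ofReal (d / a) * e := by
  rw [ENNReal.ofReal_mul ha.le, mul_assoc] at h
  have ha0 : ENNReal.ofReal a ≠ 0 := by simpa using ha
  rw [ENNReal.ofReal_div_of_pos ha, ENNReal.div_eq_inv_mul, mul_assoc]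
  calc _ = (ENNReal.ofReal a)⁻¹ * (ENNReal.ofReal a * (ENNReal.ofReal b * x)) := by
        rw [← mul_assoc, ENNReal.inv_mul_cancel ha0 ENNReal.ofReal_ne_top, one_mul]
    _ ≤ _ := by gcongr

/-- At every dense ball of radius `2⁻ᵏ` one can select a nondegenerate simplex whose affine span
approximates `μ` in the square mean, with an error controlled by the measure `e k`, and at whose
vertices a given function is not much larger than its average. -/
def FlatSelection {N : ℕ} (n : ℕ) (μ : Measure (EuclideanSpace ℝ (Fin N)))
    (e : ℕ → Measure (EuclideanSpace ℝ (Fin N))) (δ C₁ : ℝ) : Prop :=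
  ∀ (X : EuclideanSpace ℝ (Fin N)) (k : ℕ),
    ENNReal.ofReal (δ * ((1 / 2) ^ k) ^ n) ≤ μ (closedBall X ((1 / 2) ^ k)) →
    ∀ f : EuclideanSpace ℝ (Fin N) → ℝ≥0∞, Measurable f →
    ∃ y : Fin (n + 1) → EuclideanSpace ℝ (Fin N), (∀ i, y i ∈ closedBall X (2 * (1 / 2) ^ k)) ∧
      CoeffBound (C₁ / (1 / 2) ^ k) y ∧
      ∫⁻ w in closedBall X (32 * (1 / 2) ^ k),
        ENNReal.ofReal (infDist w (affineSpan ℝ (range y) : Set (EuclideanSpace ℝ (Fin N))) ^ 2) ∂μ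
        ≤ ENNReal.ofReal (C₁ * ((1 / 2) ^ k) ^ 2) * e k (closedBall X (32 * (1 / 2) ^ k)) ∧
      ∀ i, ENNReal.ofReal (((1 / 2) ^ k) ^ n) * f (y i) ≤
        ENNReal.ofReal C₁ * ∫⁻ w in closedBall X (2 * (1 / 2) ^ k), f w ∂μ

/-- Tuples of diameter comparable to `r`. -/
def scaleSet (N n : ℕ) (σ r : ℝ) : Set (Fin (n + 2) → EuclideanSpace ℝ (Fin N)) :=
  {z | (∀ i, dist (z i) (z 0) ≤ 64 * r) ∧ σ * r ≤ dist (z 0) (z 1)}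

theorem measurableSet_scaleSet (N n : ℕ) (σ r : ℝ) : MeasurableSet (scaleSet N n σ r) := by
  apply IsClosed.measurableSet
  have h1 : IsClosed {z : Fin (n + 2) → EuclideanSpace ℝ (Fin N) |
      ∀ i, dist (z i) (z 0) ≤ 64 * r} := by
    simp only [ofPred_forall]
    exact isClosed_iInter fun i => isClosed_le (by fun_prop) (by fun_prop)
  have h2 : IsClosed {z : Fin (n + 2) → EuclideanSpace ℝ (Fin N) | σ * r ≤ dist (z 0) (z 1)} :=
    isClosed_le (by fun_prop) (by fun_prop)
  exact h1.inter h2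

/-- The contribution of tuples of diameter comparable to `r` to the Menger energy, as a measure in
the first variable. -/
def scaleEnergy {N n : ℕ} (K : (Fin (n + 2) → EuclideanSpace ℝ (Fin N)) → ℝ)
    (μ : Measure (EuclideanSpace ℝ (Fin N))) (σ r : ℝ) : Measure (EuclideanSpace ℝ (Fin N)) :=
  (((Measure.pi fun _ : Fin (n + 2) => μ).withDensity
    fun z => ENNReal.ofReal (K z ^ (2 : ℝ))).restrict (scaleSet N n σ r)).map fun z => z 0

section ScaleEnergy

variable {N n : ℕ} {K : (Fin (n + 2) → EuclideanSpace ℝ (Fin N)) → ℝ}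

theorem scaleEnergy_apply (μ : Measure (EuclideanSpace ℝ (Fin N))) (σ r : ℝ)
    {A : Set (EuclideanSpace ℝ (Fin N))} (hA : MeasurableSet A) :
    scaleEnergy K μ σ r A = ∫⁻ z in {z | z 0 ∈ A} ∩ scaleSet N n σ r,
      ENNReal.ofReal (K z ^ (2 : ℝ)) ∂(Measure.pi fun _ : Fin (n + 2) => μ) := by
  have h1 : MeasurableSet ((fun z : Fin (n + 2) → EuclideanSpace ℝ (Fin N) => z 0) ⁻¹' A) :=
    measurable_pi_apply 0 hA
  rw [scaleEnergy, Measure.map_apply (measurable_pi_apply 0) hA, Measure.restrict_apply h1,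
    withDensity_apply _ (h1.inter (measurableSet_scaleSet _ _ _ _))]
  rfl

theorem lintegral_pi_lintegral_snoc_le {μ : Measure (EuclideanSpace ℝ (Fin N))} [IsFiniteMeasure μ]
    (hK : Measurable K) {σ r : ℝ} {A : Set (EuclideanSpace ℝ (Fin N))} (hA : MeasurableSet A)
    {B : Fin (n + 1) → Set (EuclideanSpace ℝ (Fin N))}
    (hBA : ∀ y : Fin (n + 1) → EuclideanSpace ℝ (Fin N), (∀ i, y i ∈ B i) → ∀ w ∈ A,
      y 0 ∈ A ∧ (Fin.snoc (α := fun _ => EuclideanSpace ℝ (Fin N)) y w) ∈ scaleSet N n σ r) :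
    ∫⁻ y, ∫⁻ w in A, ENNReal.ofReal
      (K (Fin.snoc (α := fun _ => EuclideanSpace ℝ (Fin N)) y w) ^ (2 : ℝ)) ∂μ
      ∂(Measure.pi fun i => μ.restrict (B i)) ≤ scaleEnergy K μ σ r A := by
  set ρ : (Fin (n + 2) → EuclideanSpace ℝ (Fin N)) → ℝ≥0∞ :=
    fun z => ENNReal.ofReal (K z ^ (2 : ℝ)) with hρdef
  have hρ : Measurable ρ := (hK.pow_const _).ennreal_ofReal
  set B' : Fin (n + 2) → Set (EuclideanSpace ℝ (Fin N)) :=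
    Fin.snoc (α := fun _ => Set (EuclideanSpace ℝ (Fin N))) B A with hB'
  have hmp := measurePreserving_piFinSuccAbove (fun i : Fin (n + 2) => μ.restrict (B' i))
    (Fin.last (n + 1))
  have hlast : B' (Fin.last (n + 1)) = A := by simp [hB']
  have hsucc : ∀ i : Fin (n + 1), B' (Fin.succAbove (Fin.last (n + 1)) i) = B i := by
    intro i
    simp [hB']
  simp only [hlast, hsucc] at hmp
  have h1 : ∫⁻ y, ∫⁻ w in A, ρ (Fin.snoc (α := fun _ => EuclideanSpace ℝ (Fin N)) y w) ∂μ
      ∂(Measure.pi fun i => μ.restrict (B i)) =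
      ∫⁻ z, ρ z ∂(Measure.pi fun i => μ.restrict (B' i)) := by
    have hm := hρ.comp (MeasurableEquiv.piFinSuccAbove
      (fun _ : Fin (n + 2) => EuclideanSpace ℝ (Fin N)) (Fin.last (n + 1))).symm.measurable
    rw [← hmp.symm.lintegral_comp hρ]
    refine Eq.trans ?_ (lintegral_prod_symm' _ hm).symm
    simp [MeasurableEquiv.piFinSuccAbove, Fin.insertNthEquiv, Fin.insertNth_last']
  rw [h1, scaleEnergy_apply _ _ _ hA, ← Measure.restrict_pi_pi]
  refine lintegral_mono_set fun z hz => ?_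
  have hz' : ∀ i, z i ∈ B' i := fun i => hz i (mem_univ i)
  have h2 := hBA (Fin.init z) (fun i => by simpa [hB', Fin.init] using hz' i.castSucc)
    (z (Fin.last (n + 1))) (by simpa [hB'] using hz' (Fin.last (n + 1)))
  rw [Fin.snoc_init_self] at h2
  exact h2

end ScaleEnergy

theorem exists_flatSelection_scaleEnergy {N n : ℕ} (hn : 1 ≤ n)
    {K : (Fin (n + 2) → EuclideanSpace ℝ (Fin N)) → ℝ} (hK : ProperIntegrand N n 2 K)
    {C₀ δ : ℝ} (hC₀ : 0 < C₀) (hδ : 0 < δ) :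
    ∃ C₁ ≥ (1 : ℝ), ∃ σ > (0 : ℝ), ∀ μ : Measure (EuclideanSpace ℝ (Fin N)), IsFiniteMeasure μ →
      (∀ x r, 0 < r → μ (closedBall x r) ≤ ENNReal.ofReal (C₀ * r ^ n)) →
      FlatSelection n μ (fun k => scaleEnergy K μ σ ((1 / 2) ^ k)) δ C₁ := by
  obtain ⟨hK0, hKm, ⟨cK, hcK, l, hl, hprop⟩, -, -⟩ := hK
  obtain ⟨C, hC, τ, hτ, c, hc, hτ1, hCτ, hsel⟩ := exists_coeffBound_selection hn hC₀ hδ N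
  set C' := max 32 (2 * C) with hC'
  have hC'1 : 1 ≤ C' := le_trans (by norm_num) (le_max_left _ _)
  have hC'0 : 0 < C' := by linarith
  have hA : 0 < cK * C' ^ l * ((n + 2) / c ^ (n + 1)) := by
    have : 0 < C' ^ l := Real.rpow_pos_of_pos hC'0 _
    positivity
  have hA2 : 0 < (n + 2) / c := by positivity
  refine ⟨1 + 2 * C + cK * C' ^ l * ((n + 2) / c ^ (n + 1)) + (n + 2) / c, by linarith,
    1 / (2 * C), by positivity, fun μ hfin hμ X k hX f hf => ?_⟩
  set C₁ := 1 + 2 * C + cK * C' ^ l * ((n + 2) / c ^ (n + 1)) + (n + 2) / c with hC₁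
  set r : ℝ := (1 / 2) ^ k with hr
  have hr0 : 0 < r := by positivity
  obtain ⟨p, hpX, hpμ, hp⟩ := hsel μ hμ X r hr0 hX
  set B : Fin (n + 1) → Set (EuclideanSpace ℝ (Fin N)) := fun i => closedBall (p i) (τ * r) with hB
  set A := closedBall X (32 * r) with hAdef
  have hτr : τ * r ≤ r := by nlinarith
  have hyX : ∀ y : Fin (n + 1) → EuclideanSpace ℝ (Fin N), (∀ i, y i ∈ B i) →
      ∀ i, y i ∈ closedBall X (2 * r) := by
    intro y hy i
    have h1 := hy i
    have h2 := hpX i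
    simp only [hB, mem_closedBall] at h1 h2 ⊢
    linarith [dist_triangle (y i) (p i) X]
  have hyC : ∀ y : Fin (n + 1) → EuclideanSpace ℝ (Fin N), (∀ i, y i ∈ B i) →
      CoeffBound (2 * C / r) y := by
    intro y hy
    have := hp.perturb (z := y) (τ := τ * r) (by positivity) (by positivity)
      (by
        rw [Fintype.card_fin]
        push_cast
        calc C / r * (n + 1) * (τ * r) = C * (n + 1) * τ := by field_simp
          _ ≤ _ := hCτ)
      (fun i => by
        rw [← dist_eq_norm, dist_comm]
        exact hy i)
    rwa [mul_div_assoc]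
  have hBA : ∀ y : Fin (n + 1) → EuclideanSpace ℝ (Fin N), (∀ i, y i ∈ B i) → ∀ w ∈ A,
      y 0 ∈ A ∧ (Fin.snoc (α := fun _ => EuclideanSpace ℝ (Fin N)) y w) ∈
        scaleSet N n (1 / (2 * C)) r := by
    intro y hy w hw
    have hX' := hyX y hy
    simp only [mem_closedBall, hAdef] at hX' hw ⊢
    have hz0 : (Fin.snoc (α := fun _ => EuclideanSpace ℝ (Fin N)) y w :
        Fin (n + 2) → EuclideanSpace ℝ (Fin N)) 0 = y 0 := by
      have : (0 : Fin (n + 2)) = Fin.castSucc 0 := rfl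
      rw [this, Fin.snoc_castSucc]
    have hz1 : (Fin.snoc (α := fun _ => EuclideanSpace ℝ (Fin N)) y w :
        Fin (n + 2) → EuclideanSpace ℝ (Fin N)) 1 = y ⟨1, by omega⟩ := by
      have : (1 : Fin (n + 2)) = Fin.castSucc ⟨1, by omega⟩ := by
        ext
        simp
      rw [this, Fin.snoc_castSucc]
    refine ⟨by linarith [hX' 0], fun i => ?_, ?_⟩
    · rw [hz0]
      refine Fin.lastCases ?_ (fun i => ?_) i
      · rw [Fin.snoc_last]
        linarith [dist_triangle_right w (y 0) X, hX' 0]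
      · rw [Fin.snoc_castSucc]
        linarith [dist_triangle_right (y i) (y 0) X, hX' 0, hX' i]
    · rw [hz0, hz1]
      have hne : (⟨1, by omega⟩ : Fin (n + 1)) ≠ 0 := by simp [Fin.ext_iff]
      have h1 := hyC y hy (fun i => (if i = 0 then 1 else 0) - if i = ⟨1, by omega⟩ then 1 else 0)
        (by simp) 0
      simp only [if_true, hne.symm, if_false, sub_zero, abs_one, sub_smul, ite_smul, one_smul,
        zero_smul, Finset.sum_sub_distrib, Finset.sum_ite_eq', Finset.mem_univ] at h1
      rw [dist_eq_norm, one_div, inv_mul_le_iff₀ (by positivity)]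
      rwa [div_mul_eq_mul_div, le_div_iff₀ hr0, one_mul] at h1
  set ν := Measure.pi fun i => μ.restrict (B i) with hν
  set ρ : (Fin (n + 2) → EuclideanSpace ℝ (Fin N)) → ℝ≥0∞ :=
    fun z => ENNReal.ofReal (K z ^ (2 : ℝ)) with hρdef
  have hρ : Measurable ρ := (hKm.pow_const _).ennreal_ofReal
  set g : (Fin (n + 1) → EuclideanSpace ℝ (Fin N)) → ℝ≥0∞ := fun y =>
    ∫⁻ w in A, ρ (Fin.snoc (α := fun _ => EuclideanSpace ℝ (Fin N)) y w) ∂μ with hg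
  have hsnoc : Measurable fun q : (Fin (n + 1) → EuclideanSpace ℝ (Fin N)) ×
      EuclideanSpace ℝ (Fin N) => (Fin.snoc (α := fun _ => EuclideanSpace ℝ (Fin N)) q.1 q.2 :
        Fin (n + 2) → EuclideanSpace ℝ (Fin N)) := by
    refine measurable_pi_lambda _ fun i => ?_
    refine Fin.lastCases ?_ (fun i => ?_) i
    · simpa using measurable_snd
    · simp only [Fin.snoc_castSucc]
      fun_prop
  have hgm : Measurable g := Measurable.lintegral_prod_right' (hρ.comp hsnoc)
  have hgν : ∫⁻ y, g y ∂ν ≤ scaleEnergy K μ (1 / (2 * C)) r A :=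
    lintegral_pi_lintegral_snoc_le hKm measurableSet_closedBall hBA
  have hνu : ν univ = ∏ i, μ (B i) := by
    rw [hν, Measure.pi_univ]
    simp
  have hB0 : ∀ i, μ (B i) ≠ 0 := fun i => (lt_of_lt_of_le
    (by rw [ENNReal.ofReal_pos]; positivity) (hpμ i)).ne'
  have hν0 : ν ≠ 0 := by
    intro h
    rw [h] at hνu
    exact Finset.prod_ne_zero_iff.2 (fun i _ => hB0 i) hνu.symm
  have hνB : ∀ᵐ y ∂ν, ∀ i, y i ∈ B i := by
    rw [hν, ← Measure.restrict_pi_pi]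
    filter_upwards [ae_restrict_mem (MeasurableSet.univ_pi fun i => measurableSet_closedBall)]
      with y hy i using hy i (mem_univ i)
  obtain ⟨y, hyB, hy⟩ := exists_forall_mul_le_lintegral hν0
    (f := fun o : Option (Fin (n + 1)) => o.elim g fun i y => f (y i))
    (fun o => by
      cases o with
      | none => exact hgm.aemeasurable
      | some i => exact (hf.comp (measurable_pi_apply i)).aemeasurable) hνB
  have hcard : ((Fintype.card (Option (Fin (n + 1))) : ℕ) : ℝ≥0∞) = ENNReal.ofReal (n + 2) := by
    rw [Fintype.card_option, Fintype.card_fin, ← ENNReal.ofReal_natCast]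
    push_cast
    congr 1
    ring
  rw [hcard] at hy
  refine ⟨y, hyX y hyB, (hyC y hyB).mono ?_, ?_, fun i => ?_⟩
  · gcongr
    linarith
  · have h1 : ENNReal.ofReal (c ^ (n + 1) * r ^ (n * (n + 1))) * g y ≤
        ENNReal.ofReal (n + 2) * scaleEnergy K μ (1 / (2 * C)) r A := by
      have h2 := (hy none).trans (mul_le_mul_right hgν _)
      refine le_trans ?_ h2
      rw [hνu, mul_comm]
      refine mul_le_mul_right ?_ _
      have h3 : c ^ (n + 1) * r ^ (n * (n + 1)) = (c * r ^ n) ^ (n + 1) := by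
        rw [mul_pow, ← pow_mul r n (n + 1)]
      rw [h3, ENNReal.ofReal_pow (by positivity)]
      have := Finset.prod_le_prod' (s := Finset.univ) fun i _ => hpμ i
      simpa using this
    have h4 := ENNReal.ofReal_mul_le_of_ofReal_mul_mul_le (by positivity) h1
    have hcl : 0 ≤ cK * C' ^ l := by
      have : 0 < C' ^ l := Real.rpow_pos_of_pos hC'0 _
      positivity
    have hH : IsHSimplex N (r / C') y := by
      intro i
      refine le_trans ?_ ((hyC y hyB).isHSimplex hn (by positivity) i)
      rw [one_div_div]
      gcongr
      exact le_max_right _ _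
    have hconv : convexHull ℝ (range y) ⊆ closedBall X (C' * r) := by
      refine convexHull_min ?_ (convex_closedBall _ _)
      rintro _ ⟨i, rfl⟩
      refine closedBall_subset_closedBall ?_ (hyX y hyB i)
      gcongr
      exact le_trans (by norm_num) (le_max_left _ _)
    calc _ ≤ ∫⁻ w in A, ENNReal.ofReal (r ^ 2 * (cK * C' ^ l) * r ^ (n * (n + 1))) *
            ρ (Fin.snoc (α := fun _ => EuclideanSpace ℝ (Fin N)) y w) ∂μ := by
          refine setLIntegral_mono' measurableSet_closedBall fun w hw => ?_
          have h5 := hprop r hr0 C' hC'1 X y hH hconv w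
            (closedBall_subset_closedBall (by gcongr; exact le_max_left _ _) hw)
          rw [Real.rpow_two, div_pow, div_le_iff₀ (by positivity)] at h5
          rw [hρdef, ← ENNReal.ofReal_mul (by positivity)]
          refine ENNReal.ofReal_le_ofReal (h5.trans (le_of_eq ?_))
          ring
      _ = ENNReal.ofReal (r ^ 2 * (cK * C' ^ l) * r ^ (n * (n + 1))) * g y := by
          exact lintegral_const_mul _ (hρ.comp (hsnoc.comp measurable_prodMk_left))
      _ = ENNReal.ofReal (r ^ 2 * (cK * C' ^ l)) * (ENNReal.ofReal (r ^ (n * (n + 1))) * g y) := by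
          rw [ENNReal.ofReal_mul (by positivity), mul_assoc]
      _ ≤ ENNReal.ofReal (r ^ 2 * (cK * C' ^ l)) * (ENNReal.ofReal ((n + 2) / c ^ (n + 1)) *
            scaleEnergy K μ (1 / (2 * C)) r A) := by gcongr
      _ = ENNReal.ofReal (r ^ 2 * (cK * C' ^ l) * ((n + 2) / c ^ (n + 1))) *
            scaleEnergy K μ (1 / (2 * C)) r A := by
          rw [ENNReal.ofReal_mul (p := r ^ 2 * (cK * C' ^ l)) (by positivity), mul_assoc]
      _ ≤ _ := by
          refine mul_le_mul_left (ENNReal.ofReal_le_ofReal ?_) _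
          calc r ^ 2 * (cK * C' ^ l) * ((n + 2) / c ^ (n + 1))
              = (cK * C' ^ l * ((n + 2) / c ^ (n + 1))) * r ^ 2 := by ring
            _ ≤ C₁ * r ^ 2 := by
              gcongr
              rw [hC₁]
              linarith
  · have h2 := hy (some i)
    simp only [Option.elim] at h2
    have h3 : ∫⁻ y, f (y i) ∂ν = (∏ j ∈ Finset.univ.erase i, μ (B j)) * ∫⁻ w in B i, f w ∂μ := by
      have h4 := Measure.pi_map_eval (μ := fun i => μ.restrict (B i)) i
      have h5 : ∫⁻ y, f (y i) ∂ν = ∫⁻ w, f w ∂(ν.map (Function.eval i)) := by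
        rw [lintegral_map hf (measurable_pi_apply i)]
      rw [h5, hν, h4, lintegral_smul_measure]
      simp
    rw [h3, hνu, ← Finset.mul_prod_erase _ _ (Finset.mem_univ i), ← mul_assoc,
      mul_left_comm, mul_comm (∏ j ∈ Finset.univ.erase i, μ (B j))] at h2
    have h6 : (∏ j ∈ Finset.univ.erase i, μ (B j)) ≠ 0 :=
      Finset.prod_ne_zero_iff.2 fun j _ => hB0 j
    have h7 : (∏ j ∈ Finset.univ.erase i, μ (B j)) ≠ ∞ :=
      ENNReal.prod_ne_top fun j _ => measure_ne_top _ _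
    rw [ENNReal.mul_le_mul_iff_left h6 h7] at h2
    have h8 : ENNReal.ofReal (c * r ^ n) * f (y i) ≤ ENNReal.ofReal (n + 2) *
        ∫⁻ w in closedBall X (2 * r), f w ∂μ := by
      calc _ ≤ f (y i) * μ (B i) := by
            rw [mul_comm]
            gcongr
            exact hpμ i
        _ ≤ _ := h2
        _ ≤ _ := by
            gcongr
            intro w hw
            have h1 := hpX i
            simp only [hB, mem_closedBall] at h1 hw ⊢
            linarith [dist_triangle w (p i) X]
    refine (ENNReal.ofReal_mul_le_of_ofReal_mul_mul_le hc h8).trans ?_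
    gcongr
    rw [hC₁]
    linarith

section ScaleEnergySum

variable {N n : ℕ} {K : (Fin (n + 2) → EuclideanSpace ℝ (Fin N)) → ℝ}

theorem scaleEnergy_eq_zero {μ : Measure (EuclideanSpace ℝ (Fin N))} [SigmaFinite μ] (σ r : ℝ)
    {A : Set (EuclideanSpace ℝ (Fin N))} (hA : MeasurableSet A) (hμA : μ A = 0) :
    scaleEnergy K μ σ r A = 0 := by
  rw [scaleEnergy_apply _ _ _ hA]
  refine setLIntegral_measure_zero _ _ (measure_mono_null inter_subset_left ?_)
  exact Measure.pi_eval_preimage_null (fun _ : Fin (n + 2) => μ) (i := 0) hμA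

theorem tsum_indicator_scaleSet_le {σ : ℝ} {J : ℕ} (hσ : 0 < σ) (hJ : 64 / σ < 2 ^ J)
    (z : Fin (n + 2) → EuclideanSpace ℝ (Fin N)) (a : ℝ≥0∞) :
    ∑' k : ℕ, (scaleSet N n σ ((1 / 2) ^ k)).indicator (fun _ => a) z ≤ J * a := by
  classical
  by_cases h : ∃ k : ℕ, z ∈ scaleSet N n σ ((1 / 2) ^ k)
  · set k₀ := Nat.find h with hk₀
    have h0 := Nat.find_spec h
    rw [tsum_eq_sum (s := Finset.Ico k₀ (k₀ + J))]
    · calc _ ≤ ∑ _k ∈ Finset.Ico k₀ (k₀ + J), a :=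
            Finset.sum_le_sum fun k _ => indicator_le_self' (fun _ _ => zero_le) z
        _ = _ := by simp
    · intro k hk
      refine indicator_of_notMem (fun hkz => hk ?_) _
      have hle : k₀ ≤ k := Nat.find_min' h hkz
      rw [Finset.mem_Ico]
      refine ⟨hle, ?_⟩
      by_contra! hlt
      obtain ⟨j, rfl⟩ := Nat.exists_eq_add_of_le hle
      have h1 : σ * (1 / 2) ^ k₀ ≤ 64 * (1 / 2) ^ (k₀ + j) := by
        refine h0.2.trans ?_
        rw [dist_comm]
        exact hkz.1 1
      have h2 : σ * 2 ^ j ≤ 64 := by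
        have h3 : (1 / 2 : ℝ) ^ (k₀ + j) * 2 ^ j = (1 / 2) ^ k₀ := by
          rw [pow_add, mul_assoc, ← mul_pow]
          norm_num
        have h4 : (0 : ℝ) < (1 / 2) ^ k₀ := by positivity
        have h5 : σ * (1 / 2) ^ k₀ * 2 ^ j ≤ 64 * (1 / 2) ^ (k₀ + j) * 2 ^ j := by gcongr
        rw [mul_assoc 64, h3] at h5
        nlinarith
      have h6 : (2 : ℝ) ^ J ≤ 2 ^ j := pow_le_pow_right₀ (by norm_num) (by omega)
      rw [div_lt_iff₀ hσ] at hJ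
      nlinarith
  · push Not at h
    simp_rw [fun k : ℕ => indicator_of_notMem (h k) (fun _ => a)]
    simp

theorem exists_tsum_scaleEnergy_le (hK : Measurable K) {σ : ℝ} (hσ : 0 < σ) :
    ∃ J : ℕ, ∀ μ : Measure (EuclideanSpace ℝ (Fin N)),
      ∑' k : ℕ, scaleEnergy K μ σ ((1 / 2) ^ k) univ ≤ J * MengerEnergy N n 2 K μ := by
  obtain ⟨J, hJ⟩ := pow_unbounded_of_one_lt (64 / σ) (one_lt_two (α := ℝ))
  refine ⟨J, fun μ => ?_⟩
  have hρ : Measurable fun z => ENNReal.ofReal (K z ^ (2 : ℝ)) :=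
    (hK.pow_const _).ennreal_ofReal
  calc ∑' k : ℕ, scaleEnergy K μ σ ((1 / 2) ^ k) univ
      = ∑' k : ℕ, ∫⁻ z, (scaleSet N n σ ((1 / 2) ^ k)).indicator
          (fun z => ENNReal.ofReal (K z ^ (2 : ℝ))) z ∂(Measure.pi fun _ : Fin (n + 2) => μ) := by
        congr 1
        ext k
        rw [scaleEnergy_apply _ _ _ MeasurableSet.univ,
          lintegral_indicator (measurableSet_scaleSet _ _ _ _)]
        simp
    _ = ∫⁻ z, ∑' k : ℕ, (scaleSet N n σ ((1 / 2) ^ k)).indicator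
          (fun z => ENNReal.ofReal (K z ^ (2 : ℝ))) z ∂(Measure.pi fun _ : Fin (n + 2) => μ) :=
        (lintegral_tsum fun k =>
          (hρ.indicator (measurableSet_scaleSet _ _ _ _)).aemeasurable).symm
    _ ≤ ∫⁻ z, J * ENNReal.ofReal (K z ^ (2 : ℝ)) ∂(Measure.pi fun _ : Fin (n + 2) => μ) := by
        refine lintegral_mono fun z => ?_
        refine le_trans (le_of_eq ?_) (tsum_indicator_scaleSet_le hσ hJ z _)
        congr 1
    _ = _ := lintegral_const_mul _ hρ

end ScaleEnergySum

/-- A measure with multiscale flatness control in `ℝᴺ`, together with a splitting of `ℝᴺ` into an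
approximately tangent part `P` and a normal part `Q`. -/
structure MultiscaleSetup (N n : ℕ) where
  μ : Measure (EuclideanSpace ℝ (Fin N))
  e : ℕ → Measure (EuclideanSpace ℝ (Fin N))
  P : EuclideanSpace ℝ (Fin N) →L[ℝ] EuclideanSpace ℝ (Fin n)
  Q : EuclideanSpace ℝ (Fin N) →L[ℝ] EuclideanSpace ℝ (Fin N)
  q : EuclideanSpace ℝ (Fin N)
  C₀ : ℝ
  C₁ : ℝ
  δ : ℝ
  ε : ℝ
  finite_μ : IsFiniteMeasure μ
  finite_e : ∀ k, IsFiniteMeasure (e k)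
  supp : μ (closedBall 0 (1 / 2))ᶜ = 0
  growth : ∀ x r, 0 < r → μ (closedBall x r) ≤ ENNReal.ofReal (C₀ * r ^ n)
  sel : FlatSelection n μ e δ C₁
  one_le_C₁ : 1 ≤ C₁
  C₀_pos : 0 < C₀
  ε_pos : 0 < ε
  δ_pos : 0 < δ
  mass : ENNReal.ofReal δ ≤ μ univ
  norm_P_le : ∀ x, ‖P x‖ ≤ ‖x‖
  norm_Q_le : ∀ x, ‖Q x‖ ≤ ‖x‖
  norm_le : ∀ x, ‖x‖ ≤ ‖P x‖ + ‖Q x‖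
  base : ∀ X ∈ closedBall (0 : EuclideanSpace ℝ (Fin N)) (1 / 2),
    ∫⁻ w in closedBall X 32, ENNReal.ofReal (‖Q w - q‖ ^ 2) ∂μ ≤
      ENNReal.ofReal C₁ * e 0 (closedBall X 32)
  small : 300 * (n + 1) * (4 * C₁ * 2 ^ n * (1 + 256 * (n + 1) * C₁)) * ε ≤ 1

namespace MultiscaleSetup

variable {N n : ℕ} (S : MultiscaleSetup N n)

attribute [instance] finite_μ finite_e

/-- Affine maps, as pairs of a constant and a linear part. -/
abbrev Aff (N n : ℕ) : Type :=
  EuclideanSpace ℝ (Fin N) × (EuclideanSpace ℝ (Fin n) →L[ℝ] EuclideanSpace ℝ (Fin N))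

/-- The normalized square flatness coefficient at scale `2⁻ᵏ`. -/
def b (k : ℕ) (X : EuclideanSpace ℝ (Fin N)) : ℝ :=
  √((S.e k).real (closedBall X (32 * (1 / 2) ^ k)) / ((1 / 2) ^ k) ^ n)

/-- The graph of `A` is close to `μ` in the square mean near `X` at scale `2⁻ᵏ`. -/
def App (X : EuclideanSpace ℝ (Fin N)) (k : ℕ) (A : Aff N n) : Prop :=
  ∫⁻ w in closedBall X (32 * (1 / 2) ^ k), ENNReal.ofReal (‖S.Q w - (A.1 + A.2 (S.P w))‖ ^ 2) ∂S.μ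
    ≤ ENNReal.ofReal (4 * S.C₁ * ((1 / 2) ^ k) ^ 2) * S.e k (closedBall X (32 * (1 / 2) ^ k))

/-- The ball of radius `2⁻ᵏ` around `X` has large measure. -/
def Dens (X : EuclideanSpace ℝ (Fin N)) (k : ℕ) : Prop :=
  ENNReal.ofReal (S.δ * ((1 / 2) ^ k) ^ n) ≤ S.μ (closedBall X ((1 / 2) ^ k))

/-- Comparison constant for approximating affine maps. -/
def C₃ : ℝ := 4 * S.C₁ * 2 ^ n * (1 + 256 * (n + 1) * S.C₁)

theorem C₁_pos : 0 < S.C₁ := one_pos.trans_le S.one_le_C₁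

theorem C₃_pos : 0 < S.C₃ := by
  have := S.C₁_pos
  unfold C₃
  positivity

theorem C₃_mul_ε_le : 300 * (n + 1) * S.C₃ * S.ε ≤ 1 := S.small

theorem C₃_mul_ε_le' : 300 * (S.C₃ * S.ε) ≤ 1 := by
  have h1 := S.C₃_mul_ε_le
  have h2 : 0 < S.C₃ * S.ε := mul_pos S.C₃_pos S.ε_pos
  have h3 : (0 : ℝ) ≤ n := Nat.cast_nonneg n
  nlinarith

theorem C₁_sq_mul_ε_le : 16 * (n + 1) * S.C₁ * (2 * S.C₁ * 2 ^ n) * S.ε ≤ 1 / 2 := by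
  have h1 := S.small
  have h2 := S.C₁_pos
  have h3 := S.ε_pos
  have h5 : (1 : ℝ) ≤ n + 1 := by
    have : (0 : ℝ) ≤ n := Nat.cast_nonneg n
    linarith
  have h4 : 0 ≤ (n + 1 : ℝ) * S.C₁ * (2 * S.C₁ * 2 ^ n) * S.ε := by positivity
  have h6 : (n + 1 : ℝ) * S.C₁ * (2 * S.C₁ * 2 ^ n) * S.ε * 1 ≤
      (n + 1 : ℝ) * S.C₁ * (2 * S.C₁ * 2 ^ n) * S.ε * (n + 1) := by gcongr
  have h7 : 0 ≤ (n + 1 : ℝ) * (S.C₁ * 2 ^ n) * S.ε := by positivity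
  nlinarith

theorem b_nonneg (k : ℕ) (X : EuclideanSpace ℝ (Fin N)) : 0 ≤ S.b k X := Real.sqrt_nonneg _

theorem b_sq_mul (k : ℕ) (X : EuclideanSpace ℝ (Fin N)) :
    S.b k X ^ 2 * ((1 / 2) ^ k) ^ n = (S.e k).real (closedBall X (32 * (1 / 2) ^ k)) := by
  rw [b, Real.sq_sqrt (by positivity), div_mul_cancel₀ _ (by positivity)]

theorem ofReal_b_sq_mul (k : ℕ) (X : EuclideanSpace ℝ (Fin N)) :
    ENNReal.ofReal (S.b k X ^ 2 * ((1 / 2) ^ k) ^ n) =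
      S.e k (closedBall X (32 * (1 / 2) ^ k)) := by
  rw [b_sq_mul, ofReal_measureReal]

theorem dens_zero {X : EuclideanSpace ℝ (Fin N)} (hX : X ∈ closedBall 0 (1 / 2)) :
    S.Dens X 0 := by
  have h1 : closedBall (0 : EuclideanSpace ℝ (Fin N)) (1 / 2) ⊆ closedBall X 1 := by
    intro w hw
    rw [mem_closedBall] at hX hw ⊢
    linarith [dist_triangle_right w X 0]
  have h2 : S.μ univ ≤ S.μ (closedBall X 1) := by
    have := measure_union_le (μ := S.μ) (closedBall (0 : EuclideanSpace ℝ (Fin N)) (1 / 2))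
      (closedBall (0 : EuclideanSpace ℝ (Fin N)) (1 / 2))ᶜ
    rw [union_compl_self, S.supp, add_zero] at this
    exact this.trans (measure_mono h1)
  simpa [Dens] using S.mass.trans h2

theorem measurable_residual (A : Aff N n) :
    Measurable fun w => ENNReal.ofReal (‖S.Q w - (A.1 + A.2 (S.P w))‖ ^ 2) := by
  have : Continuous fun w => ‖S.Q w - (A.1 + A.2 (S.P w))‖ ^ 2 := by fun_prop
  exact this.measurable.ennreal_ofReal

variable {S}

theorem App.lintegral_le {X Y : EuclideanSpace ℝ (Fin N)} {k : ℕ} {A : Aff N n} (h : S.App X k A)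
    {ρ : ℝ} (hXY : dist X Y + ρ ≤ 32 * (1 / 2) ^ k) :
    ∫⁻ w in closedBall Y ρ, ENNReal.ofReal (‖S.Q w - (A.1 + A.2 (S.P w))‖ ^ 2) ∂S.μ ≤
      ENNReal.ofReal (4 * S.C₁ * ((1 / 2) ^ k) ^ 2 * (S.b k X ^ 2 * ((1 / 2) ^ k) ^ n)) := by
  have h0 := S.C₁_pos
  rw [ENNReal.ofReal_mul (by positivity), ofReal_b_sq_mul]
  refine le_trans (lintegral_mono_set ?_) h
  refine closedBall_subset_closedBall' ?_
  rw [dist_comm]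
  linarith

theorem norm_residual_le {y : EuclideanSpace ℝ (Fin N)} {k j : ℕ} {A : Aff N n} {T : ℝ}
    (hjk : k = j ∨ k + 1 = j) (hT : 0 ≤ T) {I : ℝ≥0∞}
    (hI : I ≤ ENNReal.ofReal (4 * S.C₁ * ((1 / 2) ^ k) ^ 2 * (T ^ 2 * ((1 / 2) ^ k) ^ n)))
    (hy : ENNReal.ofReal (((1 / 2) ^ j) ^ n) *
      ENNReal.ofReal (‖S.Q y - (A.1 + A.2 (S.P y))‖ ^ 2) ≤ ENNReal.ofReal S.C₁ * I) :
    ‖S.Q y - (A.1 + A.2 (S.P y))‖ ≤ 2 * S.C₁ * 2 ^ n * (1 / 2) ^ k * T := by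
  have h0 := S.C₁_pos
  have h1 : ((1 / 2 : ℝ) ^ j) ^ n * ‖S.Q y - (A.1 + A.2 (S.P y))‖ ^ 2 ≤
      S.C₁ * (4 * S.C₁ * ((1 / 2) ^ k) ^ 2 * (T ^ 2 * ((1 / 2) ^ k) ^ n)) := by
    have h2 := hy.trans (mul_le_mul_right hI _)
    rw [← ENNReal.ofReal_mul (by positivity), ← ENNReal.ofReal_mul (by positivity)] at h2
    exact (ENNReal.ofReal_le_ofReal_iff (by positivity)).1 h2
  have h3 : ((1 / 2 : ℝ) ^ k) ^ n ≤ 2 ^ n * ((1 / 2) ^ j) ^ n := by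
    rw [← mul_pow]
    gcongr
    rcases hjk with rfl | rfl
    · have : (0 : ℝ) < (1 / 2) ^ k := by positivity
      linarith
    · rw [pow_succ]
      linarith
  have h4 : (0 : ℝ) < ((1 / 2) ^ j) ^ n := by positivity
  have h5 : ‖S.Q y - (A.1 + A.2 (S.P y))‖ ^ 2 ≤ (2 * S.C₁ * 2 ^ n * (1 / 2) ^ k * T) ^ 2 := by
    have h6 : ((1 / 2 : ℝ) ^ j) ^ n * ‖S.Q y - (A.1 + A.2 (S.P y))‖ ^ 2 ≤
        ((1 / 2 : ℝ) ^ j) ^ n * (2 * S.C₁ * 2 ^ n * (1 / 2) ^ k * T) ^ 2 := by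
      calc _ ≤ S.C₁ * (4 * S.C₁ * ((1 / 2) ^ k) ^ 2 * (T ^ 2 * (2 ^ n * ((1 / 2) ^ j) ^ n))) :=
            h1.trans (by gcongr)
        _ = 4 * S.C₁ ^ 2 * ((1 / 2) ^ k) ^ 2 * T ^ 2 * ((1 / 2) ^ j) ^ n * 2 ^ n := by ring
        _ ≤ 4 * S.C₁ ^ 2 * ((1 / 2) ^ k) ^ 2 * T ^ 2 * ((1 / 2) ^ j) ^ n * (2 ^ n * 2 ^ n) := by
            gcongr
            exact le_mul_of_one_le_left (by positivity) (one_le_pow₀ (by norm_num))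
        _ = _ := by ring
    exact le_of_mul_le_mul_left h6 h4
  exact (sq_le_sq₀ (norm_nonneg _) (by positivity)).1 h5

theorem App.norm_sub_le {X Y : EuclideanSpace ℝ (Fin N)} {k j : ℕ} {A A' : Aff N n}
    (hA : S.App X k A) (hA' : S.App Y j A') (hjk : k = j ∨ k + 1 = j) (hY : S.Dens Y j)
    (hΛ : ‖A.2‖ ≤ 1) (hXY : dist X Y ≤ 30 * (1 / 2) ^ k) (hbX : S.b k X ≤ S.ε)
    (hbY : S.b j Y ≤ S.ε) (v : EuclideanSpace ℝ (Fin n)) :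
    ‖(A.1 + A.2 v) - (A'.1 + A'.2 v)‖ ≤
      S.C₃ * (S.b k X + S.b j Y) * ((1 / 2) ^ k + ‖v - S.P X‖) := by
  have h0 := S.C₁_pos
  set r : ℝ := (1 / 2) ^ k with hr
  set s : ℝ := (1 / 2) ^ j with hs
  have hr0 : 0 < r := by positivity
  have hs0 : 0 < s := by positivity
  have hsr : s ≤ r ∧ r ≤ 2 * s := by
    rcases hjk with rfl | rfl
    · constructor <;> linarith
    · rw [hs, pow_succ]
      constructor <;> linarith
  have hbX0 := S.b_nonneg k X
  have hbY0 := S.b_nonneg j Y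
  set T := S.b k X + S.b j Y with hT
  obtain ⟨y, hyY, hyC, -, hyf⟩ := S.sel Y j hY
    (fun w => ENNReal.ofReal (‖S.Q w - (A.1 + A.2 (S.P w))‖ ^ 2) +
      ENNReal.ofReal (‖S.Q w - (A'.1 + A'.2 (S.P w))‖ ^ 2))
    ((S.measurable_residual A).add (S.measurable_residual A'))
  have hI : ∫⁻ w in closedBall Y (2 * s), (ENNReal.ofReal (‖S.Q w - (A.1 + A.2 (S.P w))‖ ^ 2) +
      ENNReal.ofReal (‖S.Q w - (A'.1 + A'.2 (S.P w))‖ ^ 2)) ∂S.μ ≤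
      ENNReal.ofReal (4 * S.C₁ * r ^ 2 * (T ^ 2 * r ^ n)) := by
    rw [lintegral_add_left (S.measurable_residual A)]
    refine (add_le_add (hA.lintegral_le (by linarith [hsr.1]))
      (hA'.lintegral_le (by rw [dist_self]; linarith))).trans ?_
    rw [← ENNReal.ofReal_add (by positivity) (by positivity)]
    apply ENNReal.ofReal_le_ofReal
    calc 4 * S.C₁ * r ^ 2 * (S.b k X ^ 2 * r ^ n) + 4 * S.C₁ * s ^ 2 * (S.b j Y ^ 2 * s ^ n)
        ≤ 4 * S.C₁ * r ^ 2 * (S.b k X ^ 2 * r ^ n) + 4 * S.C₁ * r ^ 2 * (S.b j Y ^ 2 * r ^ n) := by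
          have := hsr.1
          gcongr
      _ = 4 * S.C₁ * r ^ 2 * ((S.b k X ^ 2 + S.b j Y ^ 2) * r ^ n) := by ring
      _ ≤ _ := by
          gcongr
          rw [hT]
          nlinarith
  have hT0 : 0 ≤ T := by positivity
  have hres : ∀ i, ‖S.Q (y i) - (A.1 + A.2 (S.P (y i)))‖ ≤ 2 * S.C₁ * 2 ^ n * r * T := fun i =>
    norm_residual_le hjk hT0 hI ((mul_le_mul_right le_self_add _).trans (hyf i))
  have hres' : ∀ i, ‖S.Q (y i) - (A'.1 + A'.2 (S.P (y i)))‖ ≤ 2 * S.C₁ * 2 ^ n * r * T := fun i =>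
    norm_residual_le hjk hT0 hI ((mul_le_mul_right le_add_self _).trans (hyf i))
  have hTε : T ≤ 2 * S.ε := by linarith
  have hgraph := hyC.of_graph (τ := 2 * S.C₁ * 2 ^ n * r * T) (by positivity) (by positivity)
    (by
      rw [Fintype.card_fin]
      push_cast
      calc S.C₁ / s * (n + 1) * (2 * S.C₁ * 2 ^ n * r * T)
          ≤ S.C₁ / s * (n + 1) * (2 * S.C₁ * 2 ^ n * (2 * s) * (2 * S.ε)) := by
            have := hsr.2
            gcongr
        _ = 4 * ((n + 1) * S.C₁ * (2 * S.C₁ * 2 ^ n) * S.ε) := by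
            field_simp
            ring
        _ ≤ 1 / 2 := by
            have := S.C₁_sq_mul_ε_le
            have h4 : 0 ≤ (n + 1 : ℝ) * S.C₁ * (2 * S.C₁ * 2 ^ n) * S.ε := by
              have := S.ε_pos
              positivity
            nlinarith)
    S.P S.Q S.norm_le A.2 hΛ A.1 hres
  have hdiff := hgraph.norm_affine_le (τ := 2 * (2 * S.C₁ * 2 ^ n * r * T)) (by simp)
    (A.2 - A'.2) (A.1 - A'.1) (fun i => by
      have : A.1 - A'.1 + (A.2 - A'.2) (S.P (y i)) =
          (S.Q (y i) - (A'.1 + A'.2 (S.P (y i)))) - (S.Q (y i) - (A.1 + A.2 (S.P (y i)))) := by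
        simp only [sub_apply]
        abel
      rw [this]
      refine (_root_.norm_sub_le _ _).trans ?_
      linarith [hres i, hres' i]) v
  have hv : ‖v - S.P (y 0)‖ ≤ ‖v - S.P X‖ + 32 * r := by
    have h1 : v - S.P (y 0) = (v - S.P X) + S.P (X - y 0) := by simp
    rw [h1]
    refine (norm_add_le _ _).trans (add_le_add le_rfl ((S.norm_P_le _).trans ?_))
    rw [← dist_eq_norm]
    have := hyY 0
    rw [mem_closedBall, dist_comm] at this
    linarith [dist_triangle X Y (y 0), hsr.1]
  have heq : (A.1 + A.2 v) - (A'.1 + A'.2 v) = A.1 - A'.1 + (A.2 - A'.2) v := by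
    simp only [sub_apply]
    abel
  rw [heq]
  refine hdiff.trans ?_
  have hsr' : S.C₁ / s ≤ 2 * S.C₁ / r := by
    rw [div_le_div_iff₀ hs0 hr0]
    nlinarith [hsr.2]
  set d := ‖v - S.P X‖ with hd
  have hd0 : 0 ≤ d := norm_nonneg _
  calc 2 * (2 * S.C₁ * 2 ^ n * r * T) * (1 + (n + 1) * (4 * (S.C₁ / s)) * ‖v - S.P (y 0)‖)
      ≤ 2 * (2 * S.C₁ * 2 ^ n * r * T) * (1 + (n + 1) * (4 * (2 * S.C₁ / r)) * (d + 32 * r)) := by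
        gcongr
    _ = 4 * S.C₁ * 2 ^ n * T * (r * (1 + 256 * (n + 1) * S.C₁) + (8 * (n + 1) * S.C₁) * d) := by
        field_simp
        ring
    _ ≤ 4 * S.C₁ * 2 ^ n * T * (r * (1 + 256 * (n + 1) * S.C₁)
          + (1 + 256 * (n + 1) * S.C₁) * d) := by
        gcongr
        have : 0 < (n + 1) * S.C₁ := by positivity
        nlinarith
    _ = _ := by
        unfold C₃
        ring

theorem App.exists_succ {X : EuclideanSpace ℝ (Fin N)} {k : ℕ} {A : Aff N n}
    (hA : S.App X k A) (hΛ : ‖A.2‖ ≤ 1 / 2) (hX : S.Dens X (k + 1)) (hbX : S.b k X ≤ S.ε) :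
    ∃ A', S.App X (k + 1) A' ∧ ‖A'.2‖ ≤ 1 := by
  have h0 := S.C₁_pos
  set r : ℝ := (1 / 2) ^ k with hr
  set s : ℝ := (1 / 2) ^ (k + 1) with hs
  have hr0 : 0 < r := by positivity
  have hs0 : 0 < s := by positivity
  have hsr : r = 2 * s := by
    rw [hs, pow_succ]
    ring
  have hb0 := S.b_nonneg k X
  obtain ⟨y, hyY, hyC, hyaff, hyf⟩ := S.sel X (k + 1) hX _ (S.measurable_residual A)
  have hI := hA.lintegral_le (Y := X) (ρ := 2 * s) (by rw [dist_self]; linarith)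
  have hres : ∀ i, ‖S.Q (y i) - (A.1 + A.2 (S.P (y i)))‖ ≤ 2 * S.C₁ * 2 ^ n * r * S.b k X :=
    fun i => norm_residual_le (Or.inr rfl) hb0 hI (hyf i)
  have hε := S.ε_pos
  have hgraph := hyC.of_graph (τ := 2 * S.C₁ * 2 ^ n * r * S.b k X) (by positivity) (by positivity)
    (by
      rw [Fintype.card_fin]
      push_cast
      calc S.C₁ / s * (n + 1) * (2 * S.C₁ * 2 ^ n * r * S.b k X)
          ≤ S.C₁ / s * (n + 1) * (2 * S.C₁ * 2 ^ n * (2 * s) * S.ε) := by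
            rw [← hsr]
            gcongr
        _ = 2 * ((n + 1) * S.C₁ * (2 * S.C₁ * 2 ^ n) * S.ε) := by
            field_simp
        _ ≤ 1 / 2 := by
            have := S.C₁_sq_mul_ε_le
            have h4 : 0 ≤ (n + 1 : ℝ) * S.C₁ * (2 * S.C₁ * 2 ^ n) * S.ε := by positivity
            nlinarith)
    S.P S.Q S.norm_le A.2 (by linarith) A.1 hres
  obtain ⟨Λ, c, hΛc⟩ := hgraph.exists_interpolation (by simp) fun i => S.Q (y i)
  have hΛ' : ‖Λ‖ ≤ 1 := by
    have h1 : ‖Λ - A.2‖ ≤ 1 / 2 := by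
      refine ContinuousLinearMap.opNorm_le_bound _ (by norm_num) fun v => ?_
      refine (hgraph.norm_linear_le (τ := 2 * S.C₁ * 2 ^ n * r * S.b k X) (by simp)
        (Λ - A.2) (c - A.1) (fun i => ?_) v).trans ?_
      · have : c - A.1 + (Λ - A.2) (S.P (y i)) = S.Q (y i) - (A.1 + A.2 (S.P (y i))) := by
          rw [← hΛc i]
          simp only [sub_apply]
          abel
        rw [this]
        exact hres i
      · gcongr
        calc (n + 1) * (4 * (S.C₁ / s)) * (2 * S.C₁ * 2 ^ n * r * S.b k X)
            ≤ (n + 1) * (4 * (S.C₁ / s)) * (2 * S.C₁ * 2 ^ n * (2 * s) * S.ε) := by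
              rw [← hsr]
              gcongr
          _ = 8 * ((n + 1) * S.C₁ * (2 * S.C₁ * 2 ^ n) * S.ε) := by
              field_simp
              ring
          _ ≤ 1 / 2 := by
              have := S.C₁_sq_mul_ε_le
              have h4 : 0 ≤ (n + 1 : ℝ) * S.C₁ * (2 * S.C₁ * 2 ^ n) * S.ε := by positivity
              nlinarith
    have h2 : Λ = (Λ - A.2) + A.2 := by abel
    rw [h2]
    refine (norm_add_le _ _).trans ?_
    linarith
  refine ⟨(c, Λ), ?_, hΛ'⟩
  have hpt : ∀ w, ‖S.Q w - (c + Λ (S.P w))‖ ≤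
      2 * infDist w (affineSpan ℝ (range y) : Set (EuclideanSpace ℝ (Fin N))) := by
    intro w
    rw [mul_comm, ← div_le_iff₀ (by norm_num)]
    have hne : (affineSpan ℝ (range y) : Set (EuclideanSpace ℝ (Fin N))).Nonempty := by
      rw [affineSpan_nonempty]
      exact range_nonempty y
    refine (le_infDist hne).2 fun p hp => ?_
    rw [← image_univ] at hp
    obtain ⟨a, ha, -, rfl⟩ := exists_coeff_of_mem_affineSpan_image hp
    set p := ∑ i, a i • y i with hpdef
    have h1 : S.Q p = c + Λ (S.P p) := by
      simp only [hpdef, map_sum, map_smul]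
      simp_rw [← hΛc, smul_add, Finset.sum_add_distrib, ← Finset.sum_smul, ha, one_smul]
    have h2 : S.Q w - (c + Λ (S.P w)) = S.Q (w - p) - Λ (S.P (w - p)) := by
      simp only [map_sub, h1]
      abel
    rw [h2, div_le_iff₀ (by norm_num), dist_eq_norm]
    refine (_root_.norm_sub_le _ _).trans ?_
    have h3 := S.norm_Q_le (w - p)
    have h4 := (Λ.le_of_opNorm_le hΛ' (S.P (w - p))).trans_eq (one_mul _)
    have h5 := S.norm_P_le (w - p)
    linarith
  unfold App
  calc _ ≤ ∫⁻ w in closedBall X (32 * s), ENNReal.ofReal 4 * ENNReal.ofReal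
        (infDist w (affineSpan ℝ (range y) : Set (EuclideanSpace ℝ (Fin N))) ^ 2) ∂S.μ := by
        refine lintegral_mono fun w => ?_
        rw [← ENNReal.ofReal_mul (by norm_num)]
        apply ENNReal.ofReal_le_ofReal
        have h1 := hpt w
        have h2 := pow_le_pow_left₀ (norm_nonneg _) h1 2
        exact h2.trans (le_of_eq (by ring))
    _ = ENNReal.ofReal 4 * ∫⁻ w in closedBall X (32 * s), ENNReal.ofReal
        (infDist w (affineSpan ℝ (range y) : Set (EuclideanSpace ℝ (Fin N))) ^ 2) ∂S.μ :=
        lintegral_const_mul _ ((continuous_infDist_pt _).pow 2).measurable.ennreal_ofReal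
    _ ≤ ENNReal.ofReal 4 * (ENNReal.ofReal (S.C₁ * s ^ 2) *
          S.e (k + 1) (closedBall X (32 * s))) := by gcongr
    _ = _ := by
        rw [← mul_assoc, ← ENNReal.ofReal_mul (by norm_num), ← mul_assoc]

end MultiscaleSetup

namespace MultiscaleSetup

variable {N n : ℕ} (S : MultiscaleSetup N n)

open Classical in
/-- A choice of approximating affine map at each point and scale. -/
def aff (k : ℕ) (X : EuclideanSpace ℝ (Fin N)) : Aff N n :=
  if h : k ≠ 0 ∧ ∃ A, S.App X k A ∧ ‖A.2‖ ≤ 1 then h.2.choose else (S.q, 0)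

/-- Values of the chosen approximating affine map. -/
def val (k : ℕ) (X : EuclideanSpace ℝ (Fin N)) (v : EuclideanSpace ℝ (Fin n)) :
    EuclideanSpace ℝ (Fin N) :=
  (S.aff k X).1 + (S.aff k X).2 v

/-- The points at which the approximation is under control down to scale `2⁻ᵏ`. -/
def good : ℕ → Set (EuclideanSpace ℝ (Fin N))
  | 0 => {X | X ∈ closedBall 0 (1 / 2) ∧ (∀ k, S.b k X ≤ S.ε) ∧ ‖S.Q X - S.q‖ ≤ 1 / 24}
  | k + 1 => {X | X ∈ good k ∧ S.Dens X (k + 1) ∧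
      (∀ Y ∈ good k, ‖S.P X - S.P Y‖ < 2 * (1 / 2) ^ k → ‖(S.aff k Y).2‖ < 1 / 2) ∧
      ‖S.Q X - S.val (k + 1) X (S.P X)‖ ≤ 1 / 24 * (1 / 2) ^ (k + 1)}

theorem good_antitone : Antitone S.good :=
  antitone_nat_of_succ_le fun _ _ h => h.1

variable {S}

@[simp]
theorem aff_zero (X : EuclideanSpace ℝ (Fin N)) : S.aff 0 X = (S.q, 0) := by
  simp [aff]

@[simp]
theorem val_zero (X : EuclideanSpace ℝ (Fin N)) (v : EuclideanSpace ℝ (Fin n)) :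
    S.val 0 X v = S.q := by
  simp [val]

theorem good_subset_zero (k : ℕ) : S.good k ⊆ S.good 0 := S.good_antitone (Nat.zero_le k)

theorem mem_closedBall_of_mem_good {k : ℕ} {X : EuclideanSpace ℝ (Fin N)} (h : X ∈ S.good k) :
    X ∈ closedBall 0 (1 / 2) := (good_subset_zero k h).1

theorem b_le_of_mem_good {k : ℕ} {X : EuclideanSpace ℝ (Fin N)} (h : X ∈ S.good k) (j : ℕ) :
    S.b j X ≤ S.ε := (good_subset_zero k h).2.1 j

theorem dens_of_mem_good {k : ℕ} {X : EuclideanSpace ℝ (Fin N)} (h : X ∈ S.good k) :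
    S.Dens X k := by
  cases k with
  | zero => exact S.dens_zero h.1
  | succ k => exact h.2.1

theorem residual_of_mem_good {k : ℕ} {X : EuclideanSpace ℝ (Fin N)} (h : X ∈ S.good k) :
    ‖S.Q X - S.val k X (S.P X)‖ ≤ 1 / 24 * (1 / 2) ^ k := by
  cases k with
  | zero => simpa using h.2.2
  | succ k => exact h.2.2.2

theorem aff_succ_spec {k : ℕ} {X : EuclideanSpace ℝ (Fin N)}
    (h : ∃ A, S.App X (k + 1) A ∧ ‖A.2‖ ≤ 1) :
    S.App X (k + 1) (S.aff (k + 1) X) ∧ ‖(S.aff (k + 1) X).2‖ ≤ 1 := by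
  have h' : k + 1 ≠ 0 ∧ ∃ A, S.App X (k + 1) A ∧ ‖A.2‖ ≤ 1 := ⟨k.succ_ne_zero, h⟩
  rw [aff, dif_pos h']
  exact h'.2.choose_spec

theorem app_zero {X : EuclideanSpace ℝ (Fin N)} (h : X ∈ closedBall 0 (1 / 2)) :
    S.App X 0 (S.aff 0 X) := by
  have h1 := S.base X h
  have h2 := S.C₁_pos
  simp only [App, aff_zero, zero_apply, add_zero, pow_zero, mul_one, one_pow]
  exact h1.trans (mul_le_mul_left (ENNReal.ofReal_le_ofReal (by linarith)) _)

/-- The approximating maps at the next scale, as soon as density and slope are under control. -/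
theorem app_succ_of_dens {k : ℕ} {X : EuclideanSpace ℝ (Fin N)} (h : X ∈ S.good k)
    (hA : S.App X k (S.aff k X)) (hX : S.Dens X (k + 1)) (hs : ‖(S.aff k X).2‖ < 1 / 2) :
    S.App X (k + 1) (S.aff (k + 1) X) ∧ ‖(S.aff (k + 1) X).2‖ ≤ 1 :=
  aff_succ_spec (hA.exists_succ hs.le hX (b_le_of_mem_good h k))

theorem app_of_mem_good {k : ℕ} {X : EuclideanSpace ℝ (Fin N)} (h : X ∈ S.good k) :
    S.App X k (S.aff k X) ∧ ‖(S.aff k X).2‖ ≤ 1 := by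
  induction k with
  | zero => exact ⟨app_zero h.1, by simp⟩
  | succ k ih =>
    refine app_succ_of_dens h.1 (ih h.1).1 h.2.1 (h.2.2.1 X h.1 ?_)
    rw [sub_self, norm_zero]
    positivity

theorem norm_val_sub_val_le {k j : ℕ} {X Y : EuclideanSpace ℝ (Fin N)} (hX : X ∈ S.good k)
    (hY : Y ∈ S.good j) (hjk : k = j ∨ k + 1 = j) (hXY : dist X Y ≤ 30 * (1 / 2) ^ k)
    (v : EuclideanSpace ℝ (Fin n)) :
    ‖S.val k X v - S.val j Y v‖ ≤
      S.C₃ * (S.b k X + S.b j Y) * ((1 / 2) ^ k + ‖v - S.P X‖) :=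
  (app_of_mem_good hX).1.norm_sub_le (app_of_mem_good hY).1 hjk (dens_of_mem_good hY)
    (app_of_mem_good hX).2 hXY (b_le_of_mem_good hX k) (b_le_of_mem_good hY j) v

theorem norm_val_sub_val_self_le {k : ℕ} {X : EuclideanSpace ℝ (Fin N)} (hX : X ∈ S.good k)
    (v w : EuclideanSpace ℝ (Fin n)) : ‖S.val k X v - S.val k X w‖ ≤ ‖v - w‖ := by
  have : S.val k X v - S.val k X w = (S.aff k X).2 (v - w) := by
    simp [val]
  rw [this]
  exact ((S.aff k X).2.le_of_opNorm_le (app_of_mem_good hX).2 _).trans_eq (one_mul _)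

/-- On the set of good points the projection `P` is bi-Lipschitz down to scale `2⁻ᵏ`. -/
theorem dist_le_max_of_mem_good {k : ℕ} {X Y : EuclideanSpace ℝ (Fin N)} (hX : X ∈ S.good k)
    (hY : Y ∈ S.good k) :
    dist X Y ≤ max ((1 / 2) ^ k / 2) (4 * ‖S.P X - S.P Y‖) := by
  by_cases hd : dist X Y ≤ (1 / 2) ^ k / 2
  · exact le_max_of_le_left hd
  refine le_max_of_le_right ?_
  push Not at hd
  have hd1 : dist X Y ≤ 1 := by
    have h1 := mem_closedBall.1 (mem_closedBall_of_mem_good hX)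
    have h2 := mem_closedBall.1 (mem_closedBall_of_mem_good hY)
    linarith [dist_triangle_right X Y 0]
  have hd0 : 0 < dist X Y := lt_trans (by positivity) hd
  obtain ⟨j, hj1, hj2⟩ := exists_nat_pow_near_of_lt_one hd0 hd1 (y := (1 / 2 : ℝ))
    (by norm_num) (by norm_num)
  have hjk : j ≤ k := by
    by_contra hcon
    push Not at hcon
    have : (1 / 2 : ℝ) ^ j ≤ (1 / 2) ^ (k + 1) :=
      pow_le_pow_of_le_one (by norm_num) (by norm_num) hcon
    rw [pow_succ] at this
    linarith
  have hXj := S.good_antitone hjk hX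
  have hYj := S.good_antitone hjk hY
  set r : ℝ := (1 / 2) ^ j with hr
  have hr0 : 0 < r := by positivity
  rw [pow_succ] at hj1
  have h1 := norm_val_sub_val_le hYj hXj (Or.inl rfl) (by rw [dist_comm]; linarith) (S.P Y)
  have h2 := norm_val_sub_val_self_le hXj (S.P X) (S.P Y)
  have h3 := residual_of_mem_good hXj
  have h4 := residual_of_mem_good hYj
  have h5 : ‖S.Q X - S.Q Y‖ ≤ ‖S.Q X - S.val j X (S.P X)‖ +
      ‖S.val j X (S.P X) - S.val j X (S.P Y)‖ + ‖S.val j Y (S.P Y) - S.val j X (S.P Y)‖ +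
      ‖S.Q Y - S.val j Y (S.P Y)‖ := by
    have : S.Q X - S.Q Y = (S.Q X - S.val j X (S.P X)) +
      (S.val j X (S.P X) - S.val j X (S.P Y)) - (S.val j Y (S.P Y) - S.val j X (S.P Y)) -
      (S.Q Y - S.val j Y (S.P Y)) := by abel
    rw [this]
    refine (_root_.norm_sub_le _ _).trans (add_le_add ?_ le_rfl)
    refine (_root_.norm_sub_le _ _).trans (add_le_add ?_ le_rfl)
    exact norm_add_le _ _
  have h6 : S.C₃ * (S.b j Y + S.b j X) * (r + ‖S.P Y - S.P Y‖) ≤ 1 / 150 * r := by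
    rw [sub_self, norm_zero, add_zero]
    gcongr
    have h7 := b_le_of_mem_good hXj j
    have h8 := b_le_of_mem_good hYj j
    have h9 := S.C₃_mul_ε_le'
    have h10 := S.C₃_pos
    nlinarith
  have h7 := S.norm_le (X - Y)
  rw [map_sub, map_sub, ← dist_eq_norm] at h7
  linarith

theorem dist_le_of_mem_iInter_good {X Y : EuclideanSpace ℝ (Fin N)} (hX : X ∈ ⋂ k, S.good k)
    (hY : Y ∈ ⋂ k, S.good k) : dist X Y ≤ 4 * ‖S.P X - S.P Y‖ := by
  rw [mem_iInter] at hX hY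
  by_contra! hcon
  have hd0 : 0 < dist X Y := lt_of_le_of_lt (by positivity) hcon
  obtain ⟨k, hk⟩ := exists_pow_lt_of_lt_one hd0 (y := (1 / 2 : ℝ)) (by norm_num)
  have h1 := dist_le_max_of_mem_good (hX k) (hY k)
  rcases le_max_iff.1 h1 with h | h <;> linarith

/-- The limit set of good points is contained in a Lipschitz graph. -/
theorem exists_lipschitz_of_iInter_good :
    ∃ f : EuclideanSpace ℝ (Fin n) → EuclideanSpace ℝ (Fin N),
      (∃ L, LipschitzWith L f) ∧ ⋂ k, S.good k ⊆ range f := by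
  set Z := ⋂ k, S.good k with hZ
  have hinj : InjOn S.P Z := fun X hX Y hY hXY => by
    have := dist_le_of_mem_iInter_good hX hY
    rw [hXY, sub_self, norm_zero, mul_zero] at this
    exact dist_le_zero.1 this
  let g := Function.invFunOn S.P Z
  have hg : LipschitzOnWith 4 g (S.P '' Z) := by
    refine LipschitzOnWith.of_dist_le_mul ?_
    rintro _ ⟨X, hX, rfl⟩ _ ⟨Y, hY, rfl⟩
    have h1 : ∀ X ∈ Z, g (S.P X) = X := fun X hX => hinj.leftInvOn_invFunOn hX
    rw [h1 X hX, h1 Y hY, dist_eq_norm (S.P X)]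
    exact dist_le_of_mem_iInter_good hX hY
  obtain ⟨f, hf, hfg⟩ := hg.extend_finite_dimension
  refine ⟨f, ⟨_, hf⟩, fun X hX => ⟨S.P X, ?_⟩⟩
  rw [← hfg (mem_image_of_mem _ hX)]
  exact hinj.leftInvOn_invFunOn hX

end MultiscaleSetup

section Slope

variable {V F : Type*} [NormedAddCommGroup V] [NormedSpace ℝ V]
  [NormedAddCommGroup F] [InnerProductSpace ℝ F]

/-- The difference quotient of `a` in direction `v` with dyadic step `2⁻⁽ᵏ⁺¹⁾`. -/
def dyadicSlope (a : V → F) (v : V) (k : ℕ) (y : V) : F :=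
  ((2 : ℝ) ^ (k + 1)) • (a (y + ((1 / 2 : ℝ) ^ (k + 1)) • v) - a y)

theorem dyadicSlope_eq (a : V → F) (v : V) (k : ℕ) (y : V) :
    dyadicSlope a v k y = (1 / 2 : ℝ) • (dyadicSlope a v (k + 1) y +
      dyadicSlope a v (k + 1) (y + ((1 / 2 : ℝ) ^ (k + 2)) • v)) := by
  have h : y + ((1 / 2 : ℝ) ^ (k + 2)) • v + ((1 / 2 : ℝ) ^ (k + 2)) • v =
      y + ((1 / 2 : ℝ) ^ (k + 1)) • v := by
    rw [add_assoc, ← add_smul]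
    congr 2
    ring
  simp only [dyadicSlope, add_assoc k 1 1, one_add_one_eq_two, h]
  rw [← smul_add, smul_smul]
  congr 1
  · ring
  · abel

theorem norm_sq_dyadicSlope_add (a : V → F) (v : V) (k : ℕ) (y : V) :
    ‖dyadicSlope a v k y‖ ^ 2 + ‖(1 / 2 : ℝ) • (dyadicSlope a v (k + 1) y -
      dyadicSlope a v (k + 1) (y + ((1 / 2 : ℝ) ^ (k + 2)) • v))‖ ^ 2 =
    1 / 2 * (‖dyadicSlope a v (k + 1) y‖ ^ 2 +
      ‖dyadicSlope a v (k + 1) (y + ((1 / 2 : ℝ) ^ (k + 2)) • v)‖ ^ 2) := by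
  rw [dyadicSlope_eq]
  set p := dyadicSlope a v (k + 1) y
  set p' := dyadicSlope a v (k + 1) (y + ((1 / 2 : ℝ) ^ (k + 2)) • v)
  have := parallelogram_law_with_norm ℝ p p'
  rw [norm_smul, norm_smul, mul_pow, mul_pow, ← mul_add]
  norm_num
  nlinarith

variable [MeasurableSpace V] [BorelSpace V] [MeasurableSpace F] [BorelSpace F] [SecondCountableTopology F]

theorem measurable_dyadicSlope {a : V → F} (ha : Measurable a) (v : V) (k : ℕ) :
    Measurable (dyadicSlope a v k) := by
  have h1 : Measurable fun y : V => y + ((1 / 2 : ℝ) ^ (k + 1)) • v :=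
    (continuous_id.add continuous_const).measurable
  exact ((ha.comp h1).sub ha).const_smul _

theorem lintegral_slope_succ_le [FiniteDimensional ℝ V] (ν : Measure V) [ν.IsAddHaarMeasure]
    {a : V → F} (ha : Measurable a) (v : V)
    {s s' : Set V} (hs : MeasurableSet s) (hs' : MeasurableSet s') {k : ℕ} (h1 : s' ⊆ s)
    (h2 : ∀ y ∈ s', y - ((1 / 2 : ℝ) ^ (k + 2)) • v ∈ s) :
    ∫⁻ y in s', ENNReal.ofReal (‖dyadicSlope a v (k + 1) y‖ ^ 2) ∂ν +
      ∫⁻ y in (s ∩ {y | y - ((1 / 2 : ℝ) ^ (k + 2)) • v ∈ s}) \ s',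
        ENNReal.ofReal (‖dyadicSlope a v (k + 1) y‖ ^ 2) ∂ν ≤
    ∫⁻ y in s, ENNReal.ofReal (‖dyadicSlope a v k y‖ ^ 2) ∂ν +
      ∫⁻ y in s, ENNReal.ofReal (‖(1 / 2 : ℝ) • (dyadicSlope a v (k + 1) y -
        dyadicSlope a v (k + 1) (y + ((1 / 2 : ℝ) ^ (k + 2)) • v))‖ ^ 2) ∂ν := by
  set t : V := ((1 / 2 : ℝ) ^ (k + 2)) • v with ht
  set g : V → ℝ≥0∞ := fun y => ENNReal.ofReal (‖dyadicSlope a v (k + 1) y‖ ^ 2) with hg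
  have hgm : Measurable g := ((measurable_dyadicSlope ha v (k + 1)).norm.pow_const 2).ennreal_ofReal
  have hsub : Measurable fun y : V => y - t := (continuous_id.sub continuous_const).measurable
  have hadd : Measurable fun y : V => y + t := (continuous_id.add continuous_const).measurable
  have hst : MeasurableSet {y | y - t ∈ s} := hsub hs
  have e1 : ∫⁻ y in s', g y ∂ν + ∫⁻ y in (s ∩ {y | y - t ∈ s}) \ s', g y ∂ν =
      ∫⁻ y in s ∩ {y | y - t ∈ s}, g y ∂ν := by
    rw [← lintegral_union ((hs.inter hst).diff hs') disjoint_sdiff_right]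
    congr 2
    rw [Set.union_sdiff_cancel]
    exact fun y hy => ⟨h1 hy, h2 y hy⟩
  have e2 : ∫⁻ y in s, ENNReal.ofReal (‖dyadicSlope a v k y‖ ^ 2) ∂ν +
      ∫⁻ y in s, ENNReal.ofReal (‖(1 / 2 : ℝ) • (dyadicSlope a v (k + 1) y -
        dyadicSlope a v (k + 1) (y + t))‖ ^ 2) ∂ν =
      ENNReal.ofReal (1 / 2) * (∫⁻ y in s, g y ∂ν + ∫⁻ y in s, g (y + t) ∂ν) := by
    rw [← lintegral_add_left ((measurable_dyadicSlope ha v k).norm.pow_const 2).ennreal_ofReal,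
      ← lintegral_add_left hgm, ← lintegral_const_mul (f := fun y => g y + g (y + t)) _ (hgm.add (hgm.comp hadd))]
    refine lintegral_congr fun y => ?_
    rw [hg, ← ENNReal.ofReal_add (by positivity) (by positivity),
      ← ENNReal.ofReal_add (by positivity) (by positivity), ← ENNReal.ofReal_mul (by norm_num),
      norm_sq_dyadicSlope_add]
  have e3 : ∫⁻ y in s, g (y + t) ∂ν = ∫⁻ y in {y | y - t ∈ s}, g y ∂ν := by
    rw [← lintegral_indicator hs, ← lintegral_indicator hst,
      ← lintegral_add_right_eq_self (μ := ν) (indicator {y | y - t ∈ s} g) t]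
    refine lintegral_congr fun y => ?_
    have : y + t ∈ {y | y - t ∈ s} ↔ y ∈ s := by
      change y + t - t ∈ s ↔ y ∈ s
      rw [add_sub_cancel_right]
    by_cases hy : y ∈ s
    · rw [indicator_of_mem hy, indicator_of_mem (this.2 hy)]
    · rw [indicator_of_notMem hy, indicator_of_notMem (mt this.1 hy)]
  rw [e1, e2, e3]
  have h5 : ∫⁻ y in s ∩ {y | y - t ∈ s}, g y ∂ν ≤ ∫⁻ y in s, g y ∂ν :=
    lintegral_mono_set inter_subset_left
  have h6 : ∫⁻ y in s ∩ {y | y - t ∈ s}, g y ∂ν ≤ ∫⁻ y in {y | y - t ∈ s}, g y ∂ν :=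
    lintegral_mono_set inter_subset_right
  calc ∫⁻ y in s ∩ {y | y - t ∈ s}, g y ∂ν
      = ENNReal.ofReal (1 / 2) * (∫⁻ y in s ∩ {y | y - t ∈ s}, g y ∂ν +
          ∫⁻ y in s ∩ {y | y - t ∈ s}, g y ∂ν) := by
        rw [← two_mul, ← mul_assoc]
        have : ENNReal.ofReal (1 / 2) * 2 = 1 := by
          rw [← ENNReal.ofReal_ofNat 2, ← ENNReal.ofReal_mul (by norm_num)]
          norm_num
        rw [this, one_mul]
    _ ≤ _ := by gcongr

/-- Telescoping the parallelogram identity over dyadic scales. -/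
theorem sum_lintegral_slope_le [FiniteDimensional ℝ V] (ν : Measure V) [ν.IsAddHaarMeasure]
    {a : V → F} (ha : Measurable a) (v : V)
    {s : ℕ → Set V} (hs : ∀ k, MeasurableSet (s k)) (h1 : ∀ k, s (k + 1) ⊆ s k)
    (h2 : ∀ k, ∀ y ∈ s (k + 1), y - ((1 / 2 : ℝ) ^ (k + 2)) • v ∈ s k) (m : ℕ) :
    ∑ k ∈ Finset.range m, ∫⁻ y in (s k ∩ {y | y - ((1 / 2 : ℝ) ^ (k + 2)) • v ∈ s k}) \ s (k + 1),
        ENNReal.ofReal (‖dyadicSlope a v (k + 1) y‖ ^ 2) ∂ν ≤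
    ∫⁻ y in s 0, ENNReal.ofReal (‖dyadicSlope a v 0 y‖ ^ 2) ∂ν +
      ∑ k ∈ Finset.range m, ∫⁻ y in s k, ENNReal.ofReal (‖(1 / 2 : ℝ) •
        (dyadicSlope a v (k + 1) y -
          dyadicSlope a v (k + 1) (y + ((1 / 2 : ℝ) ^ (k + 2)) • v))‖ ^ 2) ∂ν := by
  refine le_trans (le_add_self (b := ∫⁻ y in s m, ENNReal.ofReal (‖dyadicSlope a v m y‖ ^ 2) ∂ν)) ?_
  induction m with
  | zero => simp
  | succ m ih =>
    rw [Finset.sum_range_succ, Finset.sum_range_succ, ← add_assoc]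
    have := lintegral_slope_succ_le ν ha v (hs m) (hs (m + 1)) (h1 m) (h2 m)
    calc _ = ∑ k ∈ Finset.range m, ∫⁻ y in (s k ∩ {y | y - ((1 / 2 : ℝ) ^ (k + 2)) • v ∈ s k}) \
              s (k + 1), ENNReal.ofReal (‖dyadicSlope a v (k + 1) y‖ ^ 2) ∂ν +
            (∫⁻ y in s (m + 1), ENNReal.ofReal (‖dyadicSlope a v (m + 1) y‖ ^ 2) ∂ν +
            ∫⁻ y in (s m ∩ {y | y - ((1 / 2 : ℝ) ^ (m + 2)) • v ∈ s m}) \ s (m + 1),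
              ENNReal.ofReal (‖dyadicSlope a v (m + 1) y‖ ^ 2) ∂ν) := by ring
      _ ≤ _ := by
          refine (add_le_add le_rfl this).trans ?_
          rw [← add_assoc, ← add_assoc]
          refine add_le_add ?_ le_rfl
          rw [add_comm]
          exact ih

end Slope

section Covering

/-- A Vitali covering theorem for families of balls with dyadic radii. -/
theorem exists_disjoint_dyadic_subfamily {ι α : Type*} [NormedAddCommGroup α] [NormedSpace ℝ α]
    [TopologicalSpace.SeparableSpace α]
    (t : Set ι) (x : ι → α) (k : ι → ℕ) {c : ℝ} (hc : 0 < c) :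
    ∃ u ⊆ t, u.PairwiseDisjoint (fun i => closedBall (x i) (c * (1 / 2) ^ k i)) ∧ u.Countable ∧
      ∀ i ∈ t, ∃ j ∈ u, k j ≤ k i ∧ dist (x i) (x j) ≤ 2 * c * (1 / 2) ^ k j := by
  obtain ⟨u, hut, hdisj, hu⟩ := Vitali.exists_disjoint_subfamily_covering_enlargement
    (fun i => closedBall (x i) (c * (1 / 2) ^ k i)) t (fun i => (1 / 2 : ℝ) ^ k i) (3 / 2)
    (by norm_num) (fun i _ => by positivity) 1
    (fun i _ => pow_le_one₀ (by norm_num) (by norm_num))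
    (fun i _ => ⟨x i, mem_closedBall_self (by positivity)⟩)
  refine ⟨u, hut, hdisj, ?_, fun i hi => ?_⟩
  · exact hdisj.countable_of_nonempty_interior fun i _ =>
      ⟨x i, ball_subset_interior_closedBall (mem_ball_self (by positivity))⟩
  · obtain ⟨j, hj, ⟨z, hz1, hz2⟩, hle⟩ := hu i hi
    have hkj : k j ≤ k i := by
      by_contra hcon
      push Not at hcon
      have h1 : (1 / 2 : ℝ) ^ k j ≤ (1 / 2) ^ (k i + 1) :=
        pow_le_pow_of_le_one (by norm_num) (by norm_num) hcon
      rw [pow_succ] at h1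
      have h2 : (0 : ℝ) < (1 / 2) ^ k i := by positivity
      linarith
    refine ⟨j, hj, hkj, ?_⟩
    have h1 : (1 / 2 : ℝ) ^ k i ≤ (1 / 2) ^ k j :=
      pow_le_pow_of_le_one (by norm_num) (by norm_num) hkj
    rw [mem_closedBall] at hz1 hz2
    have h2 := dist_triangle_left (x i) (x j) z
    nlinarith

variable {n : ℕ}

theorem tsum_pow_le_of_disjoint {ι : Type*} {u : Set ι} (hu : u.Countable)
    (x : ι → EuclideanSpace ℝ (Fin n)) (r : ι → ℝ) (hr : ∀ i ∈ u, 0 ≤ r i)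
    (hdisj : u.PairwiseDisjoint fun i => closedBall (x i) (r i))
    {z : EuclideanSpace ℝ (Fin n)} {R : ℝ} (hR : 0 ≤ R)
    (hsub : ∀ i ∈ u, closedBall (x i) (r i) ⊆ closedBall z R) :
    ∑' i : u, ENNReal.ofReal (r i ^ n) ≤ ENNReal.ofReal (R ^ n) := by
  set v := volume (ball (0 : EuclideanSpace ℝ (Fin n)) 1) with hv
  have hv0 : v ≠ 0 := (measure_ball_pos _ _ one_pos).ne'
  have hvt : v ≠ ∞ := measure_ball_lt_top.ne
  have h1 : ∑' i : u, volume (closedBall (x i) (r i)) ≤ volume (closedBall z R) := by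
    rw [← measure_biUnion hu hdisj fun i _ => measurableSet_closedBall]
    exact measure_mono (iUnion₂_subset hsub)
  rw [Measure.addHaar_closedBall _ _ hR, finrank_euclideanSpace_fin, ← hv] at h1
  have h2 : ∀ i : u, volume (closedBall (x i) (r i)) = ENNReal.ofReal (r i ^ n) * v := fun i => by
    rw [Measure.addHaar_closedBall _ _ (hr i i.2), finrank_euclideanSpace_fin]
  simp_rw [h2, ENNReal.tsum_mul_right] at h1
  exact (ENNReal.mul_le_mul_iff_left hv0 hvt).1 h1

end Covering

theorem sum_Ico_half_pow_le (k m : ℕ) :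
    ∑ j ∈ Finset.Ico k m, (1 / 2 : ℝ) ^ j ≤ 2 * (1 / 2) ^ k := by
  rcases le_total k m with h | h
  · have h1 : ∑ j ∈ Finset.Ico k m, (1 / 2 : ℝ) ^ j = 2 * (1 / 2) ^ k - 2 * (1 / 2) ^ m := by
      induction m, h using Nat.le_induction with
      | base => simp
      | succ m hm ih =>
        rw [Finset.sum_Ico_succ_top hm, ih, pow_succ]
        ring
    have : (0 : ℝ) < (1 / 2) ^ m := by positivity
    linarith
  · rw [Finset.Ico_eq_empty_of_le h, Finset.sum_empty]
    positivity

namespace MultiscaleSetup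

variable {N n : ℕ} (S : MultiscaleSetup N n)

/-- The region of the base space lying below the good points of generation `k`. -/
def shadow (k : ℕ) : Set (EuclideanSpace ℝ (Fin n)) :=
  {y | ∃ X ∈ S.good k, dist y (S.P X) < (1 / 2) ^ k}

/-- The flatness coefficient in the base space. -/
def β (j : ℕ) (y : EuclideanSpace ℝ (Fin n)) : ℝ :=
  √((S.e j).real {w | dist (S.P w) y ≤ 33 * (1 / 2) ^ j} / ((1 / 2) ^ j) ^ n)

theorem isOpen_shadow (k : ℕ) : IsOpen (S.shadow k) := by
  have : S.shadow k = ⋃ X ∈ S.good k, ball (S.P X) ((1 / 2) ^ k) := by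
    ext y
    simp [shadow]
  rw [this]
  exact isOpen_biUnion fun _ _ => isOpen_ball

theorem shadow_antitone : Antitone S.shadow := by
  refine antitone_nat_of_succ_le fun k y hy => ?_
  obtain ⟨X, hX, hy⟩ := hy
  refine ⟨X, hX.1, hy.trans_le ?_⟩
  exact pow_le_pow_of_le_one (by norm_num) (by norm_num) k.le_succ

theorem β_nonneg (j : ℕ) (y : EuclideanSpace ℝ (Fin n)) : 0 ≤ S.β j y := Real.sqrt_nonneg _

theorem b_le_β {j : ℕ} {X : EuclideanSpace ℝ (Fin N)} {y : EuclideanSpace ℝ (Fin n)}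
    (h : dist y (S.P X) ≤ (1 / 2) ^ j) : S.b j X ≤ S.β j y := by
  refine Real.sqrt_le_sqrt (div_le_div_of_nonneg_right (measureReal_mono ?_) (by positivity))
  intro w hw
  rw [mem_closedBall] at hw
  have h1 := S.norm_P_le (w - X)
  rw [map_sub, ← dist_eq_norm, ← dist_eq_norm] at h1
  change dist (S.P w) y ≤ _
  linarith [dist_triangle_right (S.P w) y (S.P X)]

theorem exists_measurable_selection (k : ℕ) :
    ∃ α : EuclideanSpace ℝ (Fin n) → EuclideanSpace ℝ (Fin N), Measurable α ∧
      ∀ y ∈ S.shadow k, ∃ X ∈ S.good k, dist y (S.P X) < (1 / 2) ^ k ∧ α y = S.val k X y := by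
  classical
  rcases (S.good k).eq_empty_or_nonempty with he | hne
  · exact ⟨0, measurable_const, fun y ⟨X, hX, _⟩ => by simp [he] at hX⟩
  have hne' : Nonempty (S.good k) := hne.to_subtype
  let x := TopologicalSpace.denseSeq (S.good k)
  have hx : ∀ y ∈ S.shadow k, ∃ i, dist y (S.P (x i)) < (1 / 2) ^ k := by
    rintro y ⟨X, hX, hy⟩
    have ho : IsOpen {X : S.good k | dist y (S.P X) < (1 / 2) ^ k} :=
      isOpen_lt (by fun_prop) continuous_const
    exact (TopologicalSpace.denseRange_denseSeq (S.good k)).exists_mem_open ho ⟨⟨X, hX⟩, hy⟩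
  let p : ℕ → EuclideanSpace ℝ (Fin n) → Prop :=
    fun i y => dist y (S.P (x i)) < (1 / 2) ^ k ∨ y ∉ S.shadow k
  have hp : ∀ y, ∃ i, p i y := fun y => by
    by_cases hy : y ∈ S.shadow k
    · exact (hx y hy).imp fun i hi => Or.inl hi
    · exact ⟨0, Or.inr hy⟩
  have hpm : ∀ i, MeasurableSet {y | p i y} := fun i => by
    have h1 : IsOpen {y | dist y (S.P (x i)) < (1 / 2) ^ k} :=
      isOpen_lt (by fun_prop) continuous_const
    exact h1.measurableSet.union (S.isOpen_shadow k).measurableSet.compl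
  have hf : ∀ i, Measurable fun y => S.val k (x i) y := fun i => by
    unfold val
    exact (continuous_const.add (ContinuousLinearMap.continuous _)).measurable
  refine ⟨_, Measurable.find hf hpm hp, fun y hy => ⟨x (Nat.find (hp y)), (x _).2, ?_, rfl⟩⟩
  exact (Nat.find_spec (hp y)).resolve_right fun h => h hy

/-- A measurable selection of approximating values over the shadow. -/
def sect (k : ℕ) : EuclideanSpace ℝ (Fin n) → EuclideanSpace ℝ (Fin N) :=
  (S.exists_measurable_selection k).choose

open Classical in
/-- The approximating graph built from the scales up to `m`. -/
def graph : ℕ → EuclideanSpace ℝ (Fin n) → EuclideanSpace ℝ (Fin N)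
  | 0 => S.sect 0
  | m + 1 => (S.shadow (m + 1)).piecewise (S.sect (m + 1)) (graph m)

/-- The accumulated flatness coefficients between scales `k` and `m`. -/
def tail (m k : ℕ) (y : EuclideanSpace ℝ (Fin n)) : ℝ :=
  ∑ j ∈ Finset.Ico k (m + 1), (1 / 2) ^ j * S.β j y

/-- The accumulated square flatness coefficients between scales `k` and `m`. -/
def sqTail (m k : ℕ) (y : EuclideanSpace ℝ (Fin n)) : ℝ :=
  ∑ j ∈ Finset.Ico k (m + 1), (1 / 2) ^ j * S.β j y ^ 2

theorem tail_nonneg (m k : ℕ) (y : EuclideanSpace ℝ (Fin n)) : 0 ≤ S.tail m k y :=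
  Finset.sum_nonneg fun j _ => mul_nonneg (by positivity) (S.β_nonneg j y)

theorem sqTail_nonneg (m k : ℕ) (y : EuclideanSpace ℝ (Fin n)) : 0 ≤ S.sqTail m k y :=
  Finset.sum_nonneg fun j _ => by positivity

theorem tail_sq_le (m k : ℕ) (y : EuclideanSpace ℝ (Fin n)) :
    S.tail m k y ^ 2 ≤ 2 * (1 / 2) ^ k * S.sqTail m k y := by
  refine (Finset.sum_sq_le_sum_mul_sum_of_sq_le_mul _ (f := fun j => (1 / 2 : ℝ) ^ j)
    (g := fun j => (1 / 2) ^ j * S.β j y ^ 2) (fun j _ => by positivity) (fun j _ => by positivity)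
    (fun j _ => le_of_eq (by ring))).trans ?_
  exact mul_le_mul_of_nonneg_right (sum_Ico_half_pow_le k (m + 1)) (S.sqTail_nonneg m k y)

theorem measurable_sect (k : ℕ) : Measurable (S.sect k) :=
  (S.exists_measurable_selection k).choose_spec.1

theorem measurable_graph (m : ℕ) : Measurable (S.graph m) := by
  classical
  induction m with
  | zero => exact S.measurable_sect 0
  | succ m ih => exact (S.measurable_sect _).piecewise (S.isOpen_shadow _).measurableSet ih

variable {S}

theorem sect_eq {k : ℕ} {y : EuclideanSpace ℝ (Fin n)} (hy : y ∈ S.shadow k) :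
    ∃ X ∈ S.good k, dist y (S.P X) < (1 / 2) ^ k ∧ S.sect k y = S.val k X y :=
  (S.exists_measurable_selection k).choose_spec.2 y hy

theorem graph_eq {m k : ℕ} (hkm : k ≤ m) {y : EuclideanSpace ℝ (Fin n)} (hy : y ∈ S.shadow k)
    (hy' : k < m → y ∉ S.shadow (k + 1)) : S.graph m y = S.sect k y := by
  classical
  induction m, hkm using Nat.le_induction with
  | base =>
    cases k with
    | zero => rfl
    | succ k => exact piecewise_eq_of_mem _ _ _ hy
  | succ m hm ih =>
    have h1 : y ∉ S.shadow (m + 1) := fun h =>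
      hy' (Nat.lt_succ_of_le hm) (S.shadow_antitone (Nat.succ_le_succ hm) h)
    exact (piecewise_eq_of_notMem _ _ _ h1).trans (ih fun h => hy' (h.trans m.lt_succ_self))

theorem dist_le_of_dist_lt {k : ℕ} {X X' : EuclideanSpace ℝ (Fin N)} {c : ℝ} (hc : 1 / 8 ≤ c)
    (hX : X ∈ S.good k) (hX' : X' ∈ S.good k) (h : ‖S.P X - S.P X'‖ ≤ c * (1 / 2) ^ k) :
    dist X X' ≤ 4 * c * (1 / 2) ^ k := by
  refine (dist_le_max_of_mem_good hX hX').trans (max_le ?_ (by linarith))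
  have : (0 : ℝ) < (1 / 2) ^ k := by positivity
  nlinarith

/-- Two good points of the same or consecutive generations over nearby base points give nearby
values. -/
theorem norm_val_sub_val_le_of_dist {k j : ℕ} {X X' : EuclideanSpace ℝ (Fin N)}
    {y : EuclideanSpace ℝ (Fin n)} (hjk : k = j ∨ k + 1 = j) (hX : X ∈ S.good k)
    (hX' : X' ∈ S.good j) (hy : dist y (S.P X) < (1 / 2) ^ k)
    (hy' : dist y (S.P X') < (1 / 2) ^ j) :
    ‖S.val k X y - S.val j X' y‖ ≤ 2 * S.C₃ * (S.b k X + S.b j X') * (1 / 2) ^ k := by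
  have hle : k ≤ j := by omega
  have hr : (1 / 2 : ℝ) ^ j ≤ (1 / 2) ^ k := pow_le_pow_of_le_one (by norm_num) (by norm_num) hle
  have hd : dist X X' ≤ 4 * 2 * (1 / 2) ^ k := by
    refine dist_le_of_dist_lt (by norm_num) hX (S.good_antitone hle hX') ?_
    rw [← dist_eq_norm]
    linarith [dist_triangle_left (S.P X) (S.P X') y]
  have h0 : (0 : ℝ) < (1 / 2) ^ k := by positivity
  refine (norm_val_sub_val_le hX hX' hjk (by linarith) y).trans ?_
  rw [← dist_eq_norm]
  have h1 : 0 ≤ S.C₃ * (S.b k X + S.b j X') :=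
    mul_nonneg S.C₃_pos.le (add_nonneg (S.b_nonneg _ _) (S.b_nonneg _ _))
  calc _ ≤ S.C₃ * (S.b k X + S.b j X') * ((1 / 2) ^ k + (1 / 2) ^ k) := by gcongr
    _ = _ := by ring

theorem norm_graph_sub_val_add_le {m k : ℕ} (hkm : k ≤ m) {X : EuclideanSpace ℝ (Fin N)}
    {y : EuclideanSpace ℝ (Fin n)} (hX : X ∈ S.good k) (hy : dist y (S.P X) < (1 / 2) ^ k) :
    ‖S.graph m y - S.val k X y‖ + 4 * S.C₃ * ((1 / 2) ^ k * S.β k y) ≤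
      8 * S.C₃ * S.tail m k y := by
  have hC := S.C₃_pos
  induction hkm using Nat.decreasingInduction generalizing X with
  | self =>
    obtain ⟨X', hX', hy', hval⟩ := sect_eq ⟨X, hX, hy⟩
    rw [graph_eq le_rfl ⟨X, hX, hy⟩ fun h => absurd h (lt_irrefl _), hval, tail,
      Nat.Ico_succ_singleton, Finset.sum_singleton]
    have h1 := norm_val_sub_val_le_of_dist (Or.inl rfl) hX' hX hy' hy
    have h2 := S.b_le_β hy.le
    have h3 := S.b_le_β hy'.le
    have h4 : (0 : ℝ) < (1 / 2) ^ m := by positivity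
    have h5 : 2 * S.C₃ * (S.b m X' + S.b m X) * (1 / 2) ^ m ≤
        2 * S.C₃ * (S.β m y + S.β m y) * (1 / 2) ^ m := by gcongr
    linarith
  | of_succ k hk ih =>
    have htail : S.tail m k y = (1 / 2) ^ k * S.β k y + S.tail m (k + 1) y := by
      rw [tail, Finset.sum_eq_sum_Ico_succ_bot (by omega)]
      rfl
    have h4 : (0 : ℝ) < (1 / 2) ^ k := by positivity
    have h2 := S.b_le_β hy.le
    by_cases hy1 : y ∈ S.shadow (k + 1)
    · obtain ⟨X', hX', hy'⟩ := hy1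
      have h1 := norm_val_sub_val_le_of_dist (Or.inr rfl) hX hX' hy hy'
      have h3 := S.b_le_β hy'.le
      have h5 : 2 * S.C₃ * (S.b k X + S.b (k + 1) X') * (1 / 2) ^ k ≤
        2 * S.C₃ * (S.β k y + S.β (k + 1) y) * (1 / 2) ^ k := by gcongr
      have h6 := ih hX' hy'
      have h7 : ‖S.graph m y - S.val k X y‖ ≤ ‖S.graph m y - S.val (k + 1) X' y‖ +
          ‖S.val k X y - S.val (k + 1) X' y‖ := by
        rw [norm_sub_rev (S.val k X y)]
        exact norm_sub_le_norm_sub_add_norm_sub _ _ _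
      have h8 : 0 ≤ S.C₃ * ((1 / 2) ^ k * S.β k y) :=
        mul_nonneg hC.le (mul_nonneg h4.le (S.β_nonneg k y))
      rw [htail]
      rw [pow_succ] at h6
      nlinarith
    · obtain ⟨X', hX', hy', hval⟩ := sect_eq ⟨X, hX, hy⟩
      rw [graph_eq (by omega) ⟨X, hX, hy⟩ fun _ => hy1, hval, htail]
      have h1 := norm_val_sub_val_le_of_dist (Or.inl rfl) hX' hX hy' hy
      have h3 := S.b_le_β hy'.le
      have h5 : 2 * S.C₃ * (S.b k X' + S.b k X) * (1 / 2) ^ k ≤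
          2 * S.C₃ * (S.β k y + S.β k y) * (1 / 2) ^ k := by gcongr
      have h6 : 0 ≤ S.C₃ * S.tail m (k + 1) y := mul_nonneg hC.le (S.tail_nonneg _ _ _)
      linarith

theorem norm_graph_sub_val_le {m k : ℕ} (hkm : k ≤ m) {X : EuclideanSpace ℝ (Fin N)}
    {y : EuclideanSpace ℝ (Fin n)} (hX : X ∈ S.good k) (hy : dist y (S.P X) < (1 / 2) ^ k) :
    ‖S.graph m y - S.val k X y‖ ≤ 8 * S.C₃ * S.tail m k y := by
  have h1 := norm_graph_sub_val_add_le hkm hX hy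
  have h2 : 0 ≤ 4 * S.C₃ * ((1 / 2) ^ k * S.β k y) :=
    mul_nonneg (mul_nonneg (by norm_num) S.C₃_pos.le) (mul_nonneg (by positivity) (S.β_nonneg k y))
  linarith

end MultiscaleSetup

namespace MultiscaleSetup

variable {N n : ℕ} (S : MultiscaleSetup N n)

/-- The points from which the segment in direction `v` of length `2⁻⁽ᵏ⁺¹⁾` meets the shadow of
generation `k + 1`. -/
def active (v : EuclideanSpace ℝ (Fin n)) (k : ℕ) : Set (EuclideanSpace ℝ (Fin n)) :=
  {y | ∃ s ∈ Icc (0 : ℝ) 1, y + (s * (1 / 2) ^ (k + 1)) • v ∈ S.shadow (k + 1)}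

theorem measurableSet_active (v : EuclideanSpace ℝ (Fin n)) (k : ℕ) :
    MeasurableSet (S.active v k) := by
  have h : S.active v k = ⋃ s ∈ Icc (0 : ℝ) 1,
      (fun y => y + (s * (1 / 2) ^ (k + 1)) • v) ⁻¹' S.shadow (k + 1) := by
    ext y
    simp [active]
  rw [h]
  refine IsOpen.measurableSet (isOpen_biUnion fun s _ => (S.isOpen_shadow _).preimage ?_)
  fun_prop

theorem active_succ_subset (v : EuclideanSpace ℝ (Fin n)) (k : ℕ) :
    S.active v (k + 1) ⊆ S.active v k := by
  rintro y ⟨s, hs, hy⟩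
  refine ⟨s / 2, ⟨by linarith [hs.1], by linarith [hs.2]⟩, ?_⟩
  have h : s / 2 * (1 / 2 : ℝ) ^ (k + 1) = s * (1 / 2) ^ (k + 1 + 1) := by ring
  rw [h]
  exact S.shadow_antitone (k + 1).le_succ hy

theorem sub_mem_active {v : EuclideanSpace ℝ (Fin n)} {k : ℕ} {y : EuclideanSpace ℝ (Fin n)}
    (hy : y ∈ S.active v (k + 1)) : y - ((1 / 2 : ℝ) ^ (k + 2)) • v ∈ S.active v k := by
  obtain ⟨s, hs, hy⟩ := hy
  refine ⟨(1 + s) / 2, ⟨by linarith [hs.1], by linarith [hs.2]⟩, ?_⟩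
  have h : y - ((1 / 2 : ℝ) ^ (k + 2)) • v + ((1 + s) / 2 * (1 / 2 : ℝ) ^ (k + 1)) • v =
      y + (s * (1 / 2) ^ (k + 1 + 1)) • v := by
    rw [sub_add, ← sub_smul, sub_eq_add_neg, ← neg_smul]
    congr 2
    ring
  rw [h]
  exact S.shadow_antitone (k + 1).le_succ hy

variable {S}

theorem exists_dist_lt_of_mem_active {v : EuclideanSpace ℝ (Fin n)} (hv : ‖v‖ ≤ 1) {k : ℕ}
    {y : EuclideanSpace ℝ (Fin n)} (hy : y ∈ S.active v k) :
    ∃ X ∈ S.good k, ∀ s ∈ Icc (0 : ℝ) 1,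
      dist (y + (s * (1 / 2) ^ (k + 1)) • v) (S.P X) < (1 / 2) ^ k := by
  obtain ⟨t, ht, X, hX, hXy⟩ := hy
  refine ⟨X, hX.1, fun s hs => ?_⟩
  have h1 : dist (y + (s * (1 / 2) ^ (k + 1)) • v) (y + (t * (1 / 2) ^ (k + 1)) • v) ≤
      (1 / 2) ^ (k + 1) := by
    rw [dist_add_left, dist_eq_norm, ← sub_smul, norm_smul, ← sub_mul, norm_mul,
      Real.norm_of_nonneg (by positivity : (0 : ℝ) ≤ (1 / 2) ^ (k + 1))]
    have h2 : ‖s - t‖ ≤ 1 := by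
      rw [Real.norm_eq_abs, abs_le]
      constructor <;> linarith [hs.1, hs.2, ht.1, ht.2]
    calc ‖s - t‖ * (1 / 2) ^ (k + 1) * ‖v‖ ≤ 1 * (1 / 2) ^ (k + 1) * 1 := by gcongr
      _ = _ := by ring
  have h3 := dist_triangle (y + (s * (1 / 2) ^ (k + 1)) • v) (y + (t * (1 / 2) ^ (k + 1)) • v)
    (S.P X)
  rw [pow_succ] at h1 hXy
  rw [pow_succ] at h3 ⊢
  linarith

theorem sq_norm_slope_sub_le {m k : ℕ} (hkm : k ≤ m) {v : EuclideanSpace ℝ (Fin n)}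
    (hv : ‖v‖ ≤ 1) {y : EuclideanSpace ℝ (Fin n)} (hy : y ∈ S.active v k) :
    ‖(1 / 2 : ℝ) • (dyadicSlope (S.graph m) v (k + 1) y -
      dyadicSlope (S.graph m) v (k + 1) (y + ((1 / 2 : ℝ) ^ (k + 2)) • v))‖ ^ 2 ≤
    2048 * S.C₃ ^ 2 * 2 ^ k * (2 * S.sqTail m k (y + ((1 / 2 : ℝ) ^ (k + 2)) • v) +
      S.sqTail m k y + S.sqTail m k (y + ((1 / 2 : ℝ) ^ (k + 1)) • v)) := by
  obtain ⟨X, hX, hXs⟩ := exists_dist_lt_of_mem_active hv hy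
  have hz0 := hXs 0 (by simp)
  have hz1 := hXs (1 / 2) (by norm_num)
  have hz2 := hXs 1 (by simp)
  have hhalf : (1 / 2 : ℝ) * (1 / 2) ^ (k + 1) = (1 / 2) ^ (k + 2) := by ring
  rw [zero_mul, zero_smul, add_zero] at hz0
  rw [hhalf] at hz1
  rw [one_mul] at hz2
  have hC := S.C₃_pos
  set t : EuclideanSpace ℝ (Fin n) := ((1 / 2 : ℝ) ^ (k + 2)) • v with ht
  have ht2 : y + t + t = y + ((1 / 2 : ℝ) ^ (k + 1)) • v := by
    rw [add_assoc, ← add_smul]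
    congr 2
    ring
  have h0 := norm_graph_sub_val_le hkm hX hz0
  have h1 := norm_graph_sub_val_le hkm hX hz1
  have h2 := norm_graph_sub_val_le hkm hX hz2
  rw [← ht2] at h2 ⊢
  set τ0 := S.tail m k y
  set τ1 := S.tail m k (y + t)
  set τ2 := S.tail m k (y + t + t)
  have hτ0 : 0 ≤ τ0 := S.tail_nonneg _ _ _
  have hτ1 : 0 ≤ τ1 := S.tail_nonneg _ _ _
  have hτ2 : 0 ≤ τ2 := S.tail_nonneg _ _ _
  have heq : (1 / 2 : ℝ) • (dyadicSlope (S.graph m) v (k + 1) y -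
      dyadicSlope (S.graph m) v (k + 1) (y + t)) = ((2 : ℝ) ^ (k + 1)) •
      ((2 : ℝ) • (S.graph m (y + t) - S.val k X (y + t)) - (S.graph m y - S.val k X y) -
        (S.graph m (y + t + t) - S.val k X (y + t + t))) := by
    simp only [dyadicSlope, val, map_add, ← ht, add_assoc k 1 1, one_add_one_eq_two]
    rw [← smul_sub, smul_smul]
    have : (1 / 2 : ℝ) * 2 ^ (k + 2) = 2 ^ (k + 1) := by ring
    rw [this]
    congr 1
    module
  have hnorm : ‖(1 / 2 : ℝ) • (dyadicSlope (S.graph m) v (k + 1) y -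
      dyadicSlope (S.graph m) v (k + 1) (y + t))‖ ≤
      2 ^ (k + 1) * (8 * S.C₃ * (2 * τ1 + τ0 + τ2)) := by
    rw [heq, norm_smul, Real.norm_of_nonneg (by positivity)]
    gcongr
    refine (_root_.norm_sub_le _ _).trans ?_
    refine (add_le_add (_root_.norm_sub_le _ _) le_rfl).trans ?_
    rw [norm_smul, Real.norm_of_nonneg (by norm_num)]
    linarith
  have hs0 := S.tail_sq_le m k y
  have hs1 := S.tail_sq_le m k (y + t)
  have hs2 := S.tail_sq_le m k (y + t + t)
  have hcs : (2 * τ1 + τ0 + τ2) ^ 2 ≤ 4 * (2 * τ1 ^ 2 + τ0 ^ 2 + τ2 ^ 2) := by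
    nlinarith [sq_nonneg (τ1 - τ0), sq_nonneg (τ1 - τ2), sq_nonneg (τ0 - τ2)]
  have h2k : (2 : ℝ) ^ k * (1 / 2) ^ k = 1 := by rw [← mul_pow]; norm_num
  calc _ ≤ (2 ^ (k + 1) * (8 * S.C₃ * (2 * τ1 + τ0 + τ2))) ^ 2 := by gcongr
    _ = 256 * S.C₃ ^ 2 * (2 ^ k) ^ 2 * (2 * τ1 + τ0 + τ2) ^ 2 := by ring
    _ ≤ 256 * S.C₃ ^ 2 * (2 ^ k) ^ 2 * (4 * (2 * τ1 ^ 2 + τ0 ^ 2 + τ2 ^ 2)) := by gcongr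
    _ ≤ 256 * S.C₃ ^ 2 * (2 ^ k) ^ 2 * (4 * (2 * (2 * (1 / 2) ^ k * S.sqTail m k (y + t)) +
          2 * (1 / 2) ^ k * S.sqTail m k y + 2 * (1 / 2) ^ k * S.sqTail m k (y + t + t))) := by
        gcongr
    _ = 2048 * S.C₃ ^ 2 * 2 ^ k * (2 ^ k * (1 / 2) ^ k) * (2 * S.sqTail m k (y + t) +
          S.sqTail m k y + S.sqTail m k (y + t + t)) := by ring
    _ = _ := by rw [h2k, mul_one]

theorem sq_norm_slope_zero_le {m : ℕ} {v : EuclideanSpace ℝ (Fin n)}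
    (hv : ‖v‖ ≤ 1) {y : EuclideanSpace ℝ (Fin n)} (hy : y ∈ S.active v 0) :
    ‖dyadicSlope (S.graph m) v 0 y‖ ^ 2 ≤
    2048 * S.C₃ ^ 2 * (S.sqTail m 0 y + S.sqTail m 0 (y + ((1 / 2 : ℝ) ^ 1) • v)) := by
  obtain ⟨X, hX, hXs⟩ := exists_dist_lt_of_mem_active hv hy
  have hz0 := hXs 0 (by simp)
  have hz2 := hXs 1 (by simp)
  rw [zero_mul, zero_smul, add_zero] at hz0
  rw [one_mul, zero_add] at hz2
  have hC := S.C₃_pos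
  have h0 := norm_graph_sub_val_le (Nat.zero_le m) hX hz0
  have h2 := norm_graph_sub_val_le (Nat.zero_le m) hX hz2
  set t : EuclideanSpace ℝ (Fin n) := ((1 / 2 : ℝ) ^ 1) • v with ht
  have hs0 := S.tail_sq_le m 0 y
  have hs1 := S.tail_sq_le m 0 (y + t)
  set τ0 := S.tail m 0 y
  set τ1 := S.tail m 0 (y + t)
  have hτ0 : 0 ≤ τ0 := S.tail_nonneg _ _ _
  have hτ1 : 0 ≤ τ1 := S.tail_nonneg _ _ _
  have heq : dyadicSlope (S.graph m) v 0 y = (2 : ℝ) •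
      ((S.graph m (y + t) - S.val 0 X (y + t)) - (S.graph m y - S.val 0 X y)) := by
    simp only [dyadicSlope, val_zero, zero_add, ht, pow_one]
    congr 1
    abel
  have hnorm : ‖dyadicSlope (S.graph m) v 0 y‖ ≤ 2 * (8 * S.C₃ * (τ0 + τ1)) := by
    rw [heq, norm_smul, Real.norm_of_nonneg (by norm_num)]
    gcongr
    refine (_root_.norm_sub_le _ _).trans ?_
    linarith
  calc _ ≤ (2 * (8 * S.C₃ * (τ0 + τ1))) ^ 2 := by gcongr
    _ = 256 * S.C₃ ^ 2 * (τ0 + τ1) ^ 2 := by ring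
    _ ≤ 256 * S.C₃ ^ 2 * (2 * (τ0 ^ 2 + τ1 ^ 2)) := by
        gcongr
        nlinarith [sq_nonneg (τ0 - τ1)]
    _ ≤ 256 * S.C₃ ^ 2 * (2 * (2 * (1 / 2) ^ 0 * S.sqTail m 0 y +
          2 * (1 / 2) ^ 0 * S.sqTail m 0 (y + t))) := by gcongr
    _ = 1024 * S.C₃ ^ 2 * (S.sqTail m 0 y + S.sqTail m 0 (y + t)) := by ring
    _ ≤ _ := by
        have := S.sqTail_nonneg m 0 y
        have := S.sqTail_nonneg m 0 (y + t)
        gcongr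
        norm_num

theorem measurable_β (j : ℕ) : Measurable (S.β j) := by
  have hT : MeasurableSet {p : EuclideanSpace ℝ (Fin n) × EuclideanSpace ℝ (Fin N) |
      dist (S.P p.2) p.1 ≤ 33 * (1 / 2) ^ j} :=
    (isClosed_le (by fun_prop) continuous_const).measurableSet
  have := (measurable_measure_prodMk_left (ν := S.e j) hT).ennreal_toReal
  exact (this.div_const _).sqrt

theorem measurable_sqTail (m k : ℕ) : Measurable (S.sqTail m k) :=
  Finset.measurable_sum _ fun j _ => ((measurable_β j).pow_const 2).const_mul _

theorem lintegral_β_sq (j : ℕ) : ∫⁻ y, ENNReal.ofReal (S.β j y ^ 2) =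
    ENNReal.ofReal (33 ^ n) * volume (ball (0 : EuclideanSpace ℝ (Fin n)) 1) * S.e j univ := by
  have hT : MeasurableSet {p : EuclideanSpace ℝ (Fin n) × EuclideanSpace ℝ (Fin N) |
      dist (S.P p.2) p.1 ≤ 33 * (1 / 2) ^ j} :=
    (isClosed_le (by fun_prop) continuous_const).measurableSet
  have h1 := Measure.prod_apply (μ := volume) (ν := S.e j) hT
  rw [Measure.prod_apply_symm hT] at h1
  have h2 : ∀ w : EuclideanSpace ℝ (Fin N), (fun y => (y, w)) ⁻¹'
      {p : EuclideanSpace ℝ (Fin n) × EuclideanSpace ℝ (Fin N) |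
        dist (S.P p.2) p.1 ≤ 33 * (1 / 2) ^ j} = closedBall (S.P w) (33 * (1 / 2) ^ j) := by
    intro w
    ext y
    simp [dist_comm]
  simp_rw [h2] at h1
  simp_rw [Measure.addHaar_closedBall volume _ (by positivity : (0 : ℝ) ≤ 33 * (1 / 2) ^ j),
    finrank_euclideanSpace_fin, lintegral_const] at h1
  have hr : (0 : ℝ) < ((1 / 2) ^ j) ^ n := by positivity
  have h3 : ∀ y, ENNReal.ofReal (S.β j y ^ 2) = S.e j {w | dist (S.P w) y ≤ 33 * (1 / 2) ^ j} *
      ENNReal.ofReal ((((1 / 2) ^ j) ^ n)⁻¹) := by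
    intro y
    rw [β, Real.sq_sqrt (by positivity), div_eq_mul_inv, ENNReal.ofReal_mul (by positivity),
      ofReal_measureReal]
  simp_rw [h3]
  rw [lintegral_mul_const' _ _ ENNReal.ofReal_ne_top]
  have h4 : ∫⁻ y, S.e j {w | dist (S.P w) y ≤ 33 * (1 / 2) ^ j} =
      ENNReal.ofReal ((33 * (1 / 2) ^ j) ^ n) *
        volume (ball (0 : EuclideanSpace ℝ (Fin n)) 1) * S.e j univ := h1.symm
  rw [h4, mul_pow, ENNReal.ofReal_mul (by positivity)]
  have h5 : ENNReal.ofReal (((1 / 2 : ℝ) ^ j) ^ n) * ENNReal.ofReal ((((1 / 2) ^ j) ^ n)⁻¹) = 1 := by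
    rw [← ENNReal.ofReal_mul hr.le, mul_inv_cancel₀ hr.ne', ENNReal.ofReal_one]
  calc _ = ENNReal.ofReal (33 ^ n) * volume (ball (0 : EuclideanSpace ℝ (Fin n)) 1) *
        S.e j univ * (ENNReal.ofReal (((1 / 2 : ℝ) ^ j) ^ n) *
          ENNReal.ofReal ((((1 / 2) ^ j) ^ n)⁻¹)) := by ring
    _ = _ := by rw [h5, mul_one]

theorem sum_sqTail_le (m : ℕ) (y : EuclideanSpace ℝ (Fin n)) :
    ∑ k ∈ Finset.range (m + 1), 2 ^ k * S.sqTail m k y ≤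
      2 * ∑ j ∈ Finset.range (m + 1), S.β j y ^ 2 := by
  simp_rw [sqTail, Finset.mul_sum]
  rw [Finset.sum_comm' (t' := Finset.range (m + 1)) (s' := fun j => Finset.range (j + 1))
    (by simp only [Finset.mem_range, Finset.mem_Ico]; omega)]
  refine Finset.sum_le_sum fun j _ => ?_
  rw [← Finset.sum_mul]
  have h1 : ∑ k ∈ Finset.range (j + 1), (2 : ℝ) ^ k ≤ 2 * 2 ^ j := by
    rw [geom_sum_eq (by norm_num), pow_succ]
    norm_num
    linarith
  have h2k : (2 : ℝ) ^ j * (1 / 2) ^ j = 1 := by rw [← mul_pow]; norm_num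
  calc _ ≤ 2 * 2 ^ j * ((1 / 2) ^ j * S.β j y ^ 2) := by gcongr
    _ = 2 * (2 ^ j * (1 / 2) ^ j) * S.β j y ^ 2 := by ring
    _ = _ := by rw [h2k, mul_one]

theorem lintegral_sum_sqTail_le (m : ℕ) :
    ∑ k ∈ Finset.range (m + 1), ENNReal.ofReal (2 ^ k) * ∫⁻ y, ENNReal.ofReal (S.sqTail m k y) ≤
      2 * (ENNReal.ofReal (33 ^ n) * volume (ball (0 : EuclideanSpace ℝ (Fin n)) 1) *
        ∑' j, S.e j univ) := by
  have h1 : ∑ k ∈ Finset.range (m + 1),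
      ENNReal.ofReal (2 ^ k) * ∫⁻ y, ENNReal.ofReal (S.sqTail m k y) =
      ∫⁻ y, ENNReal.ofReal (∑ k ∈ Finset.range (m + 1), 2 ^ k * S.sqTail m k y) := by
    have h2 : ∀ y, ENNReal.ofReal (∑ k ∈ Finset.range (m + 1), 2 ^ k * S.sqTail m k y) =
        ∑ k ∈ Finset.range (m + 1), ENNReal.ofReal (2 ^ k * S.sqTail m k y) := fun y =>
      ENNReal.ofReal_sum_of_nonneg fun k _ => mul_nonneg (by positivity) (S.sqTail_nonneg m k y)
    simp_rw [h2]
    rw [lintegral_finsetSum _ fun k _ => ((measurable_sqTail m k).const_mul _).ennreal_ofReal]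
    refine Finset.sum_congr rfl fun k _ => ?_
    rw [← lintegral_const_mul _ (measurable_sqTail m k).ennreal_ofReal]
    simp_rw [ENNReal.ofReal_mul (by positivity : (0 : ℝ) ≤ 2 ^ k)]
  rw [h1]
  calc _ ≤ ∫⁻ y, ENNReal.ofReal (2 * ∑ j ∈ Finset.range (m + 1), S.β j y ^ 2) :=
        lintegral_mono fun y => ENNReal.ofReal_le_ofReal (sum_sqTail_le m y)
    _ = 2 * ∑ j ∈ Finset.range (m + 1), ∫⁻ y, ENNReal.ofReal (S.β j y ^ 2) := by
        rw [← lintegral_finsetSum _ fun j _ => ((measurable_β j).pow_const 2).ennreal_ofReal,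
          ← lintegral_const_mul _ (Finset.measurable_sum _
            fun j _ => ((measurable_β j).pow_const 2).ennreal_ofReal)]
        refine lintegral_congr fun y => ?_
        rw [ENNReal.ofReal_mul (by norm_num), ENNReal.ofReal_sum_of_nonneg fun _ _ => sq_nonneg _,
          ENNReal.ofReal_ofNat]
    _ ≤ _ := by
        simp_rw [lintegral_β_sq, ← Finset.mul_sum]
        gcongr
        exact ENNReal.sum_le_tsum _

end MultiscaleSetup

namespace MultiscaleSetup

variable {N n : ℕ} {S : MultiscaleSetup N n}

theorem lintegral_slope_sub_le {m k : ℕ} (hkm : k ≤ m) {v : EuclideanSpace ℝ (Fin n)}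
    (hv : ‖v‖ ≤ 1) :
    ∫⁻ y in S.active v k, ENNReal.ofReal (‖(1 / 2 : ℝ) • (dyadicSlope (S.graph m) v (k + 1) y -
      dyadicSlope (S.graph m) v (k + 1) (y + ((1 / 2 : ℝ) ^ (k + 2)) • v))‖ ^ 2) ≤
    ENNReal.ofReal (8192 * S.C₃ ^ 2) *
      (ENNReal.ofReal (2 ^ k) * ∫⁻ y, ENNReal.ofReal (S.sqTail m k y)) := by
  set g : EuclideanSpace ℝ (Fin n) → ℝ≥0∞ := fun y => ENNReal.ofReal (S.sqTail m k y) with hg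
  have hgm : Measurable g := (measurable_sqTail m k).ennreal_ofReal
  have hgt : ∀ t, Measurable fun y => g (y + t) := fun t =>
    hgm.comp (continuous_id.add continuous_const).measurable
  calc _ ≤ ∫⁻ y in S.active v k, ENNReal.ofReal (2048 * S.C₃ ^ 2 * 2 ^ k) *
        (2 * g (y + ((1 / 2 : ℝ) ^ (k + 2)) • v) + g y + g (y + ((1 / 2 : ℝ) ^ (k + 1)) • v)) := by
        refine setLIntegral_mono' (S.measurableSet_active v k) fun y hy => ?_
        refine (ENNReal.ofReal_le_ofReal (sq_norm_slope_sub_le hkm hv hy)).trans (le_of_eq ?_)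
        have h0 := S.sqTail_nonneg m k y
        have h1 := S.sqTail_nonneg m k (y + ((1 / 2 : ℝ) ^ (k + 1)) • v)
        have h2 := S.sqTail_nonneg m k (y + ((1 / 2 : ℝ) ^ (k + 2)) • v)
        rw [ENNReal.ofReal_mul (p := 2048 * S.C₃ ^ 2 * 2 ^ k) (by positivity),
          ENNReal.ofReal_add (by positivity) h1,
          ENNReal.ofReal_add (by positivity) h0, ENNReal.ofReal_mul (p := 2) (by norm_num),
          ENNReal.ofReal_ofNat]
    _ ≤ ∫⁻ y, ENNReal.ofReal (2048 * S.C₃ ^ 2 * 2 ^ k) *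
        (2 * g (y + ((1 / 2 : ℝ) ^ (k + 2)) • v) + g y + g (y + ((1 / 2 : ℝ) ^ (k + 1)) • v)) :=
        setLIntegral_le_lintegral _ _
    _ = ENNReal.ofReal (2048 * S.C₃ ^ 2 * 2 ^ k) *
        (2 * (∫⁻ y, g y) + (∫⁻ y, g y) + ∫⁻ y, g y) := by
        rw [lintegral_const_mul' _ _ ENNReal.ofReal_ne_top, lintegral_add_right _ (hgt _),
          lintegral_add_right _ hgm, lintegral_const_mul' _ _ (by simp),
          lintegral_add_right_eq_self, lintegral_add_right_eq_self]
    _ = _ := by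
        have h1 : ENNReal.ofReal (2048 * S.C₃ ^ 2 * 2 ^ k) * 4 =
            ENNReal.ofReal (8192 * S.C₃ ^ 2) * ENNReal.ofReal (2 ^ k) := by
          rw [← ENNReal.ofReal_ofNat 4, ← ENNReal.ofReal_mul (by positivity),
            ← ENNReal.ofReal_mul (by positivity)]
          congr 1
          ring
        rw [← mul_assoc, ← h1]
        ring

theorem lintegral_slope_zero_le (m : ℕ) {v : EuclideanSpace ℝ (Fin n)} (hv : ‖v‖ ≤ 1) :
    ∫⁻ y in S.active v 0, ENNReal.ofReal (‖dyadicSlope (S.graph m) v 0 y‖ ^ 2) ≤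
    ENNReal.ofReal (8192 * S.C₃ ^ 2) * ∫⁻ y, ENNReal.ofReal (S.sqTail m 0 y) := by
  set g : EuclideanSpace ℝ (Fin n) → ℝ≥0∞ := fun y => ENNReal.ofReal (S.sqTail m 0 y) with hg
  have hgm : Measurable g := (measurable_sqTail m 0).ennreal_ofReal
  calc _ ≤ ∫⁻ y in S.active v 0, ENNReal.ofReal (2048 * S.C₃ ^ 2) *
        (g y + g (y + ((1 / 2 : ℝ) ^ 1) • v)) := by
        refine setLIntegral_mono' (S.measurableSet_active v 0) fun y hy => ?_
        refine (ENNReal.ofReal_le_ofReal (sq_norm_slope_zero_le hv hy)).trans (le_of_eq ?_)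
        rw [ENNReal.ofReal_mul (by positivity),
          ENNReal.ofReal_add (S.sqTail_nonneg _ _ _) (S.sqTail_nonneg _ _ _)]
    _ ≤ ∫⁻ y, ENNReal.ofReal (2048 * S.C₃ ^ 2) * (g y + g (y + ((1 / 2 : ℝ) ^ 1) • v)) :=
        setLIntegral_le_lintegral _ _
    _ = ENNReal.ofReal (2048 * S.C₃ ^ 2) * ((∫⁻ y, g y) + ∫⁻ y, g y) := by
        rw [lintegral_const_mul' _ _ ENNReal.ofReal_ne_top, lintegral_add_left hgm,
          lintegral_add_right_eq_self]
    _ = ENNReal.ofReal (4096 * S.C₃ ^ 2) * ∫⁻ y, g y := by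
        have h1 : ENNReal.ofReal (4096 * S.C₃ ^ 2) = ENNReal.ofReal (2048 * S.C₃ ^ 2) * 2 := by
          rw [← ENNReal.ofReal_ofNat 2, ← ENNReal.ofReal_mul (by positivity)]
          congr 1
          ring
        rw [← two_mul, ← mul_assoc, h1]
    _ ≤ _ := by
        gcongr
        norm_num

/-- The square-mean slope created at the stopping scales is controlled by the flatness energy. -/
theorem sum_lintegral_stopped_slope_le (m : ℕ) {v : EuclideanSpace ℝ (Fin n)} (hv : ‖v‖ ≤ 1) :
    ∑ k ∈ Finset.range m, ∫⁻ y in (S.active v k ∩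
      {y | y - ((1 / 2 : ℝ) ^ (k + 2)) • v ∈ S.active v k}) \ S.active v (k + 1),
        ENNReal.ofReal (‖dyadicSlope (S.graph m) v (k + 1) y‖ ^ 2) ≤
    ENNReal.ofReal (32768 * S.C₃ ^ 2 * 33 ^ n) *
      volume (ball (0 : EuclideanSpace ℝ (Fin n)) 1) * ∑' j, S.e j univ := by
  refine (sum_lintegral_slope_le volume (S.measurable_graph m) v (S.measurableSet_active v)
    (S.active_succ_subset v) (fun k y hy => S.sub_mem_active hy) m).trans ?_
  set I := ∑ k ∈ Finset.range (m + 1), ENNReal.ofReal (2 ^ k) *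
    ∫⁻ y, ENNReal.ofReal (S.sqTail m k y) with hI
  have h1 : ∫⁻ y in S.active v 0, ENNReal.ofReal (‖dyadicSlope (S.graph m) v 0 y‖ ^ 2) ≤
      ENNReal.ofReal (8192 * S.C₃ ^ 2) * I := by
    refine (lintegral_slope_zero_le m hv).trans (mul_le_mul_right ?_ _)
    refine le_trans (le_of_eq ?_) (Finset.single_le_sum
      (f := fun k => ENNReal.ofReal (2 ^ k) * ∫⁻ y, ENNReal.ofReal (S.sqTail m k y))
      (fun _ _ => zero_le) (Finset.mem_range.2 m.succ_pos))
    simp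
  have h2 : ∑ k ∈ Finset.range m, ∫⁻ y in S.active v k, ENNReal.ofReal (‖(1 / 2 : ℝ) •
      (dyadicSlope (S.graph m) v (k + 1) y -
      dyadicSlope (S.graph m) v (k + 1) (y + ((1 / 2 : ℝ) ^ (k + 2)) • v))‖ ^ 2) ≤
      ENNReal.ofReal (8192 * S.C₃ ^ 2) * I := by
    refine (Finset.sum_le_sum fun k hk =>
      lintegral_slope_sub_le (Finset.mem_range.1 hk).le hv).trans ?_
    rw [← Finset.mul_sum]
    gcongr
    exact Finset.sum_le_sum_of_subset (Finset.range_mono m.le_succ)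
  refine (add_le_add h1 h2).trans ?_
  have h3 := lintegral_sum_sqTail_le (S := S) m
  rw [← hI] at h3
  calc _ ≤ ENNReal.ofReal (8192 * S.C₃ ^ 2) * (2 * (ENNReal.ofReal (33 ^ n) *
        volume (ball (0 : EuclideanSpace ℝ (Fin n)) 1) * ∑' j, S.e j univ)) +
        ENNReal.ofReal (8192 * S.C₃ ^ 2) * (2 * (ENNReal.ofReal (33 ^ n) *
        volume (ball (0 : EuclideanSpace ℝ (Fin n)) 1) * ∑' j, S.e j univ)) := by gcongr
    _ = ENNReal.ofReal (8192 * S.C₃ ^ 2) * 4 * ENNReal.ofReal (33 ^ n) *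
        volume (ball (0 : EuclideanSpace ℝ (Fin n)) 1) * ∑' j, S.e j univ := by ring
    _ = _ := by
        rw [← ENNReal.ofReal_ofNat 4, ← ENNReal.ofReal_mul (by positivity),
          ← ENNReal.ofReal_mul (by positivity)]
        congr 3
        ring

theorem notMem_active_of_steep {k : ℕ} {Y : EuclideanSpace ℝ (Fin N)} (hY : Y ∈ S.good k)
    (hs : 1 / 2 ≤ ‖(S.aff k Y).2‖) {v y : EuclideanSpace ℝ (Fin n)} (hv : ‖v‖ ≤ 1)
    (hy : y ∈ ball (S.P Y) (1 / 2 * (1 / 2) ^ k)) : y ∉ S.active v k := by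
  rintro ⟨s, ⟨hs0, hs1⟩, X, hX, hXy⟩
  refine (hX.2.2.1 Y hY ?_).not_ge hs
  rw [mem_ball] at hy
  rw [← dist_eq_norm]
  have h1 : dist (y + (s * (1 / 2) ^ (k + 1)) • v) y ≤ 1 / 2 * (1 / 2) ^ k := by
    rw [dist_self_add_left, norm_smul, Real.norm_of_nonneg (by positivity)]
    calc s * (1 / 2) ^ (k + 1) * ‖v‖ ≤ 1 * (1 / 2) ^ (k + 1) * 1 := by gcongr
      _ = _ := by ring
  have hp : (1 / 2 : ℝ) ^ (k + 1) = (1 / 2) ^ k * (1 / 2) := pow_succ _ _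
  have h2 := dist_triangle_left (S.P X) (S.P Y) (y + (s * (1 / 2) ^ (k + 1)) • v)
  have h3 := dist_triangle (y + (s * (1 / 2) ^ (k + 1)) • v) y (S.P Y)
  have h4 : (0 : ℝ) < (1 / 2) ^ k := by positivity
  linarith

theorem mem_stopped_of_steep {k : ℕ} {Y : EuclideanSpace ℝ (Fin N)} (hY : Y ∈ S.good (k + 1))
    (hs : 1 / 2 ≤ ‖(S.aff (k + 1) Y).2‖) {v y : EuclideanSpace ℝ (Fin n)} (hv : ‖v‖ ≤ 1)
    (hy : y ∈ ball (S.P Y) (1 / 2 * (1 / 2) ^ (k + 1))) :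
    y ∈ (S.active v k ∩ {y | y - ((1 / 2 : ℝ) ^ (k + 2)) • v ∈ S.active v k}) \
      S.active v (k + 1) := by
  have h0 : (0 : ℝ) < (1 / 2) ^ (k + 1) := by positivity
  have hsh : y ∈ S.shadow (k + 1) := ⟨Y, hY, by rw [mem_ball] at hy; linarith⟩
  refine ⟨⟨⟨0, by simp, by simpa using hsh⟩, ⟨1 / 2, by norm_num, ?_⟩⟩,
    notMem_active_of_steep hY hs hv hy⟩
  have h : y - ((1 / 2 : ℝ) ^ (k + 2)) • v + (1 / 2 * (1 / 2 : ℝ) ^ (k + 1)) • v = y := by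
    have : (1 / 2 * (1 / 2 : ℝ) ^ (k + 1)) = (1 / 2) ^ (k + 2) := by ring
    rw [this, sub_add_cancel]
  rwa [h]

theorem norm_graph_sub_val_le_of_notMem {m k : ℕ} (hkm : k ≤ m) {Y : EuclideanSpace ℝ (Fin N)}
    (hY : Y ∈ S.good k) {y : EuclideanSpace ℝ (Fin n)} (hy : dist y (S.P Y) < (1 / 2) ^ k)
    (hy' : y ∉ S.shadow (k + 1)) :
    ‖S.graph m y - S.val k Y y‖ ≤ 4 * S.C₃ * S.ε * (1 / 2) ^ k := by
  obtain ⟨X, hX, hXy, hval⟩ := sect_eq ⟨Y, hY, hy⟩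
  rw [graph_eq hkm ⟨Y, hY, hy⟩ fun _ => hy', hval]
  refine (norm_val_sub_val_le_of_dist (Or.inl rfl) hX hY hXy hy).trans ?_
  have h1 := b_le_of_mem_good hX k
  have h2 := b_le_of_mem_good hY k
  have h3 := S.C₃_pos
  calc _ ≤ 2 * S.C₃ * (S.ε + S.ε) * (1 / 2) ^ k := by gcongr
    _ = _ := by ring

theorem norm_slope_sub_le_of_steep {m k : ℕ} (hkm : k ≤ m) {Y : EuclideanSpace ℝ (Fin N)}
    (hY : Y ∈ S.good k) (hs : 1 / 2 ≤ ‖(S.aff k Y).2‖) {v y : EuclideanSpace ℝ (Fin n)}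
    (hv : ‖v‖ ≤ 1) (hy : y ∈ ball (S.P Y) (1 / 2 * (1 / 2) ^ k)) :
    ‖dyadicSlope (S.graph m) v k y - (S.aff k Y).2 v‖ ≤ 16 * S.C₃ * S.ε := by
  have h0 : (0 : ℝ) < (1 / 2) ^ k := by positivity
  have hna := notMem_active_of_steep hY hs hv hy
  set t := ((1 / 2 : ℝ) ^ (k + 1)) • v with ht
  have h1 : y ∉ S.shadow (k + 1) := fun h => hna ⟨0, by simp, by simpa using h⟩
  have h2 : y + t ∉ S.shadow (k + 1) := fun h => hna ⟨1, by simp, by rw [one_mul]; exact h⟩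
  rw [mem_ball] at hy
  have hyt : dist (y + t) (S.P Y) < (1 / 2) ^ k := by
    have h3 : dist (y + t) y ≤ 1 / 2 * (1 / 2) ^ k := by
      rw [dist_self_add_left, norm_smul, Real.norm_of_nonneg (by positivity)]
      calc (1 / 2) ^ (k + 1) * ‖v‖ ≤ (1 / 2) ^ (k + 1) * 1 := by gcongr
        _ = _ := by ring
    linarith [dist_triangle (y + t) y (S.P Y)]
  have h3 := norm_graph_sub_val_le_of_notMem hkm hY (by linarith : dist y (S.P Y) < (1 / 2) ^ k) h1
  have h4 := norm_graph_sub_val_le_of_notMem hkm hY hyt h2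
  have h2k : (2 : ℝ) ^ (k + 1) * (1 / 2) ^ (k + 1) = 1 := by rw [← mul_pow]; norm_num
  have heq : dyadicSlope (S.graph m) v k y - (S.aff k Y).2 v = ((2 : ℝ) ^ (k + 1)) •
      ((S.graph m (y + t) - S.val k Y (y + t)) - (S.graph m y - S.val k Y y)) := by
    have h5 : (S.aff k Y).2 v = ((2 : ℝ) ^ (k + 1)) • (S.aff k Y).2 t := by
      rw [ht, map_smul, smul_smul, h2k, one_smul]
    rw [h5, dyadicSlope, ← smul_sub]
    congr 1
    simp only [val, map_add]
    abel
  rw [heq, norm_smul, Real.norm_of_nonneg (by positivity)]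
  calc _ ≤ 2 ^ (k + 1) * (4 * S.C₃ * S.ε * (1 / 2) ^ k + 4 * S.C₃ * S.ε * (1 / 2) ^ k) := by
        gcongr
        exact (_root_.norm_sub_le _ _).trans (add_le_add h4 h3)
    _ = 16 * S.C₃ * S.ε * (2 ^ (k + 1) * (1 / 2) ^ (k + 1)) := by ring
    _ = _ := by rw [h2k, mul_one]

theorem norm_le_sum_norm_apply_single {F : Type*} [NormedAddCommGroup F] [NormedSpace ℝ F]
    (Λ : EuclideanSpace ℝ (Fin n) →L[ℝ] F) :
    ‖Λ‖ ≤ ∑ i, ‖Λ (EuclideanSpace.single i 1)‖ := by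
  refine ContinuousLinearMap.opNorm_le_bound _ (by positivity) fun v => ?_
  have h1 : v = ∑ i, v i • EuclideanSpace.single i (1 : ℝ) := by
    have := (EuclideanSpace.basisFun (Fin n) ℝ).sum_repr v
    simpa using this.symm
  conv_lhs => rw [h1]
  rw [map_sum, Finset.sum_mul]
  refine (norm_sum_le _ _).trans (Finset.sum_le_sum fun i _ => ?_)
  rw [map_smul, norm_smul, mul_comm]
  gcongr
  exact PiLp.norm_apply_le v i

theorem le_sum_sq_slope_of_steep {m k : ℕ} (hkm : k ≤ m) {Y : EuclideanSpace ℝ (Fin N)}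
    (hY : Y ∈ S.good k) (hs : 1 / 2 ≤ ‖(S.aff k Y).2‖) {y : EuclideanSpace ℝ (Fin n)}
    (hy : y ∈ ball (S.P Y) (1 / 2 * (1 / 2) ^ k)) :
    1 / (16 * (n + 1) ^ 2) ≤
      ∑ i, ‖dyadicSlope (S.graph m) (EuclideanSpace.single i (1 : ℝ)) k y‖ ^ 2 := by
  have hn : (0 : ℝ) < n + 1 := by positivity
  obtain ⟨i, hi⟩ : ∃ i : Fin n,
      1 / (2 * (n + 1)) ≤ ‖(S.aff k Y).2 (EuclideanSpace.single i (1 : ℝ))‖ := by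
    by_contra! hcon
    have h1 : ∑ i, ‖(S.aff k Y).2 (EuclideanSpace.single i (1 : ℝ))‖ ≤
        ∑ _i : Fin n, (1 / (2 * (n + 1)) : ℝ) := Finset.sum_le_sum fun i _ => (hcon i).le
    rw [Finset.sum_const, Finset.card_univ, Fintype.card_fin, nsmul_eq_mul] at h1
    have h2 := norm_le_sum_norm_apply_single (S.aff k Y).2
    have h3 : (n : ℝ) * (1 / (2 * (n + 1))) < 1 / 2 := by
      rw [mul_one_div, div_lt_div_iff₀ (by positivity) (by norm_num)]
      linarith
    linarith
  have h1 := norm_slope_sub_le_of_steep hkm hY hs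
    (v := EuclideanSpace.single i (1 : ℝ)) (by simp) hy
  have h2 := S.C₃_mul_ε_le
  have h3 : 16 * S.C₃ * S.ε ≤ 1 / (4 * (n + 1)) := by
    rw [le_div_iff₀ (by positivity)]
    have : 0 < S.C₃ * S.ε := mul_pos S.C₃_pos S.ε_pos
    nlinarith
  have h4 : 1 / (4 * (n + 1)) ≤
      ‖dyadicSlope (S.graph m) (EuclideanSpace.single i (1 : ℝ)) k y‖ := by
    have h5 := norm_sub_norm_le ((S.aff k Y).2 (EuclideanSpace.single i (1 : ℝ)))
      (dyadicSlope (S.graph m) (EuclideanSpace.single i (1 : ℝ)) k y)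
    rw [norm_sub_rev] at h5
    have h6 : (1 : ℝ) / (2 * (n + 1)) = 1 / (4 * (n + 1)) + 1 / (4 * (n + 1)) := by
      field_simp
      norm_num
    linarith
  calc (1 : ℝ) / (16 * (n + 1) ^ 2) = (1 / (4 * (n + 1))) ^ 2 := by
        field_simp
        norm_num
    _ ≤ ‖dyadicSlope (S.graph m) (EuclideanSpace.single i (1 : ℝ)) k y‖ ^ 2 := by gcongr
    _ ≤ _ := Finset.single_le_sum
        (f := fun i => ‖dyadicSlope (S.graph m) (EuclideanSpace.single i (1 : ℝ)) k y‖ ^ 2)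
        (fun _ _ => sq_nonneg _) (Finset.mem_univ i)

end MultiscaleSetup

namespace MultiscaleSetup

variable {N n : ℕ} {S : MultiscaleSetup N n}

/-- The constant in the packing estimate for steep approximations. -/
def steepConst (S : MultiscaleSetup N n) : ℝ :=
  2 ^ n * (16 * (n + 1) ^ 2) * (n * (32768 * S.C₃ ^ 2 * 33 ^ n))

theorem sum_pow_le_of_steep {ι : Type*} (F : Finset ι) (Y : ι → EuclideanSpace ℝ (Fin N))
    (k : ι → ℕ) (hY : ∀ i ∈ F, Y i ∈ S.good (k i)) (hs : ∀ i ∈ F, 1 / 2 ≤ ‖(S.aff (k i) (Y i)).2‖)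
    (hd : (F : Set ι).PairwiseDisjoint fun i => closedBall (S.P (Y i)) (1 / 2 * (1 / 2) ^ k i)) :
    ∑ i ∈ F, ENNReal.ofReal (((1 / 2) ^ k i) ^ n) ≤
      ENNReal.ofReal S.steepConst * ∑' j, S.e j univ := by
  classical
  set m := F.sup k with hm
  have hkm : ∀ i ∈ F, k i ≤ m := fun i hi => Finset.le_sup hi
  set B : ι → Set (EuclideanSpace ℝ (Fin n)) :=
    fun i => ball (S.P (Y i)) (1 / 2 * (1 / 2) ^ k i) with hB
  set v : ℝ≥0∞ := volume (ball (0 : EuclideanSpace ℝ (Fin n)) 1) with hv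
  have hv0 : v ≠ 0 := (measure_ball_pos _ _ one_pos).ne'
  have hvt : v ≠ ⊤ := measure_ball_lt_top.ne
  set T : Fin n → ℕ → Set (EuclideanSpace ℝ (Fin n)) := fun d j =>
    (S.active (EuclideanSpace.single d 1) j ∩ {y | y - ((1 / 2 : ℝ) ^ (j + 2)) •
      (EuclideanSpace.single d (1 : ℝ)) ∈ S.active (EuclideanSpace.single d 1) j}) \
      S.active (EuclideanSpace.single d 1) (j + 1) with hT
  have hTm : ∀ d j, MeasurableSet (T d j) := fun d j =>
    ((S.measurableSet_active _ _).inter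
      ((continuous_id.sub continuous_const).measurable (S.measurableSet_active _ _))).diff
      (S.measurableSet_active _ _)
  set s : Fin n → ℕ → EuclideanSpace ℝ (Fin n) → ℝ≥0∞ := fun d j y =>
    ENNReal.ofReal (‖dyadicSlope (S.graph m) (EuclideanSpace.single d (1 : ℝ)) (j + 1) y‖ ^ 2)
    with hsdef
  set G : EuclideanSpace ℝ (Fin n) → ℝ≥0∞ := fun y =>
    ∑ d, ∑ j ∈ Finset.range m, (T d j).indicator (s d j) y with hG
  have hsm : ∀ d j, Measurable (s d j) := fun d j =>
    ((measurable_dyadicSlope (S.measurable_graph m) _ _).norm.pow_const 2).ennreal_ofReal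
  have hle : ∀ i ∈ F, ∀ y ∈ B i, ENNReal.ofReal (1 / (16 * (n + 1) ^ 2)) ≤ G y := by
    intro i hi y hy
    obtain ⟨j, hj⟩ : ∃ j, k i = j + 1 := by
      refine Nat.exists_eq_succ_of_ne_zero fun h0 => ?_
      have := hs i hi
      rw [h0, aff_zero] at this
      simp at this
      norm_num at this
    have h1 := le_sum_sq_slope_of_steep (hkm i hi) (hY i hi) (hs i hi) hy
    refine (ENNReal.ofReal_le_ofReal h1).trans ?_
    rw [ENNReal.ofReal_sum_of_nonneg fun _ _ => sq_nonneg _]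
    refine Finset.sum_le_sum fun d _ => ?_
    refine le_trans ?_ (Finset.single_le_sum (f := fun j => (T d j).indicator (s d j) y)
      (fun _ _ => zero_le) (Finset.mem_range.2 (show j < m by have := hkm i hi; omega)))
    have h2 : y ∈ T d j := by
      have h3 := hY i hi
      have h4 := hs i hi
      have h5 : y ∈ ball (S.P (Y i)) (1 / 2 * (1 / 2) ^ k i) := hy
      rw [hj] at h3 h4 h5
      exact mem_stopped_of_steep h3 h4 (by simp) h5
    rw [indicator_of_mem h2, hj]
  have hGint : ∫⁻ y, G y ≤ n * (ENNReal.ofReal (32768 * S.C₃ ^ 2 * 33 ^ n) * v *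
      ∑' j, S.e j univ) := by
    rw [hG, lintegral_finsetSum _ fun d _ => Finset.measurable_sum _ fun j _ =>
      (hsm d j).indicator (hTm d j)]
    calc _ ≤ ∑ _d : Fin n, (ENNReal.ofReal (32768 * S.C₃ ^ 2 * 33 ^ n) * v *
          ∑' j, S.e j univ) := by
          refine Finset.sum_le_sum fun d _ => ?_
          rw [lintegral_finsetSum _ fun j _ => (hsm d j).indicator (hTm d j)]
          simp_rw [lintegral_indicator (hTm d _)]
          exact sum_lintegral_stopped_slope_le m (by simp)
      _ = _ := by simp
  have hvol : ∀ i, volume (B i) = ENNReal.ofReal ((1 / 2) ^ n) *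
      ENNReal.ofReal (((1 / 2) ^ k i) ^ n) * v := by
    intro i
    rw [hB, Measure.addHaar_ball_of_pos _ _ (by positivity), finrank_euclideanSpace_fin, mul_pow,
      ENNReal.ofReal_mul (by positivity)]
  have hsum : ENNReal.ofReal (1 / (16 * (n + 1) ^ 2)) * ∑ i ∈ F, volume (B i) ≤ ∫⁻ y, G y := by
    rw [Finset.mul_sum]
    calc _ ≤ ∑ i ∈ F, ∫⁻ y in B i, G y := by
          refine Finset.sum_le_sum fun i hi => ?_
          rw [← setLIntegral_const]
          exact setLIntegral_mono' measurableSet_ball (hle i hi)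
      _ = ∫⁻ y in ⋃ i ∈ F, B i, G y := by
          rw [lintegral_biUnion_finset _ fun i _ => measurableSet_ball]
          exact fun i hi j hj hij => (hd hi hj hij).mono ball_subset_closedBall
            ball_subset_closedBall
      _ ≤ _ := setLIntegral_le_lintegral _ _
  have hmain := hsum.trans hGint
  simp_rw [hvol] at hmain
  rw [← Finset.sum_mul, ← Finset.mul_sum] at hmain
  set A := ∑ i ∈ F, ENNReal.ofReal (((1 / 2) ^ k i) ^ n) with hA
  have h1 : ENNReal.ofReal (1 / (16 * (n + 1) ^ 2)) * ENNReal.ofReal ((1 / 2) ^ n) * A ≤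
      n * ENNReal.ofReal (32768 * S.C₃ ^ 2 * 33 ^ n) * ∑' j, S.e j univ := by
    refine (ENNReal.mul_le_mul_iff_left hv0 hvt).1 ?_
    refine le_trans (le_of_eq ?_) (hmain.trans (le_of_eq ?_)) <;> ring
  have h2 : A = ENNReal.ofReal (2 ^ n * (16 * (n + 1) ^ 2)) *
      (ENNReal.ofReal (1 / (16 * (n + 1) ^ 2)) * ENNReal.ofReal ((1 / 2) ^ n) * A) := by
    rw [← mul_assoc, ← ENNReal.ofReal_mul (by positivity), ← ENNReal.ofReal_mul (by positivity)]
    have h3 : (2 : ℝ) ^ n * (16 * (n + 1) ^ 2) * (1 / (16 * (n + 1) ^ 2) * (1 / 2) ^ n) = 1 := by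
      have h4 : (2 : ℝ) ^ n * (1 / 2) ^ n = 1 := by rw [← mul_pow]; norm_num
      have h5 : (16 * (n + 1) ^ 2 : ℝ) * (1 / (16 * (n + 1) ^ 2)) = 1 :=
        mul_one_div_cancel (by positivity)
      linear_combination h4 + h5 * (2 ^ n * (1 / 2) ^ n)
    rw [h3, ENNReal.ofReal_one, one_mul]
  rw [h2, steepConst, ENNReal.ofReal_mul (p := 2 ^ n * (16 * (n + 1) ^ 2)) (by positivity),
    mul_assoc (ENNReal.ofReal (2 ^ n * (16 * (n + 1) ^ 2)))]
  refine mul_le_mul_right (h1.trans (le_of_eq ?_)) _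
  rw [ENNReal.ofReal_mul (p := (n : ℝ)) (by positivity), ENNReal.ofReal_natCast]

theorem tsum_pow_le_of_steep {ι : Type*} (u : Set ι) (Y : ι → EuclideanSpace ℝ (Fin N))
    (k : ι → ℕ) (hY : ∀ i ∈ u, Y i ∈ S.good (k i)) (hs : ∀ i ∈ u, 1 / 2 ≤ ‖(S.aff (k i) (Y i)).2‖)
    (hd : u.PairwiseDisjoint fun i => closedBall (S.P (Y i)) (1 / 2 * (1 / 2) ^ k i)) :
    ∑' i : u, ENNReal.ofReal (((1 / 2) ^ k i) ^ n) ≤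
      ENNReal.ofReal S.steepConst * ∑' j, S.e j univ := by
  rw [ENNReal.tsum_eq_iSup_sum]
  refine iSup_le fun F => ?_
  refine sum_pow_le_of_steep F (fun i => Y i) (fun i => k i) (fun i _ => hY i i.2)
    (fun i _ => hs i i.2) fun i _ j _ hij => ?_
  exact hd i.2 j.2 (Subtype.coe_injective.ne hij)

end MultiscaleSetup

namespace MultiscaleSetup

variable {N n : ℕ} {S : MultiscaleSetup N n}

theorem measure_lowDensity_le :
    S.μ {X | ∃ k, X ∈ S.good k ∧ ¬S.Dens X (k + 1)} ≤ ENNReal.ofReal (S.δ * 16 ^ n) := by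
  have hδ := S.δ_pos
  obtain ⟨u, hut, hd, huc, hcov⟩ := exists_disjoint_dyadic_subfamily
    {i : EuclideanSpace ℝ (Fin N) × ℕ | i.1 ∈ S.good i.2 ∧ ¬S.Dens i.1 (i.2 + 1)}
    (fun i => S.P i.1) Prod.snd (c := 1 / 16) (by norm_num)
  have hsub : {X | ∃ k, X ∈ S.good k ∧ ¬S.Dens X (k + 1)} ⊆
      ⋃ i ∈ u, closedBall i.1 ((1 / 2) ^ (i.2 + 1)) := by
    rintro X ⟨k, hk⟩
    obtain ⟨j, hj, hjk, hdist⟩ := hcov (X, k) hk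
    refine mem_biUnion hj ?_
    rw [dist_eq_norm] at hdist
    have h1 := dist_le_of_dist_lt (c := 1 / 8) le_rfl (S.good_antitone hjk hk.1) (hut hj).1
      (by linarith)
    rw [mem_closedBall, pow_succ]
    linarith
  calc _ ≤ ∑' i : u, S.μ (closedBall i.1.1 ((1 / 2) ^ (i.1.2 + 1))) :=
        (measure_mono hsub).trans (measure_biUnion_le _ huc _)
    _ ≤ ∑' i : u, ENNReal.ofReal (S.δ * 16 ^ n) *
        ENNReal.ofReal ((1 / 16 * (1 / 2) ^ i.1.2) ^ n) := by
        refine ENNReal.tsum_le_tsum fun i => ?_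
        refine (not_le.1 (hut i.2).2).le.trans ?_
        rw [← ENNReal.ofReal_mul (by positivity), mul_assoc, ← mul_pow]
        refine ENNReal.ofReal_le_ofReal ?_
        gcongr
        rw [pow_succ]
        have : (0 : ℝ) < (1 / 2) ^ i.1.2 := by positivity
        linarith
    _ ≤ ENNReal.ofReal (S.δ * 16 ^ n) * ENNReal.ofReal (1 ^ n) := by
        rw [ENNReal.tsum_mul_left]
        refine mul_le_mul_right ?_ _
        refine tsum_pow_le_of_disjoint huc (fun i => S.P i.1) (fun i => 1 / 16 * (1 / 2) ^ i.2)
          (fun _ _ => by positivity) hd (z := 0) zero_le_one fun i hi => ?_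
        refine closedBall_subset_closedBall' ?_
        have h1 := mem_closedBall_of_mem_good (hut hi).1
        rw [mem_closedBall_zero_iff] at h1
        have h2 := S.norm_P_le i.1
        have h3 : (1 / 2 : ℝ) ^ i.2 ≤ 1 := pow_le_one₀ (by norm_num) (by norm_num)
        rw [dist_zero_right]
        linarith
    _ = _ := by simp

theorem measure_steep_le :
    S.μ {X | ∃ k, X ∈ S.good k ∧ ∃ Y ∈ S.good k, ‖S.P X - S.P Y‖ < 2 * (1 / 2) ^ k ∧
      1 / 2 ≤ ‖(S.aff k Y).2‖} ≤
      ENNReal.ofReal (S.C₀ * 12 ^ n * S.steepConst) * ∑' j, S.e j univ := by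
  have hC₀ := S.C₀_pos
  obtain ⟨u, hut, hd, huc, hcov⟩ := exists_disjoint_dyadic_subfamily
    {i : EuclideanSpace ℝ (Fin N) × ℕ | i.1 ∈ S.good i.2 ∧ 1 / 2 ≤ ‖(S.aff i.2 i.1).2‖}
    (fun i => S.P i.1) Prod.snd (c := 1 / 2) (by norm_num)
  have hsub : {X | ∃ k, X ∈ S.good k ∧ ∃ Y ∈ S.good k, ‖S.P X - S.P Y‖ < 2 * (1 / 2) ^ k ∧
      1 / 2 ≤ ‖(S.aff k Y).2‖} ⊆ ⋃ i ∈ u, closedBall i.1 (12 * (1 / 2) ^ i.2) := by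
    rintro X ⟨k, hX, Y, hY, hXY, hs⟩
    obtain ⟨j, hj, hjk, hdist⟩ := hcov (Y, k) ⟨hY, hs⟩
    refine mem_biUnion hj ?_
    rw [← dist_eq_norm] at hXY
    have hr : (1 / 2 : ℝ) ^ k ≤ (1 / 2) ^ j.2 :=
      pow_le_pow_of_le_one (by norm_num) (by norm_num) hjk
    have h2 := dist_triangle (S.P X) (S.P Y) (S.P j.1)
    have h1 := dist_le_of_dist_lt (c := 3) (by norm_num) (S.good_antitone hjk hX) (hut hj).1
      (by rw [← dist_eq_norm]; linarith)
    rw [mem_closedBall]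
    linarith
  calc _ ≤ ∑' i : u, S.μ (closedBall i.1.1 (12 * (1 / 2) ^ i.1.2)) :=
        (measure_mono hsub).trans (measure_biUnion_le _ huc _)
    _ ≤ ∑' i : u, ENNReal.ofReal (S.C₀ * 12 ^ n) * ENNReal.ofReal (((1 / 2) ^ i.1.2) ^ n) := by
        refine ENNReal.tsum_le_tsum fun i => ?_
        refine (S.growth _ _ (by positivity)).trans (le_of_eq ?_)
        rw [← ENNReal.ofReal_mul (by positivity), mul_assoc, ← mul_pow]
    _ ≤ ENNReal.ofReal (S.C₀ * 12 ^ n) * (ENNReal.ofReal S.steepConst * ∑' j, S.e j univ) := by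
        rw [ENNReal.tsum_mul_left]
        exact mul_le_mul_right (tsum_pow_le_of_steep u Prod.fst Prod.snd (fun i hi => (hut hi).1)
          (fun i hi => (hut hi).2) hd) _
    _ = _ := by rw [← mul_assoc, ← ENNReal.ofReal_mul (by positivity)]

theorem measure_large_b_le :
    S.μ {X | ∃ k, S.ε < S.b k X} ≤
      ENNReal.ofReal (S.C₀ * 64 ^ n / S.ε ^ 2) * ∑' j, S.e j univ := by
  have hC₀ := S.C₀_pos
  have hε := S.ε_pos
  obtain ⟨u, hut, hd, huc, hcov⟩ := exists_disjoint_dyadic_subfamily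
    {i : EuclideanSpace ℝ (Fin N) × ℕ | S.ε < S.b i.2 i.1}
    Prod.fst Prod.snd (c := 32) (by norm_num)
  have hsub : {X | ∃ k, S.ε < S.b k X} ⊆ ⋃ i ∈ u, closedBall i.1 (64 * (1 / 2) ^ i.2) := by
    rintro X ⟨k, hk⟩
    obtain ⟨j, hj, hjk, hdist⟩ := hcov (X, k) hk
    refine mem_biUnion hj ?_
    rw [mem_closedBall]
    change dist X j.1 ≤ _ at hdist
    linarith
  calc _ ≤ ∑' i : u, S.μ (closedBall i.1.1 (64 * (1 / 2) ^ i.1.2)) :=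
        (measure_mono hsub).trans (measure_biUnion_le _ huc _)
    _ ≤ ∑' i : u, ENNReal.ofReal (S.C₀ * 64 ^ n / S.ε ^ 2) *
        Measure.sum S.e (closedBall i.1.1 (32 * (1 / 2) ^ i.1.2)) := by
        refine ENNReal.tsum_le_tsum fun i => ?_
        refine (S.growth _ _ (by positivity)).trans ?_
        refine le_trans ?_ (mul_le_mul_right (Measure.le_sum S.e i.1.2 _) _)
        rw [← ofReal_b_sq_mul, ← ENNReal.ofReal_mul (by positivity)]
        refine ENNReal.ofReal_le_ofReal ?_
        have h1 : S.ε ^ 2 ≤ S.b i.1.2 i.1.1 ^ 2 := by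
          have : S.ε < S.b i.1.2 i.1.1 := hut i.2
          gcongr
        calc S.C₀ * (64 * (1 / 2) ^ i.1.2) ^ n =
            S.C₀ * 64 ^ n / S.ε ^ 2 * (S.ε ^ 2 * ((1 / 2) ^ i.1.2) ^ n) := by
              rw [mul_pow]
              field_simp
          _ ≤ _ := by gcongr
    _ ≤ ENNReal.ofReal (S.C₀ * 64 ^ n / S.ε ^ 2) * Measure.sum S.e univ := by
        rw [ENNReal.tsum_mul_left, ← measure_biUnion huc hd fun _ _ => measurableSet_closedBall]
        exact mul_le_mul_right (measure_mono (subset_univ _)) _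
    _ = _ := by rw [Measure.sum_apply _ MeasurableSet.univ]

theorem measure_base_residual_le :
    S.μ (closedBall 0 (1 / 2) ∩ {X | 1 / 24 < ‖S.Q X - S.q‖}) ≤
      ENNReal.ofReal (576 * S.C₁) * ∑' j, S.e j univ := by
  have h0 := S.C₁_pos
  have h1 := S.base 0 (mem_closedBall_self (by norm_num))
  have hm : Measurable fun w => ENNReal.ofReal (‖S.Q w - S.q‖ ^ 2) := by
    have : Continuous fun w => ‖S.Q w - S.q‖ ^ 2 := by fun_prop
    exact this.measurable.ennreal_ofReal
  have h2 := mul_meas_ge_le_lintegral (μ := S.μ.restrict (closedBall 0 32)) hm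
    (ENNReal.ofReal (1 / 576))
  have h3 : S.μ (closedBall 0 (1 / 2) ∩ {X | 1 / 24 < ‖S.Q X - S.q‖}) ≤
      S.μ.restrict (closedBall 0 32)
        {w | ENNReal.ofReal (1 / 576) ≤ ENNReal.ofReal (‖S.Q w - S.q‖ ^ 2)} := by
    rw [Measure.restrict_apply' measurableSet_closedBall]
    refine measure_mono fun w hw => ⟨?_, closedBall_subset_closedBall (by norm_num) hw.1⟩
    refine ENNReal.ofReal_le_ofReal ?_
    have : (1 / 24 : ℝ) < ‖S.Q w - S.q‖ := hw.2
    nlinarith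
  have h4 : ENNReal.ofReal 576 * ENNReal.ofReal (1 / 576) = 1 := by
    rw [← ENNReal.ofReal_mul (by norm_num)]
    norm_num
  calc _ ≤ ENNReal.ofReal 576 * (ENNReal.ofReal (1 / 576) *
        S.μ (closedBall 0 (1 / 2) ∩ {X | 1 / 24 < ‖S.Q X - S.q‖})) := by
        rw [← mul_assoc, h4, one_mul]
    _ ≤ ENNReal.ofReal 576 * (ENNReal.ofReal S.C₁ * ∑' j, S.e j univ) := by
        refine mul_le_mul_right ((mul_le_mul_right h3 _).trans (h2.trans (h1.trans ?_))) _
        exact mul_le_mul_right ((measure_mono (subset_univ _)).trans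
          (ENNReal.le_tsum (f := fun j => S.e j univ) 0)) _
    _ = _ := by rw [← mul_assoc, ← ENNReal.ofReal_mul (by norm_num)]

/-- The points whose approximating graph at scale `2⁻⁽ᵏ⁺¹⁾` is defined but misses them. -/
def outlier (S : MultiscaleSetup N n) (k : ℕ) : Set (EuclideanSpace ℝ (Fin N)) :=
  {X | X ∈ S.good k ∧ S.Dens X (k + 1) ∧ ‖(S.aff k X).2‖ < 1 / 2 ∧
    1 / 24 * (1 / 2) ^ (k + 1) < ‖S.Q X - S.val (k + 1) X (S.P X)‖}

theorem residual_of_mem_outlier {k : ℕ} {X X' : EuclideanSpace ℝ (Fin N)} (hX : X ∈ S.outlier k)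
    (hX' : X' ∈ S.outlier k) (h : dist X X' ≤ 8 * (1 / 2) ^ (k + 1)) :
    1 / 30 * (1 / 2) ^ (k + 1) ≤ ‖S.Q X - S.val (k + 1) X' (S.P X)‖ := by
  have hA := app_succ_of_dens hX.1 (app_of_mem_good hX.1).1 hX.2.1 hX.2.2.1
  have hA' := app_succ_of_dens hX'.1 (app_of_mem_good hX'.1).1 hX'.2.1 hX'.2.2.1
  have h0 : (0 : ℝ) < (1 / 2) ^ (k + 1) := by positivity
  have hb := b_le_of_mem_good hX.1 (k + 1)
  have hb' := b_le_of_mem_good hX'.1 (k + 1)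
  have h1 := hA.1.norm_sub_le hA'.1 (Or.inl rfl) hX'.2.1 hA.2 (by linarith) hb hb' (S.P X)
  have h2 : S.C₃ * (S.b (k + 1) X + S.b (k + 1) X') * ((1 / 2) ^ (k + 1) + ‖S.P X - S.P X‖) ≤
      S.C₃ * (S.ε + S.ε) * (1 / 2) ^ (k + 1) := by
    have := S.C₃_pos
    rw [sub_self, norm_zero, add_zero]
    gcongr
  have h3 := S.C₃_mul_ε_le'
  have h4 : ‖S.Q X - S.val (k + 1) X (S.P X)‖ ≤ ‖S.Q X - S.val (k + 1) X' (S.P X)‖ +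
      ‖S.val (k + 1) X (S.P X) - S.val (k + 1) X' (S.P X)‖ := by
    rw [norm_sub_rev (S.val (k + 1) X (S.P X))]
    exact norm_sub_le_norm_sub_add_norm_sub _ _ _
  have h5 := hX.2.2.2
  have h6 : ‖S.val (k + 1) X (S.P X) - S.val (k + 1) X' (S.P X)‖ ≤
      S.C₃ * (S.ε + S.ε) * (1 / 2) ^ (k + 1) := h1.trans h2
  nlinarith

theorem tsum_measure_closedBall_le {k : ℕ} {u : Set (EuclideanSpace ℝ (Fin N))} (hu : u.Countable)
    (hd : u.PairwiseDisjoint fun X => closedBall (S.P X) (1 * (1 / 2) ^ k)) :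
    ∑' X : u, S.e k (closedBall X (32 * (1 / 2) ^ k)) ≤ ENNReal.ofReal (33 ^ n) * S.e k univ := by
  have hr : (0 : ℝ) < (1 / 2) ^ k := by positivity
  have := hu.to_subtype
  calc _ = ∫⁻ w, ∑' X : u, (closedBall (X : EuclideanSpace ℝ (Fin N)) (32 * (1 / 2) ^ k)).indicator
        (fun _ => (1 : ℝ≥0∞)) w ∂S.e k := by
        rw [lintegral_tsum fun X => (measurable_const.indicator measurableSet_closedBall).aemeasurable]
        simp_rw [lintegral_indicator_const measurableSet_closedBall, one_mul]
    _ ≤ ∫⁻ _, ENNReal.ofReal (33 ^ n) ∂S.e k := by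
        refine lintegral_mono fun w => ?_
        have h1 : ∑' X : (u ∩ closedBall w (32 * (1 / 2) ^ k) : Set (EuclideanSpace ℝ (Fin N))),
            ENNReal.ofReal ((1 * (1 / 2 : ℝ) ^ k) ^ n) ≤
            ENNReal.ofReal ((33 * (1 / 2) ^ k) ^ n) := by
          refine tsum_pow_le_of_disjoint (hu.mono inter_subset_left) (fun X => S.P X)
            (fun _ => 1 * (1 / 2) ^ k) (fun _ _ => by positivity) (hd.subset inter_subset_left)
            (z := S.P w) (by positivity) fun X hX => closedBall_subset_closedBall' ?_
          have h2 := hX.2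
          rw [mem_closedBall] at h2
          have h3 := S.norm_P_le (X - w)
          rw [map_sub, ← dist_eq_norm, ← dist_eq_norm] at h3
          linarith
        rw [tsum_subtype (u ∩ closedBall w (32 * (1 / 2) ^ k))
          (fun _ => ENNReal.ofReal ((1 * (1 / 2 : ℝ) ^ k) ^ n))] at h1
        rw [tsum_subtype u fun X => (closedBall X (32 * (1 / 2) ^ k)).indicator
          (fun _ => (1 : ℝ≥0∞)) w]
        have hpos : ENNReal.ofReal (((1 / 2 : ℝ) ^ k) ^ n) ≠ 0 := by
          rw [Ne, ENNReal.ofReal_eq_zero, not_le]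
          positivity
        refine (ENNReal.mul_le_mul_iff_right hpos ENNReal.ofReal_ne_top).1 ?_
        rw [← ENNReal.tsum_mul_left, ← ENNReal.ofReal_mul (by positivity), ← mul_pow, mul_comm _ 33]
        refine le_trans (le_of_eq (tsum_congr fun X => ?_)) h1
        by_cases hX : X ∈ u <;> by_cases hw : w ∈ closedBall X (32 * (1 / 2) ^ k)
        · rw [indicator_of_mem hX, indicator_of_mem hw,
            indicator_of_mem (show X ∈ u ∩ closedBall w (32 * (1 / 2) ^ k) from
              ⟨hX, mem_closedBall_comm.1 hw⟩), mul_one, one_mul]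
        · rw [indicator_of_mem hX, indicator_of_notMem hw,
            indicator_of_notMem fun h => hw (mem_closedBall_comm.1 h.2), mul_zero]
        · rw [indicator_of_notMem hX, indicator_of_notMem fun h => hX h.1, mul_zero]
        · rw [indicator_of_notMem hX, indicator_of_notMem fun h => hX h.1, mul_zero]
    _ = _ := lintegral_const _

theorem measure_outlier_le (k : ℕ) :
    S.μ (S.outlier k) ≤ ENNReal.ofReal (3600 * S.C₁ * 33 ^ n) * S.e (k + 1) univ := by
  have h0 := S.C₁_pos
  have hr : (0 : ℝ) < (1 / 2) ^ (k + 1) := by positivity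
  obtain ⟨u, hut, hd, huc, hcov⟩ := exists_disjoint_dyadic_subfamily
    (S.outlier k) S.P (fun _ => k + 1) (c := 1) one_pos
  set T : EuclideanSpace ℝ (Fin N) → Set (EuclideanSpace ℝ (Fin N)) := fun X =>
    {w | 1 / 30 * (1 / 2) ^ (k + 1) ≤ ‖S.Q w - S.val (k + 1) X (S.P w)‖} ∩
      closedBall X (32 * (1 / 2) ^ (k + 1)) with hT
  have hsub : S.outlier k ⊆ ⋃ X ∈ u, T X := by
    intro X hX
    obtain ⟨Y, hY, -, hdist⟩ := hcov X hX
    refine mem_biUnion hY ?_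
    have h2 : dist X Y ≤ 4 * 1 * (1 / 2) ^ k := by
      refine dist_le_of_dist_lt (by norm_num) hX.1 (hut hY).1 ?_
      rw [← dist_eq_norm]
      rw [pow_succ] at hdist
      linarith
    have h3 : dist X Y ≤ 8 * (1 / 2) ^ (k + 1) := by
      rw [pow_succ]
      linarith
    exact ⟨residual_of_mem_outlier hX (hut hY) h3, by rw [mem_closedBall]; linarith⟩
  have hTle : ∀ X ∈ u, S.μ (T X) ≤ ENNReal.ofReal (3600 * S.C₁) *
      S.e (k + 1) (closedBall X (32 * (1 / 2) ^ (k + 1))) := by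
    intro X hX
    have hX := hut hX
    have hA := (app_succ_of_dens hX.1 (app_of_mem_good hX.1).1 hX.2.1 hX.2.2.1).1
    have h2 := mul_meas_ge_le_lintegral (μ := S.μ.restrict (closedBall X (32 * (1 / 2) ^ (k + 1))))
      (S.measurable_residual (S.aff (k + 1) X)) (ENNReal.ofReal ((1 / 30 * (1 / 2) ^ (k + 1)) ^ 2))
    rw [Measure.restrict_apply' measurableSet_closedBall] at h2
    have h3 : S.μ (T X) ≤ S.μ ({w | ENNReal.ofReal ((1 / 30 * (1 / 2) ^ (k + 1)) ^ 2) ≤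
        ENNReal.ofReal (‖S.Q w - ((S.aff (k + 1) X).1 + (S.aff (k + 1) X).2 (S.P w))‖ ^ 2)} ∩
        closedBall X (32 * (1 / 2) ^ (k + 1))) := by
      refine measure_mono (inter_subset_inter_left _ fun w hw => ?_)
      refine ENNReal.ofReal_le_ofReal (pow_le_pow_left₀ (by positivity) hw 2)
    set c : ℝ := (1 / 30 * (1 / 2) ^ (k + 1)) ^ 2 with hc
    have hcpos : 0 < c := by positivity
    have h4 : ENNReal.ofReal c * S.μ (T X) ≤ ENNReal.ofReal c * (ENNReal.ofReal (3600 * S.C₁) *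
        S.e (k + 1) (closedBall X (32 * (1 / 2) ^ (k + 1)))) := by
      refine (mul_le_mul_right h3 _).trans (h2.trans (hA.trans (le_of_eq ?_)))
      rw [← mul_assoc, ← ENNReal.ofReal_mul hcpos.le]
      congr 2
      rw [hc]
      ring
    exact (ENNReal.mul_le_mul_iff_right (by simpa using hcpos) ENNReal.ofReal_ne_top).1 h4
  calc _ ≤ ∑' X : u, S.μ (T X) := (measure_mono hsub).trans (measure_biUnion_le _ huc _)
    _ ≤ ∑' X : u, ENNReal.ofReal (3600 * S.C₁) *
        S.e (k + 1) (closedBall X (32 * (1 / 2) ^ (k + 1))) :=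
        ENNReal.tsum_le_tsum fun X => hTle X X.2
    _ ≤ ENNReal.ofReal (3600 * S.C₁) * (ENNReal.ofReal (33 ^ n) * S.e (k + 1) univ) := by
        rw [ENNReal.tsum_mul_left]
        exact mul_le_mul_right (tsum_measure_closedBall_le huc hd) _
    _ = _ := by rw [← mul_assoc, ← ENNReal.ofReal_mul (by positivity)]

theorem compl_iInter_good_subset :
    closedBall 0 (1 / 2) \ ⋂ k, S.good k ⊆
      {X | ∃ k, S.ε < S.b k X} ∪ (closedBall 0 (1 / 2) ∩ {X | 1 / 24 < ‖S.Q X - S.q‖}) ∪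
      {X | ∃ k, X ∈ S.good k ∧ ¬S.Dens X (k + 1)} ∪
      {X | ∃ k, X ∈ S.good k ∧ ∃ Y ∈ S.good k, ‖S.P X - S.P Y‖ < 2 * (1 / 2) ^ k ∧
        1 / 2 ≤ ‖(S.aff k Y).2‖} ∪ ⋃ k, S.outlier k := by
  rintro X ⟨hX, hX'⟩
  by_contra hcon
  simp only [mem_union, not_or] at hcon
  obtain ⟨⟨⟨⟨h1, h2⟩, h3⟩, h4⟩, h5⟩ := hcon
  refine hX' (mem_iInter.2 fun k => ?_)
  induction k with
  | zero =>
    exact ⟨hX, fun k => not_lt.1 fun h => h1 ⟨k, h⟩, not_lt.1 fun h => h2 ⟨hX, h⟩⟩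
  | succ k ih =>
    have hd : S.Dens X (k + 1) := by_contra fun h => h3 ⟨k, ih, h⟩
    have hs : ∀ Y ∈ S.good k, ‖S.P X - S.P Y‖ < 2 * (1 / 2) ^ k → ‖(S.aff k Y).2‖ < 1 / 2 :=
      fun Y hY hXY => not_le.1 fun h => h4 ⟨k, ih, Y, hY, hXY, h⟩
    refine ⟨ih, hd, hs, not_lt.1 fun h => h5 (mem_iUnion.2 ⟨k, ih, hd, hs X ih ?_, h⟩)⟩
    rw [sub_self, norm_zero]
    positivity

/-- The factor in front of the total flatness energy in the estimate of the bad set. -/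
def badConst (S : MultiscaleSetup N n) : ℝ :=
  S.C₀ * 64 ^ n / S.ε ^ 2 + 576 * S.C₁ + S.C₀ * 12 ^ n * S.steepConst + 3600 * S.C₁ * 33 ^ n

theorem steepConst_nonneg (S : MultiscaleSetup N n) : 0 ≤ S.steepConst := by
  unfold steepConst
  positivity

/-- If the total flatness energy is small then a Lipschitz image of `ℝⁿ` carries a part of the
measure. -/
theorem exists_lipschitz_measure_range_pos
    (h : ENNReal.ofReal (S.δ * 16 ^ n) + ENNReal.ofReal S.badConst * ∑' j, S.e j univ < S.μ univ) :
    ∃ f : EuclideanSpace ℝ (Fin n) → EuclideanSpace ℝ (Fin N),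
      (∃ L, LipschitzWith L f) ∧ 0 < S.μ (range f) := by
  obtain ⟨f, hf, hsub⟩ := S.exists_lipschitz_of_iInter_good
  refine ⟨f, hf, pos_iff_ne_zero.2 fun h0 => ?_⟩
  have hg : S.μ (⋂ k, S.good k) = 0 := measure_mono_null hsub h0
  have h1 := S.C₁_pos
  have h2 := S.C₀_pos
  have h3 := S.ε_pos
  have h4 := S.steepConst_nonneg
  have hout : S.μ (⋃ k, S.outlier k) ≤
      ENNReal.ofReal (3600 * S.C₁ * 33 ^ n) * ∑' j, S.e j univ := by
    refine (measure_iUnion_le _).trans ((ENNReal.tsum_le_tsum measure_outlier_le).trans ?_)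
    rw [ENNReal.tsum_mul_left]
    exact mul_le_mul_right (ENNReal.tsum_comp_le_tsum_of_injective
      (add_left_injective 1) (fun j => S.e j univ)) _
  have hbad := (measure_mono (μ := S.μ) compl_iInter_good_subset).trans
    ((measure_union_le _ _).trans (add_le_add ((measure_union_le _ _).trans
    (add_le_add ((measure_union_le _ _).trans (add_le_add ((measure_union_le _ _).trans
    (add_le_add measure_large_b_le measure_base_residual_le)) measure_lowDensity_le))
    measure_steep_le)) hout))
  refine h.not_ge ?_
  calc S.μ univ ≤ S.μ ((⋂ k, S.good k) ∪ (closedBall 0 (1 / 2))ᶜ ∪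
        (closedBall 0 (1 / 2) \ ⋂ k, S.good k)) := by
        refine measure_mono fun X _ => ?_
        by_cases ha : X ∈ closedBall (0 : EuclideanSpace ℝ (Fin N)) (1 / 2) <;>
          by_cases hb : X ∈ ⋂ k, S.good k
        · exact Or.inl (Or.inl hb)
        · exact Or.inr ⟨ha, hb⟩
        · exact Or.inl (Or.inl hb)
        · exact Or.inl (Or.inr ha)
    _ ≤ 0 + 0 + S.μ (closedBall 0 (1 / 2) \ ⋂ k, S.good k) :=
        (measure_union_le _ _).trans (add_le_add_left ((measure_union_le _ _).trans
          (add_le_add hg.le S.supp.le)) _)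
    _ ≤ _ := by
        rw [zero_add, zero_add, badConst, ENNReal.ofReal_add (by positivity) (by positivity),
          ENNReal.ofReal_add (by positivity) (by positivity),
          ENNReal.ofReal_add (by positivity) (by positivity)]
        refine hbad.trans (le_of_eq ?_)
        ring

end MultiscaleSetup

section Threshold

variable {N n : ℕ}

theorem exists_splitting {y : Fin (n + 1) → EuclideanSpace ℝ (Fin N)} (hy : AffineIndependent ℝ y) :
    ∃ (P : EuclideanSpace ℝ (Fin N) →L[ℝ] EuclideanSpace ℝ (Fin n))
      (Q : EuclideanSpace ℝ (Fin N) →L[ℝ] EuclideanSpace ℝ (Fin N)) (q : EuclideanSpace ℝ (Fin N)),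
      (∀ x, ‖P x‖ ≤ ‖x‖) ∧ (∀ x, ‖Q x‖ ≤ ‖x‖) ∧ (∀ x, ‖x‖ ≤ ‖P x‖ + ‖Q x‖) ∧
      ∀ w, ‖Q w - q‖ ≤
        infDist w (affineSpan ℝ (range y) : Set (EuclideanSpace ℝ (Fin N))) := by
  set W := (affineSpan ℝ (range y)).direction with hW
  have hdim : Module.finrank ℝ W = n := by
    rw [hW, direction_affineSpan]
    exact hy.finrank_vectorSpan (by simp)
  set e := ((stdOrthonormalBasis ℝ W).reindex (finCongr hdim)).repr
  have hQ : ∀ x, ‖(Wᗮ).starProjection x‖ ≤ ‖x‖ := fun x => by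
    simpa using (Wᗮ).starProjection.le_of_opNorm_le (Submodule.starProjection_norm_le _) x
  refine ⟨(e.toContinuousLinearEquiv : W →L[ℝ] _).comp W.orthogonalProjectionOnto,
    (Wᗮ).starProjection, (Wᗮ).starProjection (y 0), fun x => ?_, hQ, fun x => ?_, fun w => ?_⟩
  · simpa using W.orthogonalProjectionOnto.le_of_opNorm_le (Submodule.orthogonalProjectionOnto_norm_le _) x
  · have h1 : W.starProjection x + (Wᗮ).starProjection x = x :=
      W.starProjection_add_starProjection_orthogonal x
    calc ‖x‖ = ‖W.starProjection x + (Wᗮ).starProjection x‖ := by rw [h1]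
      _ ≤ ‖W.starProjection x‖ + ‖(Wᗮ).starProjection x‖ := norm_add_le _ _
      _ = _ := by simp
  · refine (le_infDist ((affineSpan_nonempty ℝ).2 (range_nonempty y))).2 fun z hz => ?_
    have h1 : (Wᗮ).starProjection (z - y 0) = 0 := by
      rw [Submodule.starProjection_apply_eq_zero_iff, Submodule.orthogonal_orthogonal]
      exact AffineSubspace.vsub_mem_direction hz
        (subset_affineSpan ℝ _ (mem_range_self (0 : Fin (n + 1))))
    rw [map_sub, sub_eq_zero] at h1
    rw [← h1, ← map_sub, dist_eq_norm]
    exact hQ _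

/-- Among measures with controlled growth and mass, those with small Menger energy charge a
Lipschitz image of `ℝⁿ`. -/
theorem exists_energy_threshold (hn : 1 ≤ n) {K : (Fin (n + 2) → EuclideanSpace ℝ (Fin N)) → ℝ}
    (hK : ProperIntegrand N n 2 K) {C₀ m₀ : ℝ} (hC₀ : 0 < C₀) (hm₀ : 0 < m₀) :
    ∃ η > (0 : ℝ), ∀ μ : Measure (EuclideanSpace ℝ (Fin N)), IsFiniteMeasure μ →
      μ (closedBall 0 (1 / 2))ᶜ = 0 →
      (∀ x r, 0 < r → μ (closedBall x r) ≤ ENNReal.ofReal (C₀ * r ^ n)) →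
      ENNReal.ofReal m₀ ≤ μ univ → MengerEnergy N n 2 K μ ≤ ENNReal.ofReal η →
      ∃ f : EuclideanSpace ℝ (Fin n) → EuclideanSpace ℝ (Fin N),
        (∃ L, LipschitzWith L f) ∧ 0 < μ (range f) := by
  set δ : ℝ := m₀ / (4 * 16 ^ n) with hδ
  have hδ0 : 0 < δ := by positivity
  obtain ⟨C₁, hC₁, σ, hσ, hsel⟩ := exists_flatSelection_scaleEnergy hn hK hC₀ hδ0
  obtain ⟨J, hJ⟩ := exists_tsum_scaleEnergy_le hK.2.1 hσ
  have hC₁0 : 0 < C₁ := by linarith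
  set C₃ : ℝ := 4 * C₁ * 2 ^ n * (1 + 256 * (n + 1) * C₁) with hC₃
  have hC₃0 : 0 < C₃ := by positivity
  set ε : ℝ := 1 / (300 * (n + 1) * C₃) with hε
  have hε0 : 0 < ε := by positivity
  set B : ℝ := C₀ * 64 ^ n / ε ^ 2 + 576 * C₁ + C₀ * 12 ^ n *
    (2 ^ n * (16 * (n + 1) ^ 2) * (n * (32768 * C₃ ^ 2 * 33 ^ n))) + 3600 * C₁ * 33 ^ n with hB
  have hB0 : 0 < B := by positivity
  set η : ℝ := m₀ / (4 * B * (J + 1)) with hη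
  have hη0 : 0 < η := by positivity
  refine ⟨η, hη0, fun μ hfin hsupp hgrowth hmass henergy => ?_⟩
  set e : ℕ → Measure (EuclideanSpace ℝ (Fin N)) := fun k => scaleEnergy K μ σ ((1 / 2) ^ k) with he
  have hsel := hsel μ hfin hgrowth
  have htot : ∑' k, e k univ ≤ ENNReal.ofReal (J * η) := by
    refine (hJ μ).trans ((mul_le_mul_right henergy _).trans (le_of_eq ?_))
    rw [ENNReal.ofReal_mul (by positivity), ENNReal.ofReal_natCast]
  have hδm : ENNReal.ofReal δ ≤ μ univ := by
    refine le_trans (ENNReal.ofReal_le_ofReal ?_) hmass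
    refine div_le_self hm₀.le ?_
    have : (1 : ℝ) ≤ 16 ^ n := one_le_pow₀ (by norm_num)
    linarith
  have huniv : ∀ X ∈ closedBall (0 : EuclideanSpace ℝ (Fin N)) (1 / 2), ∀ R : ℝ, 1 ≤ R →
      (closedBall X R)ᶜ ⊆ (closedBall 0 (1 / 2))ᶜ := by
    intro X hX R hR
    refine compl_subset_compl.2 (closedBall_subset_closedBall' ?_)
    rw [mem_closedBall, dist_comm] at hX
    linarith
  have hμ0 : ∀ X ∈ closedBall (0 : EuclideanSpace ℝ (Fin N)) (1 / 2), ∀ R : ℝ, 1 ≤ R →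
      μ (closedBall X R)ᶜ = 0 := fun X hX R hR => measure_mono_null (huniv X hX R hR) hsupp
  have h00 : (0 : EuclideanSpace ℝ (Fin N)) ∈ closedBall 0 (1 / 2) :=
    mem_closedBall_self (by norm_num)
  obtain ⟨y, -, hy, hflat, -⟩ := hsel 0 0 (by
    rw [pow_zero, one_pow, mul_one,
      measure_of_measure_compl_eq_zero (hμ0 0 h00 1 le_rfl)]
    exact hδm) 0 measurable_const
  obtain ⟨P, Q, q, hP, hQ, hPQ, hq⟩ := exists_splitting hy.affineIndependent
  simp only [pow_zero, mul_one, one_pow] at hflat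
  let S : MultiscaleSetup N n :=
    { μ := μ
      e := e
      P := P
      Q := Q
      q := q
      C₀ := C₀
      C₁ := C₁
      δ := δ
      ε := ε
      finite_μ := hfin
      finite_e := fun k => ⟨(ENNReal.le_tsum (f := fun k => e k univ) k).trans_lt
        (htot.trans_lt ENNReal.ofReal_lt_top)⟩
      supp := hsupp
      growth := hgrowth
      sel := hsel
      one_le_C₁ := hC₁
      C₀_pos := hC₀
      ε_pos := hε0
      δ_pos := hδ0
      mass := hδm
      norm_P_le := hP
      norm_Q_le := hQ
      norm_le := hPQ
      base := by
        intro X hX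
        have h1 : ∫⁻ w in closedBall X 32, ENNReal.ofReal (‖Q w - q‖ ^ 2) ∂μ ≤
            ∫⁻ w in closedBall 0 32, ENNReal.ofReal (‖Q w - q‖ ^ 2) ∂μ := by
          rw [Measure.restrict_eq_self_of_ae_mem (s := closedBall 0 32)
            (measure_eq_zero_iff_ae_notMem.1 (hμ0 0 h00 32 (by norm_num)) |>.mono
              fun _ h => not_not.1 h)]
          exact setLIntegral_le_lintegral _ _
        have h2 : e 0 (closedBall 0 32) ≤ e 0 (closedBall X 32) := by
          rw [measure_of_measure_compl_eq_zero (s := closedBall X 32)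
            (scaleEnergy_eq_zero _ _ measurableSet_closedBall.compl (hμ0 X hX 32 (by norm_num)))]
          exact measure_mono (subset_univ _)
        refine h1.trans (le_trans (lintegral_mono fun w => ?_)
          (hflat.trans (mul_le_mul_right h2 _)))
        exact ENNReal.ofReal_le_ofReal (pow_le_pow_left₀ (norm_nonneg _) (hq w) 2)
      small := by
        rw [hε, ← hC₃]
        exact (mul_one_div_cancel (by positivity)).le }
  refine S.exists_lipschitz_measure_range_pos ?_
  have hSB : S.badConst = B := rfl
  have hSe : ∑' j, S.e j univ ≤ ENNReal.ofReal (J * η) := htot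
  have hSm : ENNReal.ofReal m₀ ≤ S.μ univ := hmass
  have hSδ : S.δ = δ := rfl
  refine lt_of_lt_of_le ?_ hSm
  calc _ ≤ ENNReal.ofReal (m₀ / 4) + ENNReal.ofReal (m₀ / 4) := by
        refine add_le_add (ENNReal.ofReal_le_ofReal (le_of_eq ?_))
          ((mul_le_mul_right hSe _).trans ?_)
        · rw [hSδ, hδ]
          field_simp
        · rw [hSB, ← ENNReal.ofReal_mul hB0.le]
          refine ENNReal.ofReal_le_ofReal ?_
          have h1 : B * (J * η) = m₀ / 4 * (J / (J + 1)) := by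
            rw [hη]
            field_simp
          have h2 : (J / (J + 1) : ℝ) ≤ 1 := div_le_one_of_le₀ (by linarith) (by positivity)
          rw [h1]
          nlinarith
    _ < ENNReal.ofReal m₀ := by
        rw [← ENNReal.ofReal_add (by positivity) (by positivity)]
        exact (ENNReal.ofReal_lt_ofReal_iff hm₀).2 (by linarith)

end Threshold

section Density

variable {N n : ℕ}

/-- If every point of `A` is the centre of arbitrarily small balls of `μ`-mass at least `C r ^ n`,
then the Hausdorff measure of `A` is controlled by the mass of `μ`. -/
theorem hausdorffMeasure_le_of_density {A : Set (EuclideanSpace ℝ (Fin N))}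
    {μ : Measure (EuclideanSpace ℝ (Fin N))} {C : ℝ} (hC : 0 < C)
    (h : ∀ d > 0, ∀ x ∈ A, ∃ r, 0 < r ∧ r < d ∧ ENNReal.ofReal (C * r ^ n) ≤ μ (closedBall x r)) :
    μH[(n : ℝ)] A ≤ ENNReal.ofReal (10 ^ n / C) * μ univ := by
  have key : ∀ k : ℕ, ∃ (u : Set (EuclideanSpace ℝ (Fin N))) (r : EuclideanSpace ℝ (Fin N) → ℝ),
      u.Countable ∧ (∀ x ∈ u, ediam (closedBall x (5 * r x)) ≤ ENNReal.ofReal (10 * (1 / (k + 1 : ℝ)))) ∧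
      A ⊆ ⋃ x : u, closedBall (x : EuclideanSpace ℝ (Fin N)) (5 * r x) ∧
      ∑' x : u, ediam (closedBall (x : EuclideanSpace ℝ (Fin N)) (5 * r x)) ^ (n : ℝ) ≤
        ENNReal.ofReal (10 ^ n / C) * μ univ := by
    intro k
    have hk : (0 : ℝ) < 1 / (k + 1 : ℝ) := by positivity
    have hex : ∀ x, ∃ r, x ∈ A → 0 < r ∧ r < 1 / (k + 1 : ℝ) ∧
        ENNReal.ofReal (C * r ^ n) ≤ μ (closedBall x r) := fun x => by
      by_cases hx : x ∈ A
      · obtain ⟨r, hr⟩ := h _ hk x hx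
        exact ⟨r, fun _ => hr⟩
      · exact ⟨0, fun h => absurd h hx⟩
    choose r hr using hex
    obtain ⟨u, huA, hdisj, hcov⟩ := Vitali.exists_disjoint_subfamily_covering_enlargement_closedBall
      A (fun x => x) r (1 / (k + 1 : ℝ)) (fun x hx => (hr x hx).2.1.le) 5 (by norm_num)
    have hcount : u.Countable := hdisj.countable_of_nonempty_interior fun x hx =>
      ⟨x, ball_subset_interior_closedBall (mem_ball_self (hr x (huA hx)).1)⟩
    have hdiam : ∀ x ∈ u, ediam (closedBall x (5 * r x)) ≤ ENNReal.ofReal (10 * r x) := by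
      intro x hx
      have h0 := (hr x (huA hx)).1
      refine ediam_le_of_forall_dist_le fun y hy z hz => ?_
      linarith [dist_triangle_right y z x, mem_closedBall.1 hy, mem_closedBall.1 hz]
    refine ⟨u, r, hcount, fun x hx => (hdiam x hx).trans (ENNReal.ofReal_le_ofReal ?_), ?_, ?_⟩
    · linarith [(hr x (huA hx)).2.1]
    · intro x hx
      obtain ⟨b, hb, hsub⟩ := hcov x hx
      exact mem_iUnion.2 ⟨⟨b, hb⟩, hsub (mem_closedBall_self (hr x hx).1.le)⟩
    · have := hcount.to_subtype
      calc ∑' x : u, ediam (closedBall (x : EuclideanSpace ℝ (Fin N)) (5 * r x)) ^ (n : ℝ)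
          ≤ ∑' x : u, ENNReal.ofReal (10 ^ n / C) * μ (closedBall (x : EuclideanSpace ℝ (Fin N)) (r x)) := by
            refine ENNReal.tsum_le_tsum fun x => ?_
            have hx := hr x (huA x.2)
            calc _ ≤ ENNReal.ofReal (10 * r x) ^ (n : ℝ) :=
                  ENNReal.rpow_le_rpow (hdiam x x.2) (by positivity)
              _ = ENNReal.ofReal (10 ^ n / C) * ENNReal.ofReal (C * r x ^ n) := by
                  rw [ENNReal.rpow_natCast, ← ENNReal.ofReal_pow (by linarith [hx.1]),
                    ← ENNReal.ofReal_mul (by positivity)]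
                  congr 1
                  field_simp
                  rw [mul_pow]
              _ ≤ _ := mul_le_mul_right hx.2.2 _
        _ = ENNReal.ofReal (10 ^ n / C) * μ (⋃ x : u, closedBall (x : EuclideanSpace ℝ (Fin N)) (r x)) := by
            rw [ENNReal.tsum_mul_left, measure_iUnion]
            · intro x y hxy
              exact hdisj x.2 y.2 (fun h => hxy (Subtype.ext h))
            · exact fun _ => measurableSet_closedBall
        _ ≤ _ := mul_le_mul_right (measure_mono (subset_univ _)) _
  choose u r hu hd hA hs using key
  have (k : ℕ) := (hu k).to_subtype
  refine (Measure.hausdorffMeasure_le_liminf_tsum (ι := fun k => u k) (n : ℝ) A (l := Filter.atTop)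
    (fun k : ℕ => ENNReal.ofReal (10 * (1 / (k + 1 : ℝ)))) ?_
    (fun k x => closedBall (x : EuclideanSpace ℝ (Fin N)) (5 * r k x))
    (.of_forall fun k x => hd k x x.2) (.of_forall hA)).trans ?_
  · have := (tendsto_one_div_add_atTop_nhds_zero_nat (𝕜 := ℝ)).const_mul 10
    simpa using ENNReal.tendsto_ofReal this
  · exact Filter.liminf_le_of_frequently_le' (Filter.Frequently.of_forall hs)

theorem isOpen_setOf_density_lt (μ : Measure (EuclideanSpace ℝ (Fin N))) (C d : ℝ) :
    IsOpen {x | ∃ r, 0 < r ∧ r < d ∧ ENNReal.ofReal (C * r ^ n) < μ (closedBall x r)} := by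
  refine Metric.isOpen_iff.2 ?_
  rintro x ⟨r, hr0, hrd, hr⟩
  have hcont : ContinuousAt (fun ρ : ℝ => ENNReal.ofReal (C * ρ ^ n)) r :=
    (ENNReal.continuous_ofReal.comp (by fun_prop : Continuous fun ρ : ℝ => C * ρ ^ n)).continuousAt
  have h1 : ∀ᶠ ρ in nhdsWithin r (Ioi r), ENNReal.ofReal (C * ρ ^ n) < μ (closedBall x r) :=
    nhdsWithin_le_nhds (hcont.eventually_lt continuousAt_const hr)
  obtain ⟨ρ, hρ, hρ'⟩ := (h1.and (Ioo_mem_nhdsGT hrd)).exists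
  refine ⟨ρ - r, sub_pos.2 hρ'.1, fun y hy => ⟨ρ, hr0.trans hρ'.1, hρ'.2, hρ.trans_le ?_⟩⟩
  refine measure_mono (closedBall_subset_closedBall' ?_)
  rw [dist_comm]
  linarith [mem_ball.1 hy]

theorem exists_upper_regular {F : Set (EuclideanSpace ℝ (Fin N))} (hF : MeasurableSet F)
    (hfin : μH[(n : ℝ)] F ≠ ∞) (hpos : μH[(n : ℝ)] F ≠ 0) :
    ∃ F' ⊆ F, MeasurableSet F' ∧ μH[(n : ℝ)] F' ≠ 0 ∧ ∃ s > (0 : ℝ), ∀ x r, 0 < r → r < s →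
      μH[(n : ℝ)] (F' ∩ closedBall x r) ≤ ENNReal.ofReal (2 * 20 ^ n * r ^ n) := by
  set μ : Measure (EuclideanSpace ℝ (Fin N)) := μH[(n : ℝ)].restrict F with hμ
  have : IsFiniteMeasure μ := ⟨by simpa [hμ, lt_top_iff_ne_top] using hfin⟩
  set B : ℕ → Set (EuclideanSpace ℝ (Fin N)) := fun m =>
    {x | ∃ r, 0 < r ∧ r < 1 / (m + 1 : ℝ) ∧
      ENNReal.ofReal (2 * 10 ^ n * r ^ n) < μ (closedBall x r)} with hB
  have hBo : ∀ m, IsOpen (B m) := fun m => isOpen_setOf_density_lt μ _ _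
  have hA : μH[(n : ℝ)] (F ∩ ⋂ m, B m) = 0 := by
    by_contra h0
    have hμA : μ (F ∩ ⋂ m, B m) = μH[(n : ℝ)] (F ∩ ⋂ m, B m) := by
      rw [hμ, Measure.restrict_apply' hF, inter_right_comm, inter_self]
    have hAt : μ (F ∩ ⋂ m, B m) ≠ ∞ := measure_ne_top _ _
    rw [← hμA] at h0
    obtain ⟨U, hAU, hU, hlt⟩ := Set.exists_isOpen_lt_add _ hAt h0
    have hle : μH[(n : ℝ)] (F ∩ ⋂ m, B m) ≤
        ENNReal.ofReal (10 ^ n / (2 * 10 ^ n)) * (μ.restrict U) univ := by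
      refine hausdorffMeasure_le_of_density (by positivity) fun d hd x hx => ?_
      obtain ⟨δ, hδ, hsub⟩ := Metric.isOpen_iff.1 hU x (hAU hx)
      obtain ⟨m, hm⟩ := exists_nat_one_div_lt (lt_min hd hδ)
      obtain ⟨r, hr0, hr, hrμ⟩ := mem_iInter.1 hx.2 m
      refine ⟨r, hr0, hr.trans (hm.trans_le (min_le_left _ _)), ?_⟩
      rw [Measure.restrict_eq_self]
      · exact hrμ.le
      · exact (closedBall_subset_ball (hr.trans (hm.trans_le (min_le_right _ _)))).trans hsub
    rw [Measure.restrict_apply_univ, ← hμA,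
      show (10 ^ n / (2 * 10 ^ n) : ℝ) = 2⁻¹ by field_simp] at hle
    have h2 : ENNReal.ofReal 2⁻¹ = 2⁻¹ := by
      rw [ENNReal.ofReal_inv_of_pos two_pos]; simp
    rw [h2] at hle
    replace hle := mul_le_mul_right hle 2
    rw [← mul_assoc, ENNReal.mul_inv_cancel (by simp) (by simp), one_mul] at hle
    rw [← two_mul] at hlt
    exact absurd hlt (not_lt.2 hle)
  have hex : ∃ m, μH[(n : ℝ)] (F \ B m) ≠ 0 := by
    by_contra! hall
    refine hpos (measure_mono_null ?_ (measure_union_null hA (measure_iUnion_null hall)))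
    intro x hx
    by_cases hxB : ∀ m, x ∈ B m
    · exact Or.inl ⟨hx, mem_iInter.2 hxB⟩
    · push Not at hxB
      obtain ⟨m, hm⟩ := hxB
      exact Or.inr (mem_iUnion.2 ⟨m, hx, hm⟩)
  obtain ⟨m, hm⟩ := hex
  refine ⟨F \ B m, sdiff_subset, MeasurableSet.diff hF (hBo m).measurableSet, hm, 1 / (m + 1 : ℝ) / 2,
    by positivity, fun x r hr hrs => ?_⟩
  rcases ((F \ B m) ∩ closedBall x r).eq_empty_or_nonempty with he | ⟨y, hy, hyr⟩
  · simp [he]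
  have hnot : ¬ ENNReal.ofReal (2 * 10 ^ n * (2 * r) ^ n) < μ (closedBall y (2 * r)) := fun hlt =>
    hy.2 ⟨2 * r, by linarith, by linarith, hlt⟩
  calc μH[(n : ℝ)] ((F \ B m) ∩ closedBall x r)
      ≤ μH[(n : ℝ)] (closedBall y (2 * r) ∩ F) := measure_mono fun z hz => ⟨by
          rw [mem_closedBall]
          linarith [dist_triangle_right z y x, mem_closedBall.1 hyr, mem_closedBall.1 hz.2], hz.1.1⟩
    _ = μ (closedBall y (2 * r)) := by rw [hμ, Measure.restrict_apply' hF]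
    _ ≤ _ := not_lt.1 hnot
    _ = _ := by
        congr 1
        rw [show (20 : ℝ) = 10 * 2 by norm_num, mul_pow, mul_pow]
        ring

theorem exists_le_iSup_ediam_of_lt {s : Set (EuclideanSpace ℝ (Fin N))} {a : ℝ≥0∞}
    (ha : μH[(n : ℝ)] s < a) {δ : ℝ≥0∞} (hδ : 0 < δ) :
    ∃ t : ℕ → Set (EuclideanSpace ℝ (Fin N)), s ⊆ ⋃ i, t i ∧ (∀ i, ediam (t i) ≤ δ) ∧
      ∑' i, ⨆ _ : (t i).Nonempty, ediam (t i) ^ (n : ℝ) < a := by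
  rw [Measure.hausdorffMeasure_apply] at ha
  have h1 := (le_iSup₂ (f := fun (r : ℝ≥0∞) (_ : 0 < r) =>
    ⨅ (t : ℕ → Set (EuclideanSpace ℝ (Fin N))) (_ : s ⊆ ⋃ n, t n) (_ : ∀ n, ediam (t n) ≤ r),
          ∑' i, ⨆ _ : (t i).Nonempty, ediam (t i) ^ (n : ℝ)) δ hδ).trans_lt ha
  simpa only [iInf_lt_iff, exists_prop] using h1

/-- The set of points of `F` at which the lower density at all scales up to `s` is small is
negligible. -/
theorem hausdorffMeasure_small_density (hn : 1 ≤ n) {F : Set (EuclideanSpace ℝ (Fin N))}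
    (hfin : μH[(n : ℝ)] F ≠ ∞) {s : ℝ} (hs : 0 < s) :
    μH[(n : ℝ)] {x ∈ F | ∀ ρ, 0 < ρ → ρ < s →
      μH[(n : ℝ)] (F ∩ closedBall x ρ) < ENNReal.ofReal (2⁻¹ * ρ ^ n)} = 0 := by
  set Z := {x ∈ F | ∀ ρ, 0 < ρ → ρ < s →
      μH[(n : ℝ)] (F ∩ closedBall x ρ) < ENNReal.ofReal (2⁻¹ * ρ ^ n)} with hZ
  have hn0 : (0 : ℝ) < n := by exact_mod_cast hn
  by_contra h0
  have hZt : μH[(n : ℝ)] Z ≠ ∞ := measure_ne_top_of_subset (fun x hx => hx.1) hfin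
  obtain ⟨t, hcov, hdiam, hsum⟩ := exists_le_iSup_ediam_of_lt (ENNReal.lt_add_right hZt h0)
    (δ := ENNReal.ofReal (s / 2)) (by simpa using hs)
  have hpiece : ∀ i, μH[(n : ℝ)] (Z ∩ t i) ≤
      2⁻¹ * ⨆ _ : (t i).Nonempty, ediam (t i) ^ (n : ℝ) := by
    intro i
    rcases (Z ∩ t i).eq_empty_or_nonempty with he | ⟨x, hxZ, hxt⟩
    · simp [he]
    have hne : (t i).Nonempty := ⟨x, hxt⟩
    have htop : ediam (t i) ≠ ∞ := ((hdiam i).trans_lt ENNReal.ofReal_lt_top).ne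
    rcases eq_or_ne (ediam (t i)) 0 with hd0 | hd0
    · have hsub : (t i).Subsingleton := ediam_eq_zero_iff.1 hd0
      have := Measure.nullSingletonClass_hausdorff (EuclideanSpace ℝ (Fin N)) hn0
      rw [(hsub.anti inter_subset_right).measure_zero]
      exact zero_le
    · set ρ := (ediam (t i)).toReal with hρ
      have hρ0 : 0 < ρ := ENNReal.toReal_pos hd0 htop
      have hρs : ρ < s := by
        have := ENNReal.toReal_mono ENNReal.ofReal_ne_top (hdiam i)
        rw [ENNReal.toReal_ofReal (by positivity)] at this
        linarith
      rw [iSup_pos hne]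
      calc μH[(n : ℝ)] (Z ∩ t i) ≤ μH[(n : ℝ)] (F ∩ closedBall x ρ) := by
            refine measure_mono fun y hy => ⟨hy.1.1, ?_⟩
            rw [mem_closedBall, dist_edist]
            exact ENNReal.toReal_mono htop (edist_le_ediam_of_mem hy.2 hxt)
        _ ≤ _ := (hxZ.2 ρ hρ0 hρs).le
        _ = _ := by
            rw [ENNReal.ofReal_mul (by norm_num), ENNReal.ofReal_inv_of_pos two_pos,
              ENNReal.ofReal_pow hρ0.le, hρ, ENNReal.ofReal_toReal htop, ENNReal.rpow_natCast]
            simp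
  have hle : μH[(n : ℝ)] Z ≤ 2⁻¹ * ∑' i, ⨆ _ : (t i).Nonempty, ediam (t i) ^ (n : ℝ) := by
    calc μH[(n : ℝ)] Z ≤ μH[(n : ℝ)] (⋃ i, Z ∩ t i) := measure_mono fun x hx => by
          rw [← inter_iUnion]; exact ⟨hx, hcov hx⟩
      _ ≤ ∑' i, μH[(n : ℝ)] (Z ∩ t i) := measure_iUnion_le _
      _ ≤ ∑' i, 2⁻¹ * ⨆ _ : (t i).Nonempty, ediam (t i) ^ (n : ℝ) := ENNReal.tsum_le_tsum hpiece
      _ = _ := ENNReal.tsum_mul_left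
  replace hle := mul_le_mul_right hle 2
  rw [← mul_assoc, ENNReal.mul_inv_cancel (by simp) (by simp), one_mul, two_mul] at hle
  exact absurd hsum (not_lt.2 hle)

theorem hausdorffMeasure_compl_density (hn : 1 ≤ n) {F : Set (EuclideanSpace ℝ (Fin N))}
    (hfin : μH[(n : ℝ)] F ≠ ∞) :
    μH[(n : ℝ)] (F \ {x ∈ F | ∀ s > 0, ∃ ρ, 0 < ρ ∧ ρ < s ∧
      ENNReal.ofReal (2⁻¹ * ρ ^ n) ≤ μH[(n : ℝ)] (F ∩ closedBall x ρ)}) = 0 := by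
  refine measure_mono_null ?_ (measure_iUnion_null fun k : ℕ =>
    hausdorffMeasure_small_density hn hfin (s := 1 / (k + 1 : ℝ)) (by positivity))
  rintro x ⟨hxF, hx⟩
  have h2 : ¬ ∀ s > 0, ∃ ρ, 0 < ρ ∧ ρ < s ∧
      ENNReal.ofReal (2⁻¹ * ρ ^ n) ≤ μH[(n : ℝ)] (F ∩ closedBall x ρ) := fun h => hx ⟨hxF, h⟩
  push Not at h2
  obtain ⟨s, hs, h3⟩ := h2
  obtain ⟨k, hk⟩ := exists_nat_one_div_lt hs
  exact mem_iUnion.2 ⟨k, hxF, fun ρ h0 hρ => h3 ρ h0 (hρ.trans hk)⟩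

end Density

section Blowup

variable {N n : ℕ} {K : (Fin (n + 2) → EuclideanSpace ℝ (Fin N)) → ℝ}

theorem pi_setOf_apply_eq_apply_zero {α : Type*} [MeasurableSpace α] [MeasurableSingletonClass α]
    [TopologicalSpace α] [T2Space α] [SecondCountableTopology α] [BorelSpace α]
    (μ : Measure α) [SigmaFinite μ] [NullSingletonClass μ] :
    (Measure.pi fun _ : Fin (n + 2) => μ) {z | z 1 = z 0} = 0 := by
  have hmp := measurePreserving_piFinSuccAbove (fun _ : Fin (n + 2) => μ) 0
  have hms : MeasurableSet {p : α × (Fin (n + 1) → α) | p.2 0 = p.1} :=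
    measurableSet_eq_fun (by fun_prop) (by fun_prop)
  have hset : {z : Fin (n + 2) → α | z 1 = z 0} =
      (MeasurableEquiv.piFinSuccAbove (fun _ : Fin (n + 2) => α) 0) ⁻¹'
        {p : α × (Fin (n + 1) → α) | p.2 0 = p.1} := by
    ext z
    rfl
  rw [hset, hmp.measure_preimage hms.nullMeasurableSet, Measure.measure_prod_null hms]
  refine .of_forall fun a => ?_
  exact Measure.pi_hyperplane (fun _ : Fin (n + 1) => μ) 0 a

theorem mengerEnergy_restrict (μ : Measure (EuclideanSpace ℝ (Fin N))) [SigmaFinite μ]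
    {B : Set (EuclideanSpace ℝ (Fin N))} (hB : MeasurableSet B) :
    MengerEnergy N n 2 K (μ.restrict B) =
      ((Measure.pi fun _ : Fin (n + 2) => μ).withDensity fun z => ENNReal.ofReal (K z ^ (2 : ℝ)))
        (univ.pi fun _ => B) := by
  rw [MengerEnergy, withDensity_apply _ (MeasurableSet.univ_pi fun _ => hB), Measure.restrict_pi_pi]

theorem exists_low_energy_ball (hn : 1 ≤ n) {F : Set (EuclideanSpace ℝ (Fin N))}
    (hfin : μH[(n : ℝ)] F ≠ ∞) (hpos : μH[(n : ℝ)] F ≠ 0)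
    (hE : MengerEnergy N n 2 K (μH[(n : ℝ)].restrict F) ≠ ∞) {η s : ℝ} (hη : 0 < η) (hs : 0 < s) :
    ∃ x ρ, 0 < ρ ∧ ρ < s ∧ ENNReal.ofReal (2⁻¹ * ρ ^ n) ≤ μH[(n : ℝ)] (F ∩ closedBall x ρ) ∧
      MengerEnergy N n 2 K (μH[(n : ℝ)].restrict (F ∩ closedBall x ρ)) ≤
        ENNReal.ofReal (η * ρ ^ n) := by
  by_contra! hcon
  have hn0 : (0 : ℝ) < n := by exact_mod_cast hn
  have := Measure.nullSingletonClass_hausdorff (EuclideanSpace ℝ (Fin N)) hn0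
  set μ : Measure (EuclideanSpace ℝ (Fin N)) := μH[(n : ℝ)].restrict F with hμ
  have : IsFiniteMeasure μ := ⟨by simpa [hμ, lt_top_iff_ne_top] using hfin⟩
  set D := {x ∈ F | ∀ s > 0, ∃ ρ, 0 < ρ ∧ ρ < s ∧
      ENNReal.ofReal (2⁻¹ * ρ ^ n) ≤ μH[(n : ℝ)] (F ∩ closedBall x ρ)} with hD
  have hD0 : μH[(n : ℝ)] D ≠ 0 := fun h0 => hpos <|
    measure_mono_null (fun x hx => by
      by_cases h : x ∈ D
      · exact Or.inl h
      · exact Or.inr ⟨hx, h⟩) (measure_union_null h0 (hausdorffMeasure_compl_density hn hfin))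
  set ν := (Measure.pi fun _ : Fin (n + 2) => μ).withDensity
    fun z => ENNReal.ofReal (K z ^ (2 : ℝ)) with hν
  have hνfin : IsFiniteMeasure ν := isFiniteMeasure_withDensity hE
  set T : ℕ → Set (Fin (n + 2) → EuclideanSpace ℝ (Fin N)) := fun j =>
    {z | ∀ i, dist (z i) (z 0) ≤ 1 / (j + 1 : ℝ)} with hT
  have hTm : ∀ j, MeasurableSet (T j) := fun j => by
    have : IsClosed (T j) := by
      rw [hT]
      simp only [ofPred_forall]
      exact isClosed_iInter fun i => isClosed_le (by fun_prop) (by fun_prop)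
    exact this.measurableSet
  have hanti : Antitone T := fun j k hjk z hz i => (hz i).trans (Nat.one_div_le_one_div hjk)
  have hlim := tendsto_measure_iInter_atTop (μ := ν) (fun j => (hTm j).nullMeasurableSet) hanti
    ⟨0, measure_ne_top _ _⟩
  have hnull : ν (⋂ j, T j) = 0 := by
    refine withDensity_absolutelyContinuous _ _ (measure_mono_null ?_
      (pi_setOf_apply_eq_apply_zero (n := n) μ))
    intro z hz
    refine dist_le_zero.1 (le_of_forall_pos_lt_add fun ε hε => ?_)
    obtain ⟨j, hj⟩ := exists_nat_one_div_lt hε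
    simpa using (mem_iInter.1 hz j 1).trans_lt hj
  rw [hnull] at hlim
  have hbound : ∀ j, μH[(n : ℝ)] D ≤ ENNReal.ofReal (10 ^ n / η) * ν (T j) := by
    intro j
    have hev : Measurable fun z : Fin (n + 2) → EuclideanSpace ℝ (Fin N) => z 0 :=
      measurable_pi_apply 0
    have := hausdorffMeasure_le_of_density (n := n) (A := D)
      (μ := (ν.restrict (T j)).map fun z => z 0) hη fun d hd x hx => by
        have hj : (0 : ℝ) < 1 / (j + 1 : ℝ) / 2 := by positivity
        obtain ⟨ρ, hρ0, hρ, hρD⟩ := hx.2 (min d (min s (1 / (j + 1 : ℝ) / 2)))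
          (lt_min hd (lt_min hs hj))
        obtain ⟨h1, h23⟩ := lt_min_iff.1 hρ
        obtain ⟨h2, h3⟩ := lt_min_iff.1 h23
        refine ⟨ρ, hρ0, h1, (hcon x ρ hρ0 h2 hρD).le.trans ?_⟩
        rw [inter_comm, ← Measure.restrict_restrict measurableSet_closedBall,
          mengerEnergy_restrict _ measurableSet_closedBall,
          Measure.map_apply hev measurableSet_closedBall,
          Measure.restrict_apply (hev measurableSet_closedBall)]
        refine measure_mono fun z hz => ⟨hz 0 trivial, fun i => ?_⟩
        linarith [dist_triangle_right (z i) (z 0) x, mem_closedBall.1 (hz i trivial),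
          mem_closedBall.1 (hz 0 trivial)]
    rwa [Measure.map_apply hev MeasurableSet.univ, preimage_univ,
      Measure.restrict_apply_univ] at this
  have hlim2 := ENNReal.Tendsto.const_mul hlim (a := ENNReal.ofReal (10 ^ n / η))
    (Or.inr ENNReal.ofReal_ne_top)
  rw [mul_zero] at hlim2
  exact hD0 (le_antisymm (ge_of_tendsto' hlim2 hbound) zero_le)

theorem ProperIntegrand.rpow_rescale (hK : ProperIntegrand N n 2 K) {τ : ℝ} (hτ : 0 < τ)
    (b : EuclideanSpace ℝ (Fin N)) (z : Fin (n + 2) → EuclideanSpace ℝ (Fin N)) :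
    K (fun i => τ⁻¹ • (z i - b)) ^ (2 : ℝ) = τ ^ (n * (n + 1)) * K z ^ (2 : ℝ) := by
  obtain ⟨-, -, -, hscale, htrans⟩ := hK
  have h1 := hscale τ⁻¹ (inv_pos.2 hτ) fun i => z i + -b
  rw [htrans] at h1
  rw [← h1, ← mul_assoc, ← mul_pow, mul_inv_cancel₀ hτ.ne', one_pow, one_mul]
  simp only [sub_eq_add_neg]

theorem mengerEnergy_rescale (hK : ProperIntegrand N n 2 K)
    (μ : Measure (EuclideanSpace ℝ (Fin N))) [IsFiniteMeasure μ] {τ : ℝ} (hτ : 0 < τ)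
    (b : EuclideanSpace ℝ (Fin N)) :
    MengerEnergy N n 2 K
        (ENNReal.ofReal (τ⁻¹ ^ n) • μ.map fun x => τ⁻¹ • (x - b)) =
      ENNReal.ofReal (τ⁻¹ ^ n) * MengerEnergy N n 2 K μ := by
  have hφ : Measurable fun x : EuclideanSpace ℝ (Fin N) => τ⁻¹ • (x - b) := by fun_prop
  set c := ENNReal.ofReal (τ⁻¹ ^ n) with hc
  have hpi : (Measure.pi fun _ : Fin (n + 2) => c • μ.map fun x => τ⁻¹ • (x - b)) =
      c ^ (n + 2) • (Measure.pi fun _ : Fin (n + 2) => μ).map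
        fun z i => τ⁻¹ • (z i - b) := by
    have : SigmaFinite (c • μ.map fun x => τ⁻¹ • (x - b)) := by
      have : IsFiniteMeasure (c • μ.map fun x => τ⁻¹ • (x - b)) :=
        ⟨by simpa [hc] using ENNReal.mul_lt_top ENNReal.ofReal_lt_top (measure_lt_top _ _)⟩
      infer_instance
    refine Measure.pi_eq fun s hs => ?_
    rw [Measure.pi_map_pi (fun _ => hφ.aemeasurable), Measure.smul_apply, Measure.pi_pi]
    simp [Finset.prod_mul_distrib]
  have hΦ : Measurable fun (z : Fin (n + 2) → EuclideanSpace ℝ (Fin N)) i => τ⁻¹ • (z i - b) := by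
    fun_prop
  have hKm : Measurable fun z => ENNReal.ofReal (K z ^ (2 : ℝ)) :=
    (hK.2.1.pow_const _).ennreal_ofReal
  have hτn : (0 : ℝ) ≤ τ ^ (n * (n + 1)) := by positivity
  rw [MengerEnergy, hpi, lintegral_smul_measure, lintegral_map hKm hΦ, MengerEnergy]
  simp only [hK.rpow_rescale hτ, ENNReal.ofReal_mul hτn]
  rw [lintegral_const_mul _ hKm, smul_eq_mul, ← mul_assoc]
  congr 1
  rw [hc, ← ENNReal.ofReal_pow (by positivity), ← ENNReal.ofReal_mul (by positivity)]
  congr 1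
  rw [← pow_mul, show n * (n + 2) = n + n * (n + 1) by ring, pow_add, mul_assoc, ← mul_pow,
    inv_mul_cancel₀ hτ.ne', one_pow, mul_one]

/-- A set of positive finite measure and finite energy meets some Lipschitz image in a set of
positive measure. -/
theorem exists_lipschitz_of_mengerEnergy (hn : 1 ≤ n) (hK : ProperIntegrand N n 2 K)
    {F : Set (EuclideanSpace ℝ (Fin N))} (hF : MeasurableSet F)
    (hfin : μH[(n : ℝ)] F ≠ ∞) (hpos : μH[(n : ℝ)] F ≠ 0)
    (hE : MengerEnergy N n 2 K (μH[(n : ℝ)].restrict F) ≠ ∞) :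
    ∃ f : EuclideanSpace ℝ (Fin n) → EuclideanSpace ℝ (Fin N), (∃ L, LipschitzWith L f) ∧
      μH[(n : ℝ)] (F ∩ range f) ≠ 0 := by
  obtain ⟨F', hF'F, hF', hpos', s, hs, hreg⟩ := exists_upper_regular hF hfin hpos
  have hfin' : μH[(n : ℝ)] F' ≠ ∞ := measure_ne_top_of_subset hF'F hfin
  have : IsFiniteMeasure (μH[(n : ℝ)].restrict F) :=
    ⟨by simpa [lt_top_iff_ne_top] using hfin⟩
  have hE' : MengerEnergy N n 2 K (μH[(n : ℝ)].restrict F') ≠ ∞ := by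
    rw [← inter_eq_self_of_subset_left hF'F, ← Measure.restrict_restrict hF',
      mengerEnergy_restrict _ hF']
    have : IsFiniteMeasure ((Measure.pi fun _ : Fin (n + 2) => μH[(n : ℝ)].restrict F).withDensity
        fun z => ENNReal.ofReal (K z ^ (2 : ℝ))) := isFiniteMeasure_withDensity hE
    exact measure_ne_top _ _
  obtain ⟨η, hη, hthr⟩ := exists_energy_threshold hn hK (C₀ := 2 * 20 ^ n)
    (m₀ := 2⁻¹ * 2⁻¹ ^ n) (by positivity) (by positivity)
  obtain ⟨b, ρ, hρ0, hρs, hmass, hen⟩ := exists_low_energy_ball hn hfin' hpos' hE'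
    (η := η * 2 ^ n) (s := s / 2) (by positivity) (by positivity)
  set G := F' ∩ closedBall b ρ with hG
  have hGm : MeasurableSet G := MeasurableSet.inter hF' measurableSet_closedBall
  have hτ : (0 : ℝ) < 2 * ρ := by positivity
  set τ := 2 * ρ with hτdef
  have : IsFiniteMeasure (μH[(n : ℝ)].restrict G) :=
    ⟨by simpa [lt_top_iff_ne_top] using measure_ne_top_of_subset inter_subset_left hfin'⟩
  set φ : EuclideanSpace ℝ (Fin N) ≃ₜ EuclideanSpace ℝ (Fin N) :=
    (Homeomorph.subRight b).trans (Homeomorph.smulOfNeZero τ⁻¹ (inv_ne_zero hτ.ne')) with hφ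
  have hφa : ∀ x, φ x = τ⁻¹ • (x - b) := fun x => rfl
  set μ := ENNReal.ofReal (τ⁻¹ ^ n) • (μH[(n : ℝ)].restrict G).map fun x => τ⁻¹ • (x - b) with hμ
  have hμa : ∀ A, μ A = ENNReal.ofReal (τ⁻¹ ^ n) *
      μH[(n : ℝ)] {x | τ⁻¹ • (x - b) ∈ A ∧ x ∈ G} := fun A => by
    rw [hμ, Measure.smul_apply, smul_eq_mul]
    congr 1
    exact (φ.toMeasurableEquiv.map_apply A).trans (Measure.restrict_apply' hGm)
  have hscale : ∀ a : ℝ, 0 ≤ a → ENNReal.ofReal (τ⁻¹ ^ n) * ENNReal.ofReal (a * τ ^ n) =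
      ENNReal.ofReal a := fun a ha => by
    rw [← ENNReal.ofReal_mul (by positivity)]
    congr 1
    rw [mul_left_comm, ← mul_pow, inv_mul_cancel₀ hτ.ne', one_pow, mul_one]
  obtain ⟨f, ⟨L, hL⟩, hf⟩ := hthr μ
    ⟨by rw [hμa]; exact ENNReal.mul_lt_top ENNReal.ofReal_lt_top
          (lt_top_iff_ne_top.2 (measure_ne_top_of_subset (fun x hx => hx.2.1) hfin'))⟩
    (by
      rw [hμa, measure_mono_null (t := ∅) ?_ measure_empty, mul_zero]
      refine fun x hx => hx.1 ?_
      rw [mem_closedBall_zero_iff, norm_smul, norm_inv, Real.norm_of_nonneg hτ.le,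
        inv_mul_le_iff₀ hτ, ← dist_eq_norm]
      linarith [mem_closedBall.1 hx.2.2])
    (fun y r hr => by
      rw [hμa, ← hscale (2 * 20 ^ n * r ^ n) (by positivity)]
      refine mul_le_mul_right ?_ _
      by_cases hrs : τ * r < s
      · refine (measure_mono (t := F' ∩ closedBall (b + τ • y) (τ * r)) fun x hx => ?_).trans
          ((hreg (b + τ • y) (τ * r) (by positivity) hrs).trans (le_of_eq ?_))
        · refine ⟨hx.2.1, ?_⟩
          have h1 := mem_closedBall.1 hx.1
          rw [mem_closedBall]
          have h2 : x - (b + τ • y) = τ • (τ⁻¹ • (x - b) - y) := by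
            rw [smul_sub, smul_inv_smul₀ hτ.ne']
            abel
          rw [dist_eq_norm, h2, norm_smul, Real.norm_of_nonneg hτ.le, ← dist_eq_norm]
          gcongr
        · congr 1
          ring
      · have hr1 : 1 ≤ r := by
          by_contra! h
          exact hrs (by nlinarith)
        refine (measure_mono fun x hx => hx.2).trans
          ((hreg b ρ hρ0 (by linarith)).trans (ENNReal.ofReal_le_ofReal ?_))
        have h1 : ρ ^ n ≤ r ^ n * τ ^ n := by
          rw [← mul_pow]
          exact pow_le_pow_left₀ hρ0.le (by nlinarith) _
        calc 2 * 20 ^ n * ρ ^ n ≤ 2 * 20 ^ n * (r ^ n * τ ^ n) := by gcongr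
          _ = _ := by ring)
    (by
      rw [hμa, ← hscale (2⁻¹ * 2⁻¹ ^ n) (by positivity)]
      refine mul_le_mul_right ?_ _
      have : {x | τ⁻¹ • (x - b) ∈ univ ∧ x ∈ G} = G := by simp
      rw [this]
      refine le_trans (le_of_eq ?_) hmass
      congr 1
      rw [hτdef, mul_assoc, ← mul_pow, inv_mul_cancel_left₀ two_ne_zero])
    (by
      rw [hμ, mengerEnergy_rescale hK _ hτ, ← hscale _ hη.le]
      refine mul_le_mul_right (hen.trans (le_of_eq ?_)) _
      congr 1
      rw [hτdef]
      ring)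
  refine ⟨fun v => b + τ • f v, ⟨‖τ‖₊ * L, ?_⟩, fun h0 => hf.ne' ?_⟩
  · refine LipschitzWith.of_dist_le_mul fun v w => ?_
    rw [dist_add_left, dist_smul₀, NNReal.coe_mul, coe_nnnorm, mul_assoc]
    gcongr
    exact hL.dist_le_mul v w
  · rw [hμa, measure_mono_null ?_ h0, mul_zero]
    rintro x ⟨⟨v, hv⟩, hx⟩
    refine ⟨hF'F hx.1, v, ?_⟩
    change b + τ • f v = x
    rw [hv, smul_inv_smul₀ hτ.ne', add_sub_cancel]

end Blowup

section Decomposition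

variable {N n : ℕ} {K : (Fin (n + 2) → EuclideanSpace ℝ (Fin N)) → ℝ}

theorem pi_mono_of_le {ι α : Type*} [Fintype ι] [MeasurableSpace α] {μ ν : Measure α}
    (h : μ ≤ ν) : (Measure.pi fun _ : ι => μ) ≤ Measure.pi fun _ : ι => ν := by
  refine Measure.le_intro fun s hs _ => ?_
  rw [Measure.pi, Measure.pi, toMeasure_apply _ _ hs, toMeasure_apply _ _ hs]
  refine OuterMeasure.le_pi.2 (fun t _ => ?_) s
  exact (OuterMeasure.pi_pi_le _ _).trans (Finset.prod_le_prod' fun i _ => h (t i))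

theorem mengerEnergy_mono {μ ν : Measure (EuclideanSpace ℝ (Fin N))} (h : μ ≤ ν) :
    MengerEnergy N n 2 K μ ≤ MengerEnergy N n 2 K ν :=
  lintegral_mono' (pi_mono_of_le h) le_rfl

/-- Every tuple in the support of a function with finite integral over a (not necessarily σ-finite)
power of `μ` has a coordinate in one of countably many sets of finite measure. -/
theorem exists_finite_measure_cover {ι α : Type*} [Fintype ι] [Nonempty ι] [MeasurableSpace α]
    (μ : Measure α) {f : (ι → α) → ℝ≥0∞} (hf : Measurable f)
    (hfin : ∫⁻ z, f z ∂(Measure.pi fun _ : ι => μ) ≠ ∞) :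
    ∃ A : ℕ → ℕ → Set α, (∀ m j, MeasurableSet (A m j) ∧ μ (A m j) ≠ ∞) ∧
      ∀ z, f z ≠ 0 → ∃ m j i, z i ∈ A m j := by
  have key : ∀ m : ℕ, ∃ A : ℕ → Set α, (∀ j, MeasurableSet (A j) ∧ μ (A j) ≠ ∞) ∧
      ∀ z, ((m : ℝ≥0∞) + 1)⁻¹ ≤ f z → ∃ j i, z i ∈ A j := by
    intro m
    have hms : MeasurableSet {z | ((m : ℝ≥0∞) + 1)⁻¹ ≤ f z} := measurableSet_le measurable_const hf
    have hlt : (Measure.pi fun _ : ι => μ) {z | ((m : ℝ≥0∞) + 1)⁻¹ ≤ f z} < ∞ := by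
      have h0 : ((m : ℝ≥0∞) + 1)⁻¹ ≠ 0 := by simp
      exact (meas_ge_le_lintegral_div hf.aemeasurable h0 (by simp)).trans_lt
        (ENNReal.div_lt_top hfin h0)
    rw [Measure.pi, toMeasure_apply _ _ hms, OuterMeasure.pi, OuterMeasure.boundedBy_apply] at hlt
    simp only [iInf_lt_iff] at hlt
    obtain ⟨t, hcov, hsum⟩ := hlt
    have hA : ∀ j, ∃ A : Set α, (MeasurableSet A ∧ μ A ≠ ∞) ∧ ∀ z ∈ t j, ∃ i, z i ∈ A := by
      intro j
      rcases (t j).eq_empty_or_nonempty with he | hne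
      · exact ⟨∅, by simp, by simp [he]⟩
      have hj := ENNReal.ne_top_of_tsum_ne_top hsum.ne j
      rw [iSup_pos hne] at hj
      have hi : ∃ i : ι, μ (Function.eval i '' t j) ≠ ∞ := by
        by_contra! hall
        refine hj ?_
        change ∏ i : ι, μ (Function.eval i '' t j) = ∞
        rw [Finset.prod_congr rfl fun i _ => hall i, Finset.prod_const]
        exact ENNReal.top_pow (by simp)
      obtain ⟨i, hi⟩ := hi
      refine ⟨toMeasurable μ (Function.eval i '' t j), ⟨measurableSet_toMeasurable _ _, ?_⟩,
        fun z hz => ⟨i, subset_toMeasurable _ _ ⟨z, hz, rfl⟩⟩⟩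
      rwa [measure_toMeasurable]
    choose A hA hAt using hA
    refine ⟨A, hA, fun z hz => ?_⟩
    obtain ⟨j, hj⟩ := mem_iUnion.1 (hcov hz)
    exact ⟨j, hAt j z hj⟩
  choose A hA hAf using key
  refine ⟨A, hA, fun z hz => ?_⟩
  obtain ⟨m, hm⟩ := ENNReal.exists_inv_nat_lt hz
  exact ⟨m, hAf m z ((ENNReal.inv_le_inv.2 le_self_add).trans hm.le)⟩

theorem isNRectifiable_of_countable_iUnion {E : Set (EuclideanSpace ℝ (Fin N))} {ι : Type*}
    [Countable ι] [Nonempty ι] {A : ι → Set (EuclideanSpace ℝ (Fin N))} (hE : E ⊆ ⋃ i, A i)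
    (hA : ∀ i, IsNRectifiable N n (A i)) : IsNRectifiable N n E := by
  choose f hf hnull using hA
  obtain ⟨g, hg⟩ := exists_surjective_nat (ι × ℕ)
  refine ⟨fun k => f (g k).1 (g k).2, fun k => hf _ _, measure_mono_null ?_
    (measure_iUnion_null hnull)⟩
  rintro x ⟨hx, hxf⟩
  obtain ⟨i, hi⟩ := mem_iUnion.1 (hE hx)
  refine mem_iUnion.2 ⟨i, hi, fun h => hxf ?_⟩
  obtain ⟨j, hj⟩ := mem_iUnion.1 h
  obtain ⟨k, hk⟩ := hg (i, j)
  exact mem_iUnion.2 ⟨k, by simpa [hk] using hj⟩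

theorem isNRectifiable_of_subset_affineSubspace {E : Set (EuclideanSpace ℝ (Fin N))}
    {S : AffineSubspace ℝ (EuclideanSpace ℝ (Fin N))} (hE : E ⊆ S)
    (hS : Module.finrank ℝ S.direction ≤ n) : IsNRectifiable N n E := by
  rcases E.eq_empty_or_nonempty with rfl | ⟨x₀, hx₀⟩
  · exact ⟨fun _ _ => 0, fun _ => ⟨0, LipschitzWith.const 0⟩, by simp⟩
  have h1 : Module.finrank ℝ S.direction ≤ Module.finrank ℝ (EuclideanSpace ℝ (Fin n)) := by
    simpa using hS
  obtain ⟨g, hg⟩ := finrank_le_iff_exists_linearMap.1 h1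
  obtain ⟨h, hh⟩ := g.exists_leftInverse_of_injective (LinearMap.ker_eq_bot.2 hg)
  set A : EuclideanSpace ℝ (Fin n) →L[ℝ] EuclideanSpace ℝ (Fin N) :=
    LinearMap.toContinuousLinearMap (S.direction.subtype ∘ₗ h)
  refine ⟨fun _ v => A v + x₀, fun _ => ⟨_, A.lipschitz.add (LipschitzWith.const x₀)⟩, ?_⟩
  rw [sdiff_eq_empty.2 ?_, measure_empty]
  intro x hx
  have hd : x - x₀ ∈ S.direction := S.vsub_mem_direction (hE hx) (hE hx₀)
  refine mem_iUnion.2 ⟨0, g ⟨x - x₀, hd⟩, ?_⟩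
  have h2 : h (g ⟨x - x₀, hd⟩) = ⟨x - x₀, hd⟩ := LinearMap.congr_fun hh _
  change ((h (g ⟨x - x₀, hd⟩) : S.direction) : EuclideanSpace ℝ (Fin N)) + x₀ = x
  rw [h2, sub_add_cancel]

theorem AffineIndependent.exists_isHSimplex {m : ℕ}
    {y : Fin (m + 2) → EuclideanSpace ℝ (Fin N)} (hy : AffineIndependent ℝ y) :
    ∃ σ > 0, IsHSimplex N σ y := by
  have hpos : ∀ i, 0 < infDist (y i)
      (affineSpan ℝ (y '' {i}ᶜ) : Set (EuclideanSpace ℝ (Fin N))) := by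
    intro i
    have hne : (affineSpan ℝ (y '' {i}ᶜ) : Set (EuclideanSpace ℝ (Fin N))).Nonempty := by
      rw [affineSpan_nonempty ℝ]
      obtain ⟨j, hj⟩ := exists_ne i
      exact ⟨y j, j, hj, rfl⟩
    refine ((AffineSubspace.closed_of_finiteDimensional _).notMem_iff_infDist_pos hne).1 ?_
    have := hy.notMem_affineSpan_sdiff i univ
    rwa [← compl_eq_univ_sdiff] at this
  refine ⟨Finset.univ.inf' Finset.univ_nonempty fun i => infDist (y i)
      (affineSpan ℝ (y '' {i}ᶜ) : Set (EuclideanSpace ℝ (Fin N))), ?_, fun i => ?_⟩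
  · exact (Finset.lt_inf'_iff _).2 fun i _ => hpos i
  · exact Finset.inf'_le _ (Finset.mem_univ i)

theorem mem_affineSpan_of_integrand_eq_zero (hn : 1 ≤ n) (hK : ProperIntegrand N n 2 K)
    {y : Fin (n + 1) → EuclideanSpace ℝ (Fin N)} (hy : AffineIndependent ℝ y)
    {w : EuclideanSpace ℝ (Fin N)} (h0 : K (Fin.snoc y w) = 0) :
    w ∈ affineSpan ℝ (range y) := by
  obtain ⟨m, rfl⟩ := Nat.exists_eq_add_of_le' hn
  obtain ⟨σ, hσ, hsim⟩ := hy.exists_isHSimplex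
  obtain ⟨-, -, ⟨c, hc, l, hl, hineq⟩, -, -⟩ := hK
  obtain ⟨R, hR⟩ := ((isBounded_convexHull.2 (finite_range y).isBounded).union
    (Bornology.isBounded_singleton (x := w))).subset_closedBall 0
  set C := max 1 (max R σ⁻¹) with hC
  have hC1 : 1 ≤ C := le_max_left _ _
  have hCR : R ≤ C * 1 := by rw [mul_one]; exact (le_max_left _ _).trans (le_max_right _ _)
  have hsub := hR.trans (closedBall_subset_closedBall hCR)
  have h1 := hineq 1 one_pos C hC1 0 y
    (fun i => le_trans (by
      rw [one_div]
      exact inv_le_of_inv_le₀ hσ ((le_max_right _ _).trans (le_max_right _ _))) (hsim i))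
    (subset_union_left.trans hsub) w (hsub (Or.inr rfl))
  rw [h0, Real.zero_rpow two_ne_zero, mul_zero, div_one] at h1
  have h2 : infDist w (affineSpan ℝ (range y) : Set (EuclideanSpace ℝ (Fin N))) = 0 := by
    by_contra hne
    have := Real.rpow_pos_of_pos (lt_of_le_of_ne infDist_nonneg (Ne.symm hne)) 2
    linarith
  exact ((AffineSubspace.closed_of_finiteDimensional _).mem_iff_infDist_zero
    ((affineSpan_nonempty ℝ).2 (range_nonempty y))).2 h2

theorem isNRectifiable_of_integrand_eq_zero (hn : 1 ≤ n) (hK : ProperIntegrand N n 2 K)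
    {F : Set (EuclideanSpace ℝ (Fin N))} (hF : ∀ z, (∀ i, z i ∈ F) → K z = 0) :
    IsNRectifiable N n F := by
  by_cases hex : ∃ y : Fin (n + 1) → EuclideanSpace ℝ (Fin N), AffineIndependent ℝ y ∧ ∀ i, y i ∈ F
  · obtain ⟨y, hy, hyF⟩ := hex
    refine isNRectifiable_of_subset_affineSubspace (S := affineSpan ℝ (range y)) (fun w hw => ?_) ?_
    · refine mem_affineSpan_of_integrand_eq_zero hn hK hy (hF _ fun i => ?_)
      refine Fin.lastCases ?_ (fun j => ?_) i
      · simpa using hw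
      · simpa using hyF j
    · rw [direction_affineSpan]
      exact (hy.finrank_vectorSpan (by simp)).le
  · obtain ⟨t, htF, hspan, ht⟩ := exists_affineIndependent ℝ (EuclideanSpace ℝ (Fin N)) F
    have := finite_of_fin_dim_affineIndependent ℝ ht
    have := Fintype.ofFinite t
    have hcard : Fintype.card t ≤ n := by
      by_contra! hlt
      have hle : Fintype.card (Fin (n + 1)) ≤ Fintype.card t := by simpa using hlt
      obtain ⟨e⟩ := Function.Embedding.nonempty_of_card_le hle
      exact hex ⟨fun i => (e i : EuclideanSpace ℝ (Fin N)), ht.comp_embedding e,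
        fun i => htF (e i).2⟩
    refine isNRectifiable_of_subset_affineSubspace (S := affineSpan ℝ F) (subset_affineSpan ℝ F) ?_
    rw [← hspan, direction_affineSpan]
    rcases isEmpty_or_nonempty t with he | hne
    · have : t = ∅ := isEmpty_coe_sort.1 he
      rw [this, vectorSpan_empty, finrank_bot]
      exact Nat.zero_le n
    · have h1 := finrank_vectorSpan_range_le ℝ (fun i : t => (i : EuclideanSpace ℝ (Fin N)))
        (n := Fintype.card t - 1) (by have := Fintype.card_pos (α := t); omega)
      rw [Subtype.range_coe] at h1
      omega

theorem measurableSet_range_of_lipschitzWith {f : EuclideanSpace ℝ (Fin n) → EuclideanSpace ℝ (Fin N)}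
    (hf : ∃ L, LipschitzWith L f) : MeasurableSet (range f) := by
  obtain ⟨L, hL⟩ := hf
  obtain ⟨C, hC, hU⟩ := isSigmaCompact_range hL.continuous
  rw [← hU]
  exact MeasurableSet.iUnion fun i => (hC i).measurableSet

/-- There is a countable union of Lipschitz images capturing as much of a finite measure as
possible. -/
theorem exists_maximal_lipschitz_family (μ : Measure (EuclideanSpace ℝ (Fin N))) [IsFiniteMeasure μ] :
    ∃ g : ℕ → EuclideanSpace ℝ (Fin n) → EuclideanSpace ℝ (Fin N),
      (∀ i, ∃ L : ℝ≥0, LipschitzWith L (g i)) ∧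
      ∀ f : EuclideanSpace ℝ (Fin n) → EuclideanSpace ℝ (Fin N), (∃ L, LipschitzWith L f) →
        μ (range f \ ⋃ i, range (g i)) = 0 := by
  set 𝒞 : Set (ℕ → EuclideanSpace ℝ (Fin n) → EuclideanSpace ℝ (Fin N)) :=
    {g | ∀ i, ∃ L : ℝ≥0, LipschitzWith L (g i)} with h𝒞
  have hne : ((fun g : ℕ → EuclideanSpace ℝ (Fin n) → EuclideanSpace ℝ (Fin N) =>
      μ (⋃ i, range (g i))) '' 𝒞).Nonempty :=
    ⟨_, fun _ _ => 0, fun _ => ⟨0, LipschitzWith.const 0⟩, rfl⟩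
  obtain ⟨u, -, hlim, hu⟩ := exists_seq_tendsto_sSup hne (OrderTop.bddAbove _)
  choose g hg hgu using hu
  set G : ℕ → EuclideanSpace ℝ (Fin n) → EuclideanSpace ℝ (Fin N) :=
    fun k => g k.unpair.1 k.unpair.2 with hG
  have hGC : G ∈ 𝒞 := fun k => hg _ _
  have hsub : ∀ k, ⋃ i, range (g k i) ⊆ ⋃ i, range (G i) := fun k => iUnion_subset fun i =>
    subset_iUnion_of_subset (Nat.pair k i) (by simp [hG])
  have hmax := le_of_tendsto' hlim fun k => by
    rw [← hgu k]
    exact measure_mono (μ := μ) (hsub k)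
  refine ⟨G, hGC, fun f hf => ?_⟩
  have hfG : (fun k => Nat.casesOn k f G : ℕ → EuclideanSpace ℝ (Fin n) →
      EuclideanSpace ℝ (Fin N)) ∈ 𝒞 := fun k => by
    cases k with
    | zero => exact hf
    | succ k => exact hGC k
  have hle := (le_sSup (mem_image_of_mem (fun g : ℕ → EuclideanSpace ℝ (Fin n) →
    EuclideanSpace ℝ (Fin N) => μ (⋃ i, range (g i))) hfG)).trans hmax
  have hmeas : MeasurableSet (⋃ i, range (G i)) :=
    MeasurableSet.iUnion fun i => measurableSet_range_of_lipschitzWith (hGC i)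
  have hsum : μ (range f \ ⋃ i, range (G i)) + μ (⋃ i, range (G i)) ≤ 0 + μ (⋃ i, range (G i)) := by
    rw [← measure_union disjoint_sdiff_left hmeas, zero_add]
    refine (measure_mono ?_).trans hle
    rintro x (hx | hx)
    · exact mem_iUnion.2 ⟨0, hx.1⟩
    · obtain ⟨k, hk⟩ := mem_iUnion.1 hx
      exact mem_iUnion.2 ⟨k + 1, hk⟩
  exact le_antisymm ((ENNReal.add_le_add_iff_right (measure_ne_top _ _)).1 hsum) zero_le

theorem isNRectifiable_of_finite_measure (hn : 1 ≤ n) (hK : ProperIntegrand N n 2 K)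
    {E : Set (EuclideanSpace ℝ (Fin N))} (hE : MeasurableSet E) (hfin : μH[(n : ℝ)] E ≠ ∞)
    (hen : MengerEnergy N n 2 K (μH[(n : ℝ)].restrict E) ≠ ∞) : IsNRectifiable N n E := by
  have : IsFiniteMeasure (μH[(n : ℝ)].restrict E) := ⟨by simpa [lt_top_iff_ne_top] using hfin⟩
  obtain ⟨g, hg, hmax⟩ := exists_maximal_lipschitz_family (n := n) (μH[(n : ℝ)].restrict E)
  refine ⟨g, hg, ?_⟩
  by_contra h0
  obtain ⟨f, hf, hfpos⟩ := exists_lipschitz_of_mengerEnergy hn hK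
    (MeasurableSet.diff hE (MeasurableSet.iUnion fun i => measurableSet_range_of_lipschitzWith (hg i)))
    (measure_ne_top_of_subset sdiff_subset hfin) h0
    (ne_top_of_le_ne_top hen (mengerEnergy_mono (Measure.restrict_mono sdiff_subset le_rfl)))
  refine hfpos (measure_mono_null ?_ ((Measure.restrict_apply' hE).symm.trans (hmax f hf)))
  rintro x ⟨⟨hxE, hxg⟩, hxf⟩
  exact ⟨⟨hxf, hxg⟩, hxE⟩

theorem isNRectifiable_of_mengerEnergy (hn : 1 ≤ n) (hK : ProperIntegrand N n 2 K)
    {E : Set (EuclideanSpace ℝ (Fin N))} (hE : MeasurableSet E)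
    (hen : MengerEnergy N n 2 K (μH[(n : ℝ)].restrict E) ≠ ∞) : IsNRectifiable N n E := by
  obtain ⟨A, hA, hcov⟩ := exists_finite_measure_cover (μH[(n : ℝ)].restrict E)
    (hK.2.1.pow_const (2 : ℝ)).ennreal_ofReal hen
  have hflat : IsNRectifiable N n (E \ ⋃ q : ℕ × ℕ, A q.1 q.2) := by
    refine isNRectifiable_of_integrand_eq_zero hn hK fun z hz => ?_
    by_contra hne
    have hpos : 0 < K z ^ (2 : ℝ) := Real.rpow_pos_of_pos (lt_of_le_of_ne (hK.1 z) (Ne.symm hne)) 2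
    obtain ⟨m, j, i, hi⟩ := hcov z (ENNReal.ofReal_pos.2 hpos).ne'
    exact (hz i).2 (mem_iUnion.2 ⟨(m, j), hi⟩)
  have hpiece : ∀ q : ℕ × ℕ, IsNRectifiable N n (A q.1 q.2 ∩ E) := fun q => by
    refine isNRectifiable_of_finite_measure hn hK (MeasurableSet.inter (hA _ _).1 hE) ?_
      (ne_top_of_le_ne_top hen (mengerEnergy_mono (Measure.restrict_mono inter_subset_right le_rfl)))
    rw [← Measure.restrict_apply' hE]
    exact (hA _ _).2
  refine isNRectifiable_of_countable_iUnion (ι := Option (ℕ × ℕ))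
    (A := fun o => Option.casesOn o (E \ ⋃ q : ℕ × ℕ, A q.1 q.2) fun q => A q.1 q.2 ∩ E)
    (fun x hx => ?_) (fun o => ?_)
  · by_cases hxA : x ∈ ⋃ q : ℕ × ℕ, A q.1 q.2
    · obtain ⟨q, hq⟩ := mem_iUnion.1 hxA
      exact mem_iUnion.2 ⟨some q, hq, hx⟩
    · exact mem_iUnion.2 ⟨none, hx, hxA⟩
  · cases o with
    | none => exact hflat
    | some q => exact hpiece q

end Decomposition

/-- **Theorem (main result).** Let `1 ≤ n < N` and let `K : (ℝ^N)^{n+2} → [0,∞)` be such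
that `K^2` is a proper integrand. If `E ⊆ ℝ^N` is a Borel set with `M_{K^2}(E) < ∞`,
then `E` is `n`-rectifiable. -/
theorem menger_rectifiable {N n : ℕ} (hn : 1 ≤ n) (hnN : n < N)
    (K : (Fin (n + 2) → EuclideanSpace ℝ (Fin N)) → ℝ)
    (hK : ProperIntegrand N n 2 K)
    (E : Set (EuclideanSpace ℝ (Fin N))) (hE : MeasurableSet E)
    (hfin : MengerEnergy N n 2 K (μH[(n : ℝ)].restrict E) < ⊤) :
    IsNRectifiable N n E :=
  isNRectifiable_of_mengerEnergy hn hK hE hfin.ne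

end
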